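/- arXiv:1908.09661 — 2 statements merged into one kernel-verified Lean document; each statement's English description precedes it below -/
import Mathlib

section
/- Let (V₁,b₁) and (V₂,b₂) be non-degenerate alternating bilinear K[u]-modules on which u acts as a single Jordan block of size 2ℓ and 2k respectively (ℓ, k ≥ 1). Then: (i) every Jordan block size of u⊗u on V₁⊗V₂ is even and occurs with even multiplicity; and (ii) if ν₂(ℓ) ≠ ν₂(k), then ε_{V₁⊗V₂, b₁⊗b₂}(d) = 0 for all d ≥ 1. -/
set_option maxSynthPendingDepth 3

open Module LinearMap

noncomputable section

/-- Multiplicity of a Jordan block of size `d` of a unipotent map `u`, computed from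
`f = u - 1` as `rank f^(d-1) - 2 rank f^d + rank f^(d+1)`. -/
def jordanMult (K : Type*) [Field K] {V : Type*} [AddCommGroup V] [Module K V]
    (f : V →ₗ[K] V) (d : ℕ) : ℕ :=
  Module.finrank K (LinearMap.range (f ^ (d - 1))) +
    Module.finrank K (LinearMap.range (f ^ (d + 1))) -
    2 * Module.finrank K (LinearMap.range (f ^ d))

open Classical in
/-- The invariant ε_{V,b}(d) of Hesselink/Spaltenstein, computed from `f = u - 1`. -/
def eps (K : Type*) [Field K] {V : Type*} [AddCommGroup V] [Module K V]
    (f : V →ₗ[K] V) (b : V →ₗ[K] V →ₗ[K] K) (d : ℕ) : ℕ :=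
  if ∃ v : V, (f ^ d) v = 0 ∧ b ((f ^ (d - 1)) v) v ≠ 0 then 1 else 0

/-- A linear endomorphism is unipotent if `(f - 1)^N = 0` for some `N`. -/
def IsUnipotent (K : Type*) [Field K] {V : Type*} [AddCommGroup V] [Module K V]
    (f : V →ₗ[K] V) : Prop :=
  ∃ N : ℕ, (f - 1) ^ N = 0

/-- The standard single unipotent Jordan block of size `m` over `K`. -/
def jordanBlockMap (K : Type*) [Field K] (m : ℕ) : (Fin m → K) →ₗ[K] (Fin m → K) :=
  Matrix.toLin' (1 + Matrix.of fun i j : Fin m => if (i : ℕ) + 1 = (j : ℕ) then 1 else 0)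

end

section
variable {K : Type*} [Field K]

/-- Shift. -/
lemma exists_shift (n : ℕ) (hn : 1 ≤ n) :
    ∃ (N : (Fin n → K) →ₗ[K] (Fin n → K)),
      (∀ j : Fin n, (N ^ (j : ℕ)) (Pi.basisFun K (Fin n) ⟨0, hn⟩) = Pi.basisFun K (Fin n) j) ∧
      N ^ n = 0 := by
  classical
  set B := Pi.basisFun K (Fin n) with hB
  let N : (Fin n → K) →ₗ[K] (Fin n → K) :=
    B.constr K (fun j => if h : (j : ℕ) + 1 < n then B ⟨j + 1, h⟩ else 0)
  have hN : ∀ j, N (B j) = if h : (j : ℕ) + 1 < n then B ⟨j + 1, h⟩ else 0 := by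
    intro j; exact B.constr_basis K _ j
  have h1 : ∀ j (hj : j < n), (N ^ j) (B ⟨0, hn⟩) = B ⟨j, hj⟩ := by
    intro j
    induction j with
    | zero => intro hj; simp
    | succ j ih =>
      intro hj
      rw [pow_succ', Module.End.mul_apply, ih (by omega), hN]
      simp [hj]
  refine ⟨N, fun j => h1 j j.2, ?_⟩
  apply B.ext
  intro j
  rw [← h1 j j.2, ← Module.End.mul_apply, ← pow_add]
  obtain ⟨n, rfl⟩ : ∃ m, n = m + 1 := ⟨n - 1, by omega⟩
  have h2 : (N ^ (n+1)) (B ⟨0, hn⟩) = 0 := by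
    rw [pow_succ', Module.End.mul_apply, h1 n (by omega), hN]; simp
  rw [Nat.add_comm (n + 1) (j : ℕ), pow_add, Module.End.mul_apply, h2]; simp

lemma gen_of_block {V : Type*} [AddCommGroup V] [Module K V] [FiniteDimensional K V]
    (x : V →ₗ[K] V) (n : ℕ) (hn : 1 ≤ n) (hd : finrank K V = n) (h0 : x ^ n = 0)
    (w : V) (h1 : (x ^ (n - 1)) w ≠ 0)
    (S : Submodule K V) (hw : w ∈ S) (hx : ∀ v ∈ S, x v ∈ S) : S = ⊤ := by
  have hp : ∀ i : ℕ, (x ^ i) w ∈ S := by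
    intro i
    induction i with
    | zero => simpa
    | succ i ih => rw [pow_succ', Module.End.mul_apply]; exact hx _ ih
  have li : LinearIndependent K (fun i : Fin n => (x ^ (i : ℕ)) w) := by
    rw [Fintype.linearIndependent_iff]
    intro g hg
    by_contra! hne
    have hex : ∃ i : ℕ, ∃ h : i < n, g ⟨i, h⟩ ≠ 0 := by
      obtain ⟨i, hi⟩ := hne; exact ⟨i, i.2, hi⟩
    classical
    obtain ⟨hlt, hi⟩ := Nat.find_spec hex
    set i := Nat.find hex with hidef
    have hmin : ∀ j : Fin n, (j : ℕ) < i → g j = 0 := by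
      intro j hj
      have := Nat.find_min hex hj
      push Not at this
      exact this j.2
    have := congrArg (x ^ (n - 1 - i)) hg
    rw [map_sum, Finset.sum_eq_single ⟨i, hlt⟩] at this
    · rw [map_smul, ← Module.End.mul_apply, ← pow_add, map_zero] at this
      rw [show n - 1 - i + i = n - 1 by omega] at this
      exact (smul_ne_zero hi h1) this
    · intro j _ hj
      rw [map_smul, ← Module.End.mul_apply, ← pow_add]
      rcases lt_trichotomy (j : ℕ) i with h | h | h
      · simp [hmin j h]
      · exact absurd (Fin.ext h) hj
      · rw [show n - 1 - i + j = n + (j - 1 - i) by omega, pow_add, h0]; simp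
    · simp
  have hspan := li.span_eq_top_of_card_eq_finrank' (by simp [hd])
  rw [eq_top_iff, ← hspan, Submodule.span_le]
  rintro _ ⟨i, rfl⟩
  exact hp i

lemma exists_model {V : Type*} [AddCommGroup V] [Module K V] [FiniteDimensional K V]
    (x : V →ₗ[K] V) (R n : ℕ) (hR : 1 ≤ R) (hn : 1 ≤ n) (hd : finrank K V = R * n)
    (h0 : x ^ (R * n) = 0) (h1 : x ^ (R * n - 1) ≠ 0) :
    ∃ (ι : (Fin n → K) →ₗ[K] V) (N : (Fin n → K) →ₗ[K] (Fin n → K)),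
      (∀ m, (x ^ R) (ι m) = ι (N m)) ∧
      (∀ S : Submodule K V, (∀ m, ι m ∈ S) → (∀ v ∈ S, x v ∈ S) → S = ⊤) ∧
      (∀ j : Fin n, (N ^ (j : ℕ)) (Pi.basisFun K (Fin n) ⟨0, hn⟩) = Pi.basisFun K (Fin n) j) ∧
      N ^ n = 0 := by
  obtain ⟨N, hN, hN0⟩ := exists_shift (K := K) n hn
  obtain ⟨w, hw⟩ : ∃ w, (x ^ (R * n - 1)) w ≠ 0 := by
    by_contra! h; exact h1 (LinearMap.ext h)
  set B := Pi.basisFun K (Fin n) with hB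
  let ι : (Fin n → K) →ₗ[K] V := B.constr K (fun j => (x ^ (R * (j : ℕ))) w)
  have hι : ∀ j, ι (B j) = (x ^ (R * (j : ℕ))) w := by
    intro j; exact B.constr_basis K _ j
  have hx : (x ^ R) ∘ₗ ι = ι ∘ₗ N := by
    apply B.ext
    intro j
    simp only [LinearMap.comp_apply]
    rw [hι, ← Module.End.mul_apply, ← pow_add, ← hN j, ← Module.End.mul_apply, ← pow_succ']
    by_cases h : (j : ℕ) + 1 < n
    · rw [hN ⟨j + 1, h⟩, hι]; simp; ring_nf
    · have : (j : ℕ) + 1 = n := by omega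
      rw [this, hN0, show R + R * (j : ℕ) = R * n by nlinarith, h0]; simp
  refine ⟨ι, N, fun m => LinearMap.congr_fun hx m, ?_, hN, hN0⟩
  intro S hS hSx
  refine gen_of_block x (R * n) (by nlinarith) hd h0 w hw S ?_ hSx
  have := hS (B ⟨0, hn⟩)
  rw [hι] at this
  simpa using this

/-- Induced-module decomposition. -/
lemma induced {W Y : Type*} [AddCommGroup W] [Module K W] [FiniteDimensional K W]
    [AddCommGroup Y] [Module K Y] [FiniteDimensional K Y]
    (X : W →ₗ[K] W) (ι : Y →ₗ[K] W) (σ : Y →ₗ[K] Y) (R : ℕ) (hR : 1 ≤ R)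
    (hσ : ∀ y, (X ^ R) (ι y) = ι (σ y))
    (hd : R * finrank K Y = finrank K W)
    (hgen : ∀ S : Submodule K W, (∀ m, ι m ∈ S) → (∀ v ∈ S, X v ∈ S) → S = ⊤) :
    ∃ Φ : (Fin R → Y) ≃ₗ[K] W, ∀ y, Φ y = ∑ i : Fin R, (X ^ (i : ℕ)) (ι (y i)) := by
  let F : (Fin R → Y) →ₗ[K] W :=
    ∑ i : Fin R, (X ^ (i : ℕ)) ∘ₗ ι ∘ₗ LinearMap.proj i
  have hF : ∀ y, F y = ∑ i : Fin R, (X ^ (i : ℕ)) (ι (y i)) := by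
    intro y; simp [F]
  have hmem : ∀ (i : ℕ) (y : Y), i < R → (X ^ i) (ι y) ∈ LinearMap.range F := by
    intro i y hi
    refine ⟨Pi.single ⟨i, hi⟩ y, ?_⟩
    rw [hF, Finset.sum_eq_single ⟨i, hi⟩]
    · simp
    · intro j _ hj; simp [Pi.single_eq_of_ne hj]
    · simp
  have hr : LinearMap.range F = ⊤ := by
    apply hgen
    · intro m; simpa using hmem 0 m hR
    · rintro _ ⟨y, rfl⟩
      rw [hF, map_sum]
      refine Submodule.sum_mem _ fun i _ => ?_
      rw [← Module.End.mul_apply, ← pow_succ']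
      by_cases h : (i : ℕ) + 1 < R
      · exact hmem _ _ h
      · have : (i : ℕ) + 1 = R := by omega
        rw [this, hσ]; simpa using hmem 0 (σ (y i)) hR
  have hfr : finrank K (Fin R → Y) = finrank K W := by
    rw [Module.finrank_pi_fintype]; simp [hd]
  have hsurj : Function.Surjective F := LinearMap.range_eq_top.1 hr
  have hinj : Function.Injective F := (LinearMap.injective_iff_surjective_of_finrank_eq_finrank hfr).2 hsurj
  exact ⟨LinearEquiv.ofBijective F ⟨hinj, hsurj⟩, fun y => hF y⟩
end

section
variable {K : Type*} [Field K] {W : Type*} [AddCommGroup W] [Module K W]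

/-- `b` is invariant under `1 + X` (characteristic two form). -/
def Adj (b : W →ₗ[K] W →ₗ[K] K) (X : W →ₗ[K] W) : Prop :=
  ∀ a w, b a (X w) = b (X a) (w + X w)

variable {b : W →ₗ[K] W →ₗ[K] K} {X : W →ₗ[K] W}

lemma adj_of_inv [CharP K 2] (h : ∀ v w, b (v + X v) (w + X w) = b v w) : Adj b X := by
  intro a w
  have := h a w
  simp only [map_add, LinearMap.add_apply] at this ⊢
  have h2 : (2 : K) = 0 := CharTwo.two_eq_zero
  linear_combination this - (b (X a) w + b (X a) (X w)) * h2

lemma adj_sq [CharP K 2] (h : Adj b X) : Adj b (X ^ 2) := by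
  intro a w
  have h1 := h a (X w)
  have h2 := h (X a) (w + X w)
  have h0 : (2 : K) = 0 := CharTwo.two_eq_zero
  simp only [pow_two, Module.End.mul_apply, map_add] at *
  linear_combination h1 + h2 + b (X (X a)) (X w) * h0

lemma adj_pow_two [CharP K 2] (h : Adj b X) (i : ℕ) : Adj b (X ^ (2 ^ i)) := by
  induction i with
  | zero => simpa using h
  | succ i ih => rw [pow_succ, pow_mul]; exact adj_sq ih

lemma adj_pow_U (h : Adj b X) (n : ℕ) (a w : W) :
    b a ((X ^ n) w) = b ((X ^ n) a) (((1 + X) ^ n) w) := by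
  induction n generalizing a w with
  | zero => simp
  | succ n ih =>
    rw [pow_succ', Module.End.mul_apply, h,
      show (X ^ n) w + X ((X ^ n) w) = (X ^ n) (w + X w) by
        rw [map_add, ← Module.End.mul_apply, ← pow_succ', pow_succ, Module.End.mul_apply], ih,
      ← Module.End.mul_apply, ← pow_succ, ← pow_succ', pow_succ (1 + X), Module.End.mul_apply]
    rfl

lemma U_pow (n : ℕ) (w : W) : ∃ w', ((1 + X) ^ n) w = w + X w' := by
  induction n with
  | zero => exact ⟨0, by simp⟩
  | succ n ih =>
    obtain ⟨w', hw⟩ := ih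
    refine ⟨w' + w + X w', ?_⟩
    rw [pow_succ', Module.End.mul_apply, hw]
    simp; abel

lemma adj_X_zero (h : Adj b X) (n : ℕ) (a w : W) (ha : (X ^ (n + 1)) a = 0) :
    b ((X ^ n) a) (X w) = 0 := by
  rw [h, ← Module.End.mul_apply, ← pow_succ', ha]; simp

lemma adj_pow (h : Adj b X) (n : ℕ) (a w : W) (ha : (X ^ (n + 1)) a = 0) :
    b a ((X ^ n) w) = b ((X ^ n) a) w := by
  obtain ⟨w', hw⟩ := U_pow (X := X) n w
  rw [adj_pow_U h, hw, map_add, adj_X_zero h n a w' ha, add_zero]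

lemma q_add [CharP K 2] (h : Adj b X) (hs : ∀ v w, b v w = b w v) (n : ℕ) (v w : W)
    (hv : (X ^ (n + 1)) v = 0) :
    b ((X ^ n) (v + w)) (v + w) = b ((X ^ n) v) v + b ((X ^ n) w) w := by
  have h1 := adj_pow h n v w hv
  rw [hs] at h1
  have h0 : (2 : K) = 0 := CharTwo.two_eq_zero
  simp only [map_add, LinearMap.add_apply]
  linear_combination h1 + b ((X ^ n) v) w * h0

lemma q_sum [CharP K 2] (h : Adj b X) (hs : ∀ v w, b v w = b w v) (n : ℕ) {ι : Type*}
    (s : Finset ι) (f : ι → W) (hf : ∀ i ∈ s, (X ^ (n + 1)) (f i) = 0)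
    (hq : ∀ i ∈ s, b ((X ^ n) (f i)) (f i) = 0) :
    b ((X ^ n) (∑ i ∈ s, f i)) (∑ i ∈ s, f i) = 0 := by
  classical
  induction s using Finset.induction_on with
  | empty => simp
  | insert i s hi ih =>
    rw [Finset.sum_insert hi, q_add h hs n _ _ (hf i (by simp)), hq i (by simp),
      ih (fun j hj => hf j (by simp [hj])) (fun j hj => hq j (by simp [hj])), add_zero]

lemma q_X_zero (h : Adj b X) (n : ℕ) (w : W) (hw : (X ^ (n + 2)) w = 0) :
    b ((X ^ n) (X w)) (X w) = 0 := by
  apply adj_X_zero h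
  rw [← Module.End.mul_apply, ← pow_succ]; exact hw

lemma U_pow_odd [CharP K 2] (m : ℕ) (w : W) : ∃ w', ((1 + X) ^ (2 * m + 1)) w = w + X w + X (X w') := by
  have h0 : ∀ v : W, v + v = 0 := fun v => by
    rw [← two_smul K v, CharTwo.two_eq_zero, zero_smul]
  induction m with
  | zero => exact ⟨0, by simp⟩
  | succ n ih =>
    obtain ⟨w', hw⟩ := ih
    refine ⟨w' + w + X w + X (X w'), ?_⟩
    rw [show 2 * (n + 1) + 1 = (2 * n + 1) + 1 + 1 by ring, pow_succ', pow_succ', Module.End.mul_apply,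
      Module.End.mul_apply, hw]
    simp only [LinearMap.add_apply, Module.End.one_apply, map_add]
    linear_combination (norm := module) h0 (X w) + h0 (X (X w)) + h0 (X (X (X w')))

lemma q_half [CharP K 2] (h : Adj b X) (halt : ∀ v, b v v = 0) (m : ℕ) (v : W)
    (hv : (X ^ (4 * m + 4)) v = 0) :
    b ((X ^ (4 * m + 3)) v) v = b ((X ^ (4 * m + 2)) v) v := by
  have h1 := adj_pow_U h (2 * m + 1) ((X ^ (2 * m + 1)) v) v
  rw [halt, ← Module.End.mul_apply, ← pow_add, show 2 * m + 1 + (2 * m + 1) = 4 * m + 2 by ring] at h1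
  obtain ⟨w', hw⟩ := U_pow_odd (X := X) m v
  have h2 : b ((X ^ (4 * m + 2)) v) (X (X w')) = 0 := by
    rw [h, ← Module.End.mul_apply, ← pow_succ', ← map_add]
    exact adj_X_zero h _ _ _ hv
  rw [hw, map_add, h2, map_add, h ((X ^ (4 * m + 2)) v) v, ← Module.End.mul_apply, ← pow_succ',
    map_add, adj_X_zero h _ _ _ hv] at h1
  have h0 : (2 : K) = 0 := CharTwo.two_eq_zero
  have e : 4 * m + 3 = 4 * m + 2 + 1 := rfl
  rw [e]
  linear_combination - h1 - b ((X ^ (4 * m + 2)) v) v * h0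

lemma q_reduce [CharP K 2] (h : Adj b X) (halt : ∀ v, b v v = 0) (a e : ℕ) (v : W)
    (hv : (X ^ (2 ^ (a + 1) * (e + 1))) v = 0) :
    b ((X ^ (2 ^ (a + 1) * (e + 1) - 1)) v) v =
      b ((X ^ (2 ^ (a + 1) * (e + 1) - 2 ^ a)) v) v := by
  induction a generalizing e with
  | zero => simp
  | succ a ih =>
    have hp : 2 ^ (a + 1 + 1) * (e + 1) = 2 ^ (a + 1) * ((2 * e + 1) + 1) := by ring
    rw [hp] at hv ⊢
    rw [ih _ hv]
    have h3 := q_half (adj_pow_two h a) halt e v (by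
      rw [← pow_mul]; convert hv using 3; ring)
    rw [← pow_mul, ← pow_mul] at h3
    have hpos : 1 ≤ 2 ^ a := Nat.one_le_two_pow
    have e1 : 2 ^ (a + 1) * ((2 * e + 1) + 1) = 2 ^ a * (4 * e + 3) + 2 ^ a := by ring
    have e2 : 2 ^ (a + 1) * ((2 * e + 1) + 1) = 2 ^ a * (4 * e + 2) + 2 ^ (a + 1) := by ring
    rw [show 2 ^ (a + 1) * ((2 * e + 1) + 1) - 2 ^ a = 2 ^ a * (4 * e + 3) by omega,
      show 2 ^ (a + 1) * ((2 * e + 1) + 1) - 2 ^ (a + 1) = 2 ^ a * (4 * e + 2) by omega]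
    exact h3

lemma q_split [CharP K 2] {γ : W →ₗ[K] W →ₗ[K] K} (h : Adj γ X)
    (hb : ∀ v w, b v w = γ v w + γ w v) (n : ℕ) (v : W) (hv : (X ^ (n + 1)) v = 0) :
    b ((X ^ n) v) v = 0 := by
  rw [hb, adj_pow h n v v hv]; exact CharTwo.add_self_eq_zero _

/-- Alternating invariant forms on a single odd block split. -/
lemma odd_split [CharP K 2] (m : ℕ) (B : Basis (Fin (2 * m + 1)) K W)
    (N : W →ₗ[K] W) (hN : ∀ j : Fin (2 * m + 1), (N ^ (j : ℕ)) (B 0) = B j)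
    (hN0 : N ^ (2 * m + 1) = 0) (b : W →ₗ[K] W →ₗ[K] K) (halt : ∀ v, b v v = 0)
    (h : Adj b N) :
    ∃ β : W →ₗ[K] W →ₗ[K] K, Adj β N ∧ ∀ v w, b v w = β v w + β w v := by
  have h0 : ∀ v : W, v + v = 0 := fun v => by
    rw [← two_smul K v, CharTwo.two_eq_zero, zero_smul]
  have hs : ∀ v w, b v w = b w v := by
    intro v w
    have := halt (v + w)
    simp only [map_add, LinearMap.add_apply, halt, zero_add, add_zero] at this
    exact (CharTwo.add_eq_zero.1 this).symm
  obtain ⟨z', hz1, hz2⟩ : ∃ z' : W →ₗ[K] W, (1 + N) * z' = 1 ∧ z' * (1 + N) = 1 := by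
    have : IsUnit (1 + N) := IsNilpotent.isUnit_one_add ⟨_, hN0⟩
    obtain ⟨u, hu⟩ := this
    exact ⟨↑u⁻¹, by rw [← hu]; simp, by rw [← hu]; simp⟩
  set t : W →ₗ[K] W := z' * N with ht
  have hcomm : Commute z' N := by
    have : z' * N = z' * N * ((1 + N) * z') := by rw [hz1, mul_one]
    have h3 : z' * N * ((1 + N) * z') = z' * (1 + N) * N * z' := by noncomm_ring
    rw [hz2, one_mul] at h3
    exact this.trans h3
  have hzt : z' + t = 1 := by rw [ht, ← hz2, mul_add, mul_one]
  have ht0 : t ^ (2 * m + 1) = 0 := by rw [ht, hcomm.mul_pow, hN0, mul_zero]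
  have hbt : ∀ v w, b v (N w) = b (t v) w := by
    intro v w
    have e1 : v = z' v + t v := by
      rw [← LinearMap.add_apply, hzt]; simp
    have e2 : N (z' v) = t v := by rw [ht, hcomm.eq]; rfl
    have e3 := h (z' v) w
    have e4 : b v (N w) = b (z' v) (N w) + b (t v) (N w) := by
      conv_lhs => rw [e1]
      simp
    rw [e4, e3, e2, map_add]
    have := CharTwo.add_self_eq_zero (b (t v) (N w))
    linear_combination this
  have hspan : ∀ v : W, ∃ (c : K) (v' : W), v = c • B 0 + N v' := by
    have hS : Submodule.span K {B 0} ⊔ LinearMap.range N = ⊤ := by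
      rw [eq_top_iff, ← B.span_eq, Submodule.span_le]
      rintro _ ⟨j, rfl⟩
      by_cases hj : (j : ℕ) = 0
      · have : j = 0 := Fin.ext hj
        rw [this]
        exact Submodule.mem_sup_left (Submodule.mem_span_singleton_self _)
      · apply Submodule.mem_sup_right
        obtain ⟨i, hi⟩ : ∃ i, (j : ℕ) = i + 1 := ⟨j - 1, by omega⟩
        rw [← hN j, hi, pow_succ', Module.End.mul_apply]
        exact ⟨_, rfl⟩
    intro v
    have hv : v ∈ Submodule.span K {B 0} ⊔ LinearMap.range N := by rw [hS]; trivial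
    obtain ⟨y, hy, _, ⟨v', rfl⟩, rfl⟩ := Submodule.mem_sup.1 hv
    obtain ⟨c, rfl⟩ := Submodule.mem_span_singleton.1 hy
    exact ⟨c, v', rfl⟩
  have hsoc : b ((N ^ (2 * m)) (B 0)) (B 0) = 0 := by
    have h1 := adj_pow_U h m ((N ^ m) (B 0)) (B 0)
    rw [halt, ← Module.End.mul_apply, ← pow_add, ← two_mul] at h1
    obtain ⟨w', hw⟩ := U_pow (X := N) m (B 0)
    rw [hw, map_add, adj_X_zero h (2 * m) _ _ (by rw [hN0]; rfl), add_zero] at h1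
    exact h1.symm
  let φ' : W →ₗ[K] K := B.constr K
    (fun j => if (j : ℕ) = 0 then 0 else b ((N ^ ((j : ℕ) - 1)) (B 0)) (B 0))
  have hφB : ∀ j, φ' (B j) = if (j : ℕ) = 0 then 0 else b ((N ^ ((j : ℕ) - 1)) (B 0)) (B 0) :=
    fun j => B.constr_basis K _ j
  have hφ' : ∀ v, φ' (N v) = b v (B 0) := by
    have : φ' ∘ₗ N = b.flip (B 0) := by
      apply B.ext
      intro j
      simp only [LinearMap.comp_apply, LinearMap.flip_apply]
      rw [← hN j, ← Module.End.mul_apply, ← pow_succ']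
      by_cases hj : (j : ℕ) + 1 < 2 * m + 1
      · have e := hN ⟨j + 1, hj⟩
        simp only at e
        rw [e, hφB]
        simp
      · have hj' : (j : ℕ) = 2 * m := by omega
        rw [hj', hN0, hsoc]; simp
    intro v
    exact LinearMap.congr_fun this v
  let φ : W →ₗ[K] K := φ' ∘ₗ (1 + N)
  let γ : W →ₗ[K] W →ₗ[K] K := B.constr K (fun j => φ ∘ₗ (t ^ (j : ℕ)))
  have hγB : ∀ j v, γ (B j) v = φ ((t ^ (j : ℕ)) v) := by
    intro j v
    have : γ (B j) = φ ∘ₗ (t ^ (j : ℕ)) := B.constr_basis K _ j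
    rw [this]; rfl
  have hγN : ∀ w v, γ (N w) v = γ w (t v) := by
    have : γ ∘ₗ N = (LinearMap.lcomp K K t) ∘ₗ γ := by
      apply B.ext
      intro j
      ext v
      simp only [LinearMap.comp_apply, LinearMap.lcomp_apply]
      rw [hγB, ← hN j, ← Module.End.mul_apply, ← Module.End.mul_apply, ← pow_succ', ← pow_succ]
      by_cases hj : (j : ℕ) + 1 < 2 * m + 1
      · have e := hN ⟨j + 1, hj⟩
        simp only at e
        rw [e, hγB]
      · have hj' : (j : ℕ) + 1 = 2 * m + 1 := by omega
        rw [hj', hN0, ht0]; simp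
    intro w v
    exact LinearMap.congr_fun (LinearMap.congr_fun this w) v
  have hNz : ∀ v, v + N v = (1 + N) v := fun v => rfl
  have hUt : ∀ v, (1 + N) (t v) = N v := by
    intro v
    rw [← Module.End.mul_apply, ht, ← mul_assoc, hz1, one_mul]
  have hbtpow : ∀ (j : ℕ) v w, b v ((N ^ j) w) = b ((t ^ j) v) w := by
    intro j
    induction j with
    | zero => simp
    | succ j ih =>
      intro v w
      rw [pow_succ', Module.End.mul_apply, hbt, ih, ← Module.End.mul_apply, ← pow_succ]
  have hγb : ∀ w v, γ w (t v) = b v w := by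
    have : (LinearMap.lcomp K K t) ∘ₗ γ = b.flip := by
      apply B.ext
      intro j
      ext v
      simp only [LinearMap.comp_apply, LinearMap.lcomp_apply, LinearMap.flip_apply]
      rw [hγB, ← Module.End.mul_apply, ← pow_succ, pow_succ', Module.End.mul_apply]
      change φ' ((1 + N) (t _)) = _
      rw [hUt, hφ', ← hN j, hbtpow]
    intro w v
    exact LinearMap.congr_fun (LinearMap.congr_fun this w) v
  have hztv : ∀ v, z' v + t v = v := by
    intro v; rw [← LinearMap.add_apply, hzt]; rfl
  have hNt : ∀ v, N (t v) = t (N v) := by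
    intro v; rw [ht]; rw [← Module.End.mul_apply, ← Module.End.mul_apply, ← mul_assoc, ← hcomm.eq]
  have hbz : ∀ v w, b (z' v) w = b v w + b v (N w) := by
    intro v w
    have := hztv v
    rw [hbt]
    conv_rhs => rw [← this]
    have e : t (z' v + t v) = t v := by rw [this]
    rw [e]
    simp only [map_add, LinearMap.add_apply]
    linear_combination - CharTwo.add_self_eq_zero (b (t v) w)
  have hsymγ : ∀ v w, γ v w = γ w (z' v) := by
    intro v w
    obtain ⟨c, v', rfl⟩ := hspan v
    obtain ⟨d, w', rfl⟩ := hspan w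
    have e1 : ∀ v' w, γ (N v') w = γ w (z' (N v')) := by
      intro v' w
      rw [hγN, hγb]
      change _ = γ w (t v')
      rw [hγb, hs]
    have e2 : γ (B 0) (B 0) = γ (B 0) (z' (B 0)) := by
      have := congrArg (γ (B 0)) (hztv (B 0))
      rw [map_add, hγb, halt, add_zero] at this
      exact this.symm
    have e3 : ∀ w', γ (B 0) (N w') = γ (N w') (z' (B 0)) := by
      intro w'
      rw [hγN, hγb, hbz]
      have : N w' = t (w' + N w') := by
        rw [map_add, ← hNt]; exact (hUt w').symm
      conv_lhs => rw [this]
      rw [hγb, hs, map_add]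
    simp only [map_smul, map_add, LinearMap.add_apply, LinearMap.smul_apply, smul_eq_mul]
    linear_combination c * d * e2 + c * e3 w' + d * e1 v' (B 0) + e1 v' (N w')
  refine ⟨γ.flip, ?_, ?_⟩
  · intro a w
    simp only [LinearMap.flip_apply]
    rw [hγN, map_add, LinearMap.add_apply, hγN, ← hNt, ← map_add]
    congr 1
    have : t a + N (t a) = N a := hUt a
    linear_combination (norm := module) this - h0 (N (t a))
  · intro v w
    simp only [LinearMap.flip_apply]
    rw [hsymγ v w, ← hγb]
    have := congrArg (γ w) (hztv v)
    rw [map_add] at this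
    linear_combination this - CharTwo.add_self_eq_zero (γ w (z' v))
end

section
variable {K : Type*} [Field K]

lemma sub_one_sq_two [CharP K 2] {V : Type*} [AddCommGroup V] [Module K V] (A : V →ₗ[K] V) :
    (A - 1) ^ 2 = A ^ 2 - 1 := by
  have h : A + A = 0 := by
    rw [← two_smul K A, CharTwo.two_eq_zero, zero_smul]
  have h1 : (1 : V →ₗ[K] V) + 1 = 0 := by
    rw [← two_smul K (1 : V →ₗ[K] V), CharTwo.two_eq_zero, zero_smul]
  have : (A - 1) ^ 2 = A ^ 2 - 1 - (A + A) + (1 + 1) := by noncomm_ring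
  rw [this, h, h1]; simp

lemma sub_one_pow_two [CharP K 2] {V : Type*} [AddCommGroup V] [Module K V] (A : V →ₗ[K] V)
    (i : ℕ) : (A - 1) ^ (2 ^ i) = A ^ (2 ^ i) - 1 := by
  induction i with
  | zero => simp
  | succ i ih => rw [pow_succ, pow_mul, ih, sub_one_sq_two, ← pow_mul]

/-- Range-indexed version of the induced decomposition. -/
lemma induced' {W Y : Type*} [AddCommGroup W] [Module K W] [FiniteDimensional K W]
    [AddCommGroup Y] [Module K Y] [FiniteDimensional K Y]
    (X : W →ₗ[K] W) (ι : Y →ₗ[K] W) (σ : Y →ₗ[K] Y) (R : ℕ) (hR : 1 ≤ R)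
    (hσ : ∀ y, (X ^ R) (ι y) = ι (σ y))
    (hd : R * finrank K Y = finrank K W)
    (hgen : ∀ S : Submodule K W, (∀ m, ι m ∈ S) → (∀ v ∈ S, X v ∈ S) → S = ⊤) :
    (∀ w, ∃ y : ℕ → Y, w = ∑ i ∈ Finset.range R, (X ^ i) (ι (y i))) ∧
    (∀ y : ℕ → Y, ∑ i ∈ Finset.range R, (X ^ i) (ι (y i)) = 0 → ∀ i < R, y i = 0) := by
  obtain ⟨Φ, hΦ⟩ := induced X ι σ R hR hσ hd hgen
  constructor
  · intro w
    refine ⟨fun i => if h : i < R then Φ.symm w ⟨i, h⟩ else 0, ?_⟩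
    rw [← Fin.sum_univ_eq_sum_range (fun i => (X ^ i) (ι (if h : i < R then Φ.symm w ⟨i, h⟩ else 0)))]
    conv_lhs => rw [← Φ.apply_symm_apply w, hΦ]
    simp
  · intro y hy i hi
    rw [← Fin.sum_univ_eq_sum_range (fun i => (X ^ i) (ι (y i))), ← hΦ (fun i => y i)] at hy
    have := Φ.map_eq_zero_iff.1 hy
    exact congrFun this ⟨i, hi⟩

lemma sig_pow {W Y : Type*} [AddCommGroup W] [Module K W]
    [AddCommGroup Y] [Module K Y]
    (X : W →ₗ[K] W) (ι : Y →ₗ[K] W) (σ : Y →ₗ[K] Y) (R : ℕ)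
    (hσ : ∀ y, (X ^ R) (ι y) = ι (σ y)) (e : ℕ) (y : Y) :
    (X ^ (R * e)) (ι y) = ι ((σ ^ e) y) := by
  induction e with
  | zero => simp
  | succ e ih =>
    rw [mul_add, mul_one, add_comm, pow_add, Module.End.mul_apply, ih, hσ, pow_succ',
      Module.End.mul_apply]

lemma q_nondiv [CharP K 2] {W Y : Type*} [AddCommGroup W] [Module K W] [FiniteDimensional K W]
    [AddCommGroup Y] [Module K Y] [FiniteDimensional K Y]
    (X : W →ₗ[K] W) (ι : Y →ₗ[K] W) (σ : Y →ₗ[K] Y) (R : ℕ) (hR : 1 ≤ R)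
    (hσ : ∀ y, (X ^ R) (ι y) = ι (σ y))
    (hd : R * finrank K Y = finrank K W)
    (hgen : ∀ S : Submodule K W, (∀ m, ι m ∈ S) → (∀ v ∈ S, X v ∈ S) → S = ⊤)
    (b : W →ₗ[K] W →ₗ[K] K) (h : Adj b X) (hs : ∀ v w, b v w = b w v)
    (e c : ℕ) (hc : c + 1 < R) (v : W) (hv : (X ^ (R * e + c + 1)) v = 0) :
    b ((X ^ (R * e + c)) v) v = 0 := by
  obtain ⟨hsurj, hinj⟩ := induced' X ι σ R hR hσ hd hgen
  have hsp := sig_pow X ι σ R hσ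
  obtain ⟨y, rfl⟩ := hsurj v
  have hmul : ∀ (p q : ℕ) (w : W), (X ^ p) ((X ^ q) w) = (X ^ (p + q)) w := by
    intro p q w; rw [pow_add, Module.End.mul_apply]
  have h1 : ∀ i < R, (σ ^ (e + 1)) (y i) = 0 := by
    apply hinj (fun i => (σ ^ (e + 1)) (y i))
    have := congrArg (X ^ (R - (c + 1))) hv
    rw [hmul, map_zero, show R - (c + 1) + (R * e + c + 1) = R * (e + 1) by
      rw [mul_add]; omega, map_sum] at this
    rw [← this]
    refine Finset.sum_congr rfl fun i _ => ?_
    rw [← hsp, hmul, hmul, add_comm]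
  have hz1 : ∀ i < R, ∀ p, R * (e + 1) ≤ p → (X ^ p) (ι (y i)) = 0 := by
    intro i hi p hp
    obtain ⟨q, rfl⟩ := Nat.exists_eq_add_of_le hp
    rw [add_comm, ← hmul, hsp, h1 i hi]; simp
  have h2 : ∀ i, i + (c + 1) < R → (σ ^ e) (y i) = 0 := by
    intro i hi
    have := hinj (fun m => if m < c + 1 then 0 else (σ ^ e) (y (m - (c + 1)))) (by
      conv_lhs => rw [show R = (c + 1) + (R - (c + 1)) by omega]
      rw [Finset.sum_range_add]
      rw [Finset.sum_eq_zero, zero_add]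
      · rw [← hv, map_sum]
        conv_rhs => rw [show R = (R - (c + 1)) + (c + 1) by omega]
        rw [Finset.sum_range_add]
        conv_rhs => rw [add_comm]
        rw [Finset.sum_eq_zero (s := Finset.range (c + 1)), zero_add]
        · have hR' : (R - (c + 1)) + (c + 1) = R := by omega
          refine Finset.sum_congr rfl fun i _ => ?_
          rw [if_neg (by omega), hmul, hR', show c + 1 + i - (c + 1) = i by omega, ← hsp, hmul]
          congr 2; omega
        · intro i hi
          have := Finset.mem_range.1 hi
          have hR' : (R - (c + 1)) + (c + 1) = R := by omega
          rw [hmul, hR']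
          apply hz1 _ (by omega)
          rw [mul_add]; omega
      · intro i hi
        rw [if_pos (Finset.mem_range.1 hi)]; simp) (i + (c + 1)) hi
    simpa [show c < i + (c + 1) by omega] using this
  have hz2 : ∀ i, i + (c + 1) < R → ∀ p, R * e ≤ p → (X ^ p) (ι (y i)) = 0 := by
    intro i hi p hp
    obtain ⟨q, rfl⟩ := Nat.exists_eq_add_of_le hp
    rw [add_comm, ← hmul, hsp, h2 i hi]; simp
  apply q_sum h hs
  · intro i hi
    have := Finset.mem_range.1 hi
    rw [hmul]
    by_cases hic : i + (c + 1) < R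
    · exact hz2 i hic _ (by omega)
    · exact hz1 i this _ (by rw [mul_add]; omega)
  · intro i hi
    have := Finset.mem_range.1 hi
    by_cases hic : i + (c + 1) < R
    · rw [hmul, hz2 i hic _ (by omega)]; simp
    · obtain ⟨j, rfl⟩ : ∃ j, i = j + 1 := ⟨i - 1, by omega⟩
      rw [pow_succ' X j, Module.End.mul_apply]
      apply q_X_zero h
      rw [hmul]
      exact hz1 _ this _ (by rw [mul_add]; omega)

/-- The alternating form on a block of size `2^a * odd` splits over the subgroup of index `2^a`. -/
lemma block_split [CharP K 2] {V : Type*} [AddCommGroup V] [Module K V] [FiniteDimensional K V]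
    (x : V →ₗ[K] V) (a m : ℕ) (hd : finrank K V = 2 ^ a * (2 * m + 1))
    (h0 : x ^ (2 ^ a * (2 * m + 1)) = 0) (h1 : x ^ (2 ^ a * (2 * m + 1) - 1) ≠ 0)
    (b : V →ₗ[K] V →ₗ[K] K) (halt : ∀ v, b v v = 0) (h : Adj b x) :
    ∃ β : V →ₗ[K] V →ₗ[K] K, Adj β (x ^ (2 ^ a)) ∧ ∀ v w, b v w = β v w + β w v := by
  have hs : ∀ v w, b v w = b w v := by
    intro v w
    have := halt (v + w)
    simp only [map_add, LinearMap.add_apply, halt, zero_add, add_zero] at this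
    exact (CharTwo.add_eq_zero.1 this).symm
  have hR : 1 ≤ 2 ^ a := Nat.one_le_two_pow
  obtain ⟨ι, N, hι, hgen, hN, hN0⟩ := exists_model x (2 ^ a) (2 * m + 1) hR (by omega) hd h0 h1
  obtain ⟨Φ, hΦ⟩ := induced x ι N (2 ^ a) hR hι (by simp [hd]) hgen
  have hA := adj_pow_two h a
  have hxc : ∀ i v, (x ^ (2 ^ a)) ((x ^ i) v) = (x ^ i) ((x ^ (2 ^ a)) v) := by
    intro i v
    rw [← Module.End.mul_apply, ← Module.End.mul_apply, ← pow_add, ← pow_add, add_comm]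
  have hsplit : ∀ i : Fin (2 ^ a), ∃ β : (Fin (2 * m + 1) → K) →ₗ[K] (Fin (2 * m + 1) → K) →ₗ[K] K,
      Adj β N ∧ ∀ v w, b ((x ^ (i : ℕ)) (ι v)) ((x ^ (i : ℕ)) (ι w)) = β v w + β w v := by
    intro i
    have := odd_split m (Pi.basisFun K (Fin (2 * m + 1))) N hN hN0
      (b.compl₁₂ ((x ^ (i : ℕ)) ∘ₗ ι) ((x ^ (i : ℕ)) ∘ₗ ι)) (by intro v; simp [halt]) (by
        intro v w
        simp only [LinearMap.compl₁₂_apply, LinearMap.comp_apply, map_add, ← hι, ← hxc]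
        rw [hA, map_add])
    simpa using this
  choose β hβ1 hβ2 using hsplit
  let P : Fin (2 ^ a) → V →ₗ[K] (Fin (2 * m + 1) → K) := fun i => LinearMap.proj i ∘ₗ Φ.symm.toLinearMap
  have hP : ∀ v, v = ∑ i : Fin (2 ^ a), (x ^ (i : ℕ)) (ι (P i v)) := by
    intro v
    conv_lhs => rw [← Φ.apply_symm_apply v, hΦ]
    rfl
  have hPx : ∀ i v, P i ((x ^ (2 ^ a)) v) = N (P i v) := by
    intro i v
    have : Φ.symm ((x ^ (2 ^ a)) v) = fun i => N (Φ.symm v i) := by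
      rw [LinearEquiv.symm_apply_eq, hΦ]
      conv_lhs => rw [← Φ.apply_symm_apply v, hΦ, map_sum]
      refine Finset.sum_congr rfl fun i _ => ?_
      rw [hxc, hι]
    exact congrFun this i
  let c : Fin (2 ^ a) → Fin (2 ^ a) → (V →ₗ[K] V →ₗ[K] K) := fun i j =>
    b.compl₁₂ ((x ^ (i : ℕ)) ∘ₗ ι ∘ₗ P i) ((x ^ (j : ℕ)) ∘ₗ ι ∘ₗ P j)
  let g : Fin (2 ^ a) → Fin (2 ^ a) → (V →ₗ[K] V →ₗ[K] K) := fun i j =>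
    if i = j then (β i).compl₁₂ (P i) (P i) else if i < j then c i j else 0
  have hc : ∀ i j v w, c i j v w = b ((x ^ (i : ℕ)) (ι (P i v))) ((x ^ (j : ℕ)) (ι (P j w))) :=
    fun i j v w => rfl
  have hg : ∀ i j v w, c i j v w = g i j v w + g j i w v := by
    intro i j v w
    rcases lt_trichotomy i j with hij | hij | hij
    · simp [g, hij.ne, hij, hij.ne', not_lt_of_gt hij]
    · subst hij
      simp only [g, if_true, LinearMap.compl₁₂_apply, hc]
      exact hβ2 i _ _
    · simp only [g, hij.ne, hij, hij.ne', not_lt_of_gt hij, if_false, if_true, hc, LinearMap.zero_apply, zero_add]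
      exact hs _ _
  have hcA : ∀ i j, Adj (c i j) (x ^ (2 ^ a)) := by
    intro i j v w
    simp only [hc, hPx, map_add, ← hι, ← hxc]
    rw [hA, map_add]
  have hgA : ∀ i j, Adj (g i j) (x ^ (2 ^ a)) := by
    intro i j
    simp only [g]
    split_ifs with h1 h2
    · intro v w
      simp only [LinearMap.compl₁₂_apply, hPx, map_add]
      rw [hβ1, map_add]
    · exact hcA i j
    · intro v w; simp
  refine ⟨∑ i, ∑ j, g i j, ?_, ?_⟩
  · intro v w
    simp only [LinearMap.sum_apply]
    exact Finset.sum_congr rfl fun i _ => Finset.sum_congr rfl fun j _ => hgA i j v w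
  · intro v w
    have : b v w = ∑ i, ∑ j, c i j v w := by
      conv_lhs => rw [hP v, hP w]
      simp only [map_sum, LinearMap.sum_apply, hc]
      rw [Finset.sum_comm]
    rw [this]
    simp only [LinearMap.sum_apply, hg, Finset.sum_add_distrib]
    congr 1
    rw [Finset.sum_comm]
end

section
variable {K : Type*} [Field K]

lemma block_facts [CharP K 2] {V : Type*} [AddCommGroup V] [Module K V] [FiniteDimensional K V]
    (u : V ≃ₗ[K] V) (n : ℕ) (hn : 1 ≤ n) (hord : ∃ m : ℕ, u ^ (2 ^ m) = 1)
    (hdim : finrank K V = n) (hblock : jordanMult K ((u : V →ₗ[K] V) - 1) n = 1) :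
    ((u : V →ₗ[K] V) - 1) ^ n = 0 ∧ ((u : V →ₗ[K] V) - 1) ^ (n - 1) ≠ 0 := by
  constructor
  · obtain ⟨m, hm⟩ := hord
    have hm' : (u : V →ₗ[K] V) ^ (2 ^ m) = 1 := by
      have : ∀ j : ℕ, ∀ v, ((u : V →ₗ[K] V) ^ j) v = (u ^ j) v := by
        intro j
        induction j with
        | zero => intro v; simp
        | succ j ih => intro v; rw [pow_succ, pow_succ]; simp [ih]
      ext v
      rw [this, hm]; simp
    have h0 : ((u : V →ₗ[K] V) - 1) ^ (2 ^ m) = 0 := by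
      rw [sub_one_pow_two, hm', sub_self]
    have h := Module.End.ker_pow_le_ker_pow_finrank ((u : V →ₗ[K] V) - 1) (2 ^ m)
    rw [h0, hdim] at h
    ext v
    have : v ∈ LinearMap.ker (((u : V →ₗ[K] V) - 1) ^ n) := h (by simp)
    simpa using this
  · intro h
    have hs : ((u : V →ₗ[K] V) - 1) ^ (n + 1) = 0 := by
      have : n + 1 = n - 1 + 2 := by omega
      rw [this, pow_add, h, zero_mul]
    unfold jordanMult at hblock
    rw [h, hs] at hblock
    rw [LinearMap.range_zero, finrank_bot, zero_add, Nat.zero_sub] at hblock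
    exact absurd hblock (by norm_num)

open TensorProduct in
lemma tensor_ind [CharP K 2] {V₁ V₂ : Type*} [AddCommGroup V₁] [Module K V₁]
    [FiniteDimensional K V₁] [AddCommGroup V₂] [Module K V₂] [FiniteDimensional K V₂]
    (u₁ : V₁ ≃ₗ[K] V₁) (u₂ : V₂ ≃ₗ[K] V₂) (i n : ℕ) (hn : 1 ≤ n)
    (hd : finrank K V₂ = 2 ^ i * n) (h0 : ((u₂ : V₂ →ₗ[K] V₂) - 1) ^ (2 ^ i * n) = 0)
    (h1 : ((u₂ : V₂ →ₗ[K] V₂) - 1) ^ (2 ^ i * n - 1) ≠ 0) :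
    ∃ (ι : (Fin n → K) →ₗ[K] V₂) (N : (Fin n → K) →ₗ[K] (Fin n → K)),
      (∀ y : V₁ ⊗[K] (Fin n → K),
        (((TensorProduct.map (u₁ : V₁ →ₗ[K] V₁) (u₂ : V₂ →ₗ[K] V₂) - 1) ^ (2 ^ i) :
            V₁ ⊗[K] V₂ →ₗ[K] V₁ ⊗[K] V₂))
          (TensorProduct.map LinearMap.id ι y) =
        TensorProduct.map LinearMap.id ι
          ((TensorProduct.map ((u₁ : V₁ →ₗ[K] V₁) ^ (2 ^ i)) (1 + N) - 1 :
            V₁ ⊗[K] (Fin n → K) →ₗ[K] V₁ ⊗[K] (Fin n → K)) y)) ∧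
      (∀ S : Submodule K (V₁ ⊗[K] V₂),
        (∀ y : V₁ ⊗[K] (Fin n → K), TensorProduct.map LinearMap.id ι y ∈ S) →
        (∀ w ∈ S, (TensorProduct.map (u₁ : V₁ →ₗ[K] V₁) (u₂ : V₂ →ₗ[K] V₂) - 1 :
            V₁ ⊗[K] V₂ →ₗ[K] V₁ ⊗[K] V₂) w ∈ S) →
        S = ⊤) := by
  obtain ⟨ι, N, hι, hgen, -, -⟩ := exists_model ((u₂ : V₂ →ₗ[K] V₂) - 1) (2 ^ i) n
    Nat.one_le_two_pow hn hd h0 h1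
  refine ⟨ι, N, ?_, ?_⟩
  · intro y
    rw [sub_one_pow_two, TensorProduct.map_pow]
    have hu : ∀ m, ((u₂ : V₂ →ₗ[K] V₂) ^ (2 ^ i)) (ι m) = ι ((1 + N) m) := by
      intro m
      have := hι m
      rw [sub_one_pow_two, LinearMap.sub_apply, sub_eq_iff_eq_add] at this
      rw [this]; simp [add_comm]
    induction y using TensorProduct.induction_on with
    | zero => simp
    | tmul v m =>
      simp only [LinearMap.sub_apply, TensorProduct.map_tmul, Module.End.one_apply, map_sub, hu,
        LinearMap.id_apply]
    | add a b ha hb => rw [map_add, map_add, ha, hb, map_add, map_add]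
  · intro S hS hX
    have hU : ∀ w ∈ S, TensorProduct.map (u₁ : V₁ →ₗ[K] V₁) (u₂ : V₂ →ₗ[K] V₂) w ∈ S := by
      intro w hw
      have := S.add_mem (hX w hw) hw
      simpa using this
    let T : Submodule K V₂ :=
      { carrier := {m | ∀ v : V₁, v ⊗ₜ[K] m ∈ S}
        add_mem' := by
          intro a b ha hb v
          rw [TensorProduct.tmul_add]
          exact S.add_mem (ha v) (hb v)
        zero_mem' := by intro v; rw [TensorProduct.tmul_zero]; exact S.zero_mem
        smul_mem' := by
          intro c a ha v
          rw [TensorProduct.tmul_smul]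
          exact S.smul_mem c (ha v) }
    have hT : T = ⊤ := by
      apply hgen T
      · intro m v
        simpa using hS (v ⊗ₜ m)
      · intro m hm
        rw [LinearMap.sub_apply]
        refine T.sub_mem ?_ hm
        intro v
        have := hU _ (hm (u₁.symm v))
        simpa using this
    rw [eq_top_iff]
    rintro w -
    induction w using TensorProduct.induction_on with
    | zero => exact S.zero_mem
    | tmul v m =>
      have : m ∈ T := by rw [hT]; trivial
      exact this v
    | add a b ha hb => exact S.add_mem ha hb

/-- dimension of the range of a product map. -/
lemma finrank_range_prodMap {Y Z : Type*} [AddCommGroup Y] [Module K Y] [FiniteDimensional K Y]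
    [AddCommGroup Z] [Module K Z] [FiniteDimensional K Z]
    (f : Y →ₗ[K] Y) (g : Z →ₗ[K] Z) :
    finrank K (LinearMap.range (f.prodMap g)) =
      finrank K (LinearMap.range f) + finrank K (LinearMap.range g) := by
  rw [LinearMap.range_prodMap, ← Module.finrank_prod]
  exact LinearEquiv.finrank_eq
    { toFun := fun x => (⟨x.1.1, x.2.1⟩, ⟨x.1.2, x.2.2⟩)
      invFun := fun x => ⟨(x.1.1, x.2.1), ⟨x.1.2, x.2.2⟩⟩
      map_add' := fun _ _ => rfl
      map_smul' := fun _ _ => rfl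
      left_inv := fun _ => rfl
      right_inv := fun _ => rfl }

/-- two-step induced decomposition. -/
lemma induced_two {W Y : Type*} [AddCommGroup W] [Module K W] [FiniteDimensional K W]
    [AddCommGroup Y] [Module K Y] [FiniteDimensional K Y]
    (X : W →ₗ[K] W) (ι : Y →ₗ[K] W) (σ : Y →ₗ[K] Y)
    (hσ : ∀ y, (X ^ 2) (ι y) = ι (σ y))
    (hd : 2 * finrank K Y = finrank K W)
    (hgen : ∀ S : Submodule K W, (∀ y, ι y ∈ S) → (∀ w ∈ S, X w ∈ S) → S = ⊤) :
    ∃ E : (Y × Y) ≃ₗ[K] W, ∀ y, E y = ι y.1 + X (ι y.2) := by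
  obtain ⟨Φ, hΦ⟩ := induced X ι σ 2 (by norm_num) hσ hd hgen
  refine ⟨(LinearEquiv.finTwoArrow K Y).symm.trans Φ, ?_⟩
  rintro ⟨a, b⟩
  simp [hΦ, Fin.sum_univ_two]

lemma rank_conj {W Z : Type*} [AddCommGroup W] [Module K W] [AddCommGroup Z] [Module K Z]
    (E E' : Z ≃ₗ[K] W) (A : W →ₗ[K] W) (B : Z →ₗ[K] Z) (h : ∀ z, A (E z) = E' (B z)) :
    finrank K (LinearMap.range A) = finrank K (LinearMap.range B) := by
  have h1 : A ∘ₗ E.toLinearMap = E'.toLinearMap ∘ₗ B := by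
    ext z; simpa using h z
  have h2 : LinearMap.range A = (LinearMap.range B).map E'.toLinearMap := by
    rw [← LinearMap.range_comp, ← h1, LinearMap.range_comp_of_range_eq_top]
    exact E.range
  rw [h2]
  exact (LinearEquiv.finrank_map_eq E' _)

lemma rank_pow {W Y : Type*} [AddCommGroup W] [Module K W] [FiniteDimensional K W]
    [AddCommGroup Y] [Module K Y] [FiniteDimensional K Y]
    (X : W →ₗ[K] W) (ι : Y →ₗ[K] W) (σ : Y →ₗ[K] Y)
    (hσ : ∀ y, (X ^ 2) (ι y) = ι (σ y))
    (hd : 2 * finrank K Y = finrank K W)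
    (hgen : ∀ S : Submodule K W, (∀ y, ι y ∈ S) → (∀ w ∈ S, X w ∈ S) → S = ⊤) (j : ℕ) :
    finrank K (LinearMap.range (X ^ (2 * j))) = 2 * finrank K (LinearMap.range (σ ^ j)) ∧
    finrank K (LinearMap.range (X ^ (2 * j + 1))) =
      finrank K (LinearMap.range (σ ^ j)) + finrank K (LinearMap.range (σ ^ (j + 1))) := by
  obtain ⟨E, hE⟩ := induced_two X ι σ hσ hd hgen
  have hp := sig_pow X ι σ 2 hσ
  constructor
  · rw [rank_conj E E (X ^ (2 * j)) ((σ ^ j).prodMap (σ ^ j)), finrank_range_prodMap, two_mul]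
    rintro ⟨a, b⟩
    rw [hE, hE, map_add, hp]
    have : (X ^ (2 * j)) (X (ι b)) = X ((X ^ (2 * j)) (ι b)) := by
      rw [← Module.End.mul_apply, ← Module.End.mul_apply, ← pow_succ, ← pow_succ']
    rw [this, hp]; rfl
  · rw [rank_conj E ((LinearEquiv.prodComm K Y Y).trans E) (X ^ (2 * j + 1))
      ((σ ^ j).prodMap (σ ^ (j + 1))), finrank_range_prodMap]
    rintro ⟨a, b⟩
    rw [hE, LinearEquiv.trans_apply, hE, map_add]
    have h1 : (X ^ (2 * j + 1)) (ι a) = X (ι ((σ ^ j) a)) := by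
      rw [pow_succ', Module.End.mul_apply, hp]
    have h2 : (X ^ (2 * j + 1)) (X (ι b)) = ι ((σ ^ (j + 1)) b) := by
      rw [← hp, ← Module.End.mul_apply, ← pow_succ]; rfl
    rw [h1, h2, add_comm]; rfl

lemma rank_even {W Y : Type*} [AddCommGroup W] [Module K W] [FiniteDimensional K W]
    [AddCommGroup Y] [Module K Y] [FiniteDimensional K Y]
    (X : W →ₗ[K] W) (ι : Y →ₗ[K] W) (σ : Y →ₗ[K] Y)
    (hσ : ∀ y, (X ^ 2) (ι y) = ι (σ y))
    (hd : 2 * finrank K Y = finrank K W)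
    (hgen : ∀ S : Submodule K W, (∀ y, ι y ∈ S) → (∀ w ∈ S, X w ∈ S) → S = ⊤)
    (A : W →ₗ[K] W) (B : Y →ₗ[K] Y) (hAX : ∀ w, A (X w) = X (A w))
    (hA : ∀ y, A (ι y) = ι (B y)) (j : ℕ) :
    Even (finrank K (LinearMap.range (A ^ j))) := by
  obtain ⟨E, hE⟩ := induced_two X ι σ hσ hd hgen
  have hp : ∀ y, (A ^ j) (ι y) = ι ((B ^ j) y) := by
    have := sig_pow A ι B 1 (by simpa using hA) j
    simpa using this
  have hc : ∀ w, (A ^ j) (X w) = X ((A ^ j) w) := by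
    have hcm : Commute A X := LinearMap.ext hAX
    intro w
    exact LinearMap.congr_fun (hcm.pow_left j) w
  rw [rank_conj E E (A ^ j) ((B ^ j).prodMap (B ^ j)), finrank_range_prodMap]
  · exact ⟨_, rfl⟩
  · rintro ⟨a, b⟩
    rw [hE, hE, map_add, hp, hc, hp]; rfl
end

section
variable {K : Type*} [Field K]

open TensorProduct in
lemma part_one [CharP K 2] {V₁ V₂ : Type*} [AddCommGroup V₁] [Module K V₁]
    [FiniteDimensional K V₁] [AddCommGroup V₂] [Module K V₂] [FiniteDimensional K V₂]
    (u₁ : V₁ ≃ₗ[K] V₁) (u₂ : V₂ ≃ₗ[K] V₂) (ℓ k : ℕ) (hℓ : 1 ≤ ℓ) (hk : 1 ≤ k)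
    (hd₁ : finrank K V₁ = 2 * ℓ) (h0₁ : ((u₁ : V₁ →ₗ[K] V₁) - 1) ^ (2 * ℓ) = 0)
    (h1₁ : ((u₁ : V₁ →ₗ[K] V₁) - 1) ^ (2 * ℓ - 1) ≠ 0)
    (hd₂ : finrank K V₂ = 2 * k) (h0₂ : ((u₂ : V₂ →ₗ[K] V₂) - 1) ^ (2 * k) = 0)
    (h1₂ : ((u₂ : V₂ →ₗ[K] V₂) - 1) ^ (2 * k - 1) ≠ 0) (X : V₁ ⊗[K] V₂ →ₗ[K] V₁ ⊗[K] V₂)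
    (hX : X = TensorProduct.map (u₁ : V₁ →ₗ[K] V₁) (u₂ : V₂ →ₗ[K] V₂) - 1) (d : ℕ) (hd : 1 ≤ d) :
    (jordanMult K X d ≠ 0 → Even d) ∧ Even (jordanMult K X d) := by
  obtain ⟨ι, N, hσ, hgen⟩ := tensor_ind u₁ u₂ 1 k hk (by simpa using hd₂) (by simpa using h0₂)
    (by simpa using h1₂)
  obtain ⟨ι₁, N₁, hι₁, hgen₁, -, -⟩ := exists_model ((u₁ : V₁ →ₗ[K] V₁) - 1) 2 ℓ
    (by norm_num) hℓ hd₁ h0₁ h1₁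
  rw [← hX] at hσ hgen
  rw [pow_one] at hσ
  set σ : V₁ ⊗[K] (Fin k → K) →ₗ[K] V₁ ⊗[K] (Fin k → K) :=
    TensorProduct.map ((u₁ : V₁ →ₗ[K] V₁) ^ 2) (1 + N) - 1 with hσdef
  have hrank := rank_pow X (TensorProduct.map LinearMap.id ι) σ hσ (by
    simp only [finrank_tensorProduct, hd₁, hd₂, finrank_fin_fun]; ring) hgen
  have hu : ∀ m, ((u₁ : V₁ →ₗ[K] V₁) ^ 2) (ι₁ m) = ι₁ ((1 + N₁) m) := by
    intro m
    have := hι₁ m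
    rw [sub_one_sq_two, LinearMap.sub_apply, sub_eq_iff_eq_add] at this
    rw [this]; simp [add_comm]
  let ξ : V₁ ⊗[K] (Fin k → K) →ₗ[K] V₁ ⊗[K] (Fin k → K) :=
    TensorProduct.map ((u₁ : V₁ →ₗ[K] V₁) - 1) LinearMap.id
  have heven : ∀ j, Even (finrank K (LinearMap.range (σ ^ j))) := by
    refine rank_even (Y := (Fin ℓ → K) ⊗[K] (Fin k → K)) ξ
      (TensorProduct.map ι₁ LinearMap.id) (TensorProduct.map N₁ LinearMap.id) ?_ ?_ ?_ σ
      (TensorProduct.map (1 + N₁) (1 + N) - 1) ?_ ?_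
    · intro y
      induction y using TensorProduct.induction_on with
      | zero => simp
      | tmul v m =>
        have := hι₁ v
        simp only [pow_two, Module.End.mul_apply] at this
        simp only [pow_two, Module.End.mul_apply, ξ, TensorProduct.map_tmul, this,
          LinearMap.id_apply]
      | add a b ha hb => rw [map_add, map_add, ha, hb, map_add, map_add]
    · simp only [finrank_tensorProduct, hd₁, finrank_fin_fun]; ring
    · intro S hS hξ
      let T : Submodule K V₁ :=
        { carrier := {v | ∀ m : Fin k → K, v ⊗ₜ[K] m ∈ S}
          add_mem' := by
            intro a b ha hb v
            rw [TensorProduct.add_tmul]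
            exact S.add_mem (ha v) (hb v)
          zero_mem' := by intro v; rw [TensorProduct.zero_tmul]; exact S.zero_mem
          smul_mem' := by
            intro c a ha v
            rw [← TensorProduct.smul_tmul']
            exact S.smul_mem c (ha v) }
      have hT : T = ⊤ := by
        apply hgen₁ T
        · intro m v
          simpa using hS (m ⊗ₜ v)
        · intro v hv m
          exact hξ _ (hv m)
      rw [eq_top_iff]
      rintro w -
      induction w using TensorProduct.induction_on with
      | zero => exact S.zero_mem
      | tmul v m =>
        have : v ∈ T := by rw [hT]; trivial
        exact this m
      | add a b ha hb => exact S.add_mem ha hb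
    · intro y
      induction y using TensorProduct.induction_on with
      | zero => simp
      | tmul v m =>
        simp [ξ, σ, pow_two, TensorProduct.sub_tmul]
      | add a b ha hb => rw [map_add, map_add, ha, hb, map_add, map_add]
    · intro y
      induction y using TensorProduct.induction_on with
      | zero => simp
      | tmul v m =>
        simp only [σ, LinearMap.sub_apply, TensorProduct.map_tmul, Module.End.one_apply, map_sub,
          hu, LinearMap.id_apply]
      | add a b ha hb => rw [map_add, map_add, ha, hb, map_add, map_add]
  unfold jordanMult
  rcases Nat.even_or_odd' d with ⟨j, rfl | rfl⟩
  · refine ⟨fun _ => ⟨j, by ring⟩, ?_⟩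
    obtain ⟨i, rfl⟩ : ∃ i, j = i + 1 := ⟨j - 1, by omega⟩
    have e1 := (hrank i).2
    have e2 := (hrank (i + 1)).2
    have e3 := (hrank (i + 1)).1
    have e4 : 2 * (i + 1) - 1 = 2 * i + 1 := by omega
    rw [e4, e1, e2, e3]
    obtain ⟨p, hp⟩ := heven i
    obtain ⟨q, hq⟩ := heven (i + 1)
    obtain ⟨r, hr⟩ := heven (i + 1 + 1)
    rw [hp, hq, hr]
    exact ⟨p + r - 2 * q, by omega⟩
  · have e1 := (hrank j).1
    have e2 := (hrank (j + 1)).1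
    have e3 := (hrank j).2
    have e4 : 2 * j + 1 - 1 = 2 * j := by omega
    have e5 : 2 * j + 1 + 1 = 2 * (j + 1) := by omega
    rw [e4, e5, e1, e2, e3]
    have : ∀ p q : ℕ, 2 * p + 2 * q - 2 * (p + q) = 0 := by intro p q; omega
    rw [this]
    simp

lemma q_apply_tensor {V W : Type*} [AddCommGroup V] [Module K V] [AddCommGroup W] [Module K W]
    (f g : TensorProduct K V W →ₗ[K] TensorProduct K V W →ₗ[K] K)
    (h : ∀ v w v' w', f (v ⊗ₜ[K] w) (v' ⊗ₜ[K] w') = g (v ⊗ₜ[K] w) (v' ⊗ₜ[K] w')) : f = g := by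
  apply TensorProduct.ext'
  intro v w
  apply TensorProduct.ext'
  intro v' w'
  exact h v w v' w'

lemma symm_of_alt [CharP K 2] {V : Type*} [AddCommGroup V] [Module K V]
    (b : V →ₗ[K] V →ₗ[K] K) (h : ∀ v, b v v = 0) (v w : V) : b v w = b w v := by
  have := h (v + w)
  simp only [map_add, LinearMap.add_apply, h, zero_add, add_zero] at this
  rw [add_comm] at this
  exact CharTwo.add_eq_zero.1 this

lemma inv_of_adj [CharP K 2] {V : Type*} [AddCommGroup V] [Module K V]
    {b : V →ₗ[K] V →ₗ[K] K} {Z : V →ₗ[K] V} (h : Adj b (Z - 1)) (v w : V) :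
    b (Z v) (Z w) = b v w := by
  have h1 := h v w
  have h2 : (2 : K) = 0 := CharTwo.two_eq_zero
  simp only [LinearMap.sub_apply, Module.End.one_apply, map_sub, map_add] at h1
  linear_combination (b v (Z w) - b v w) * h2 - h1

open TensorProduct in
lemma core [CharP K 2] {V₁ V₂ : Type*} [AddCommGroup V₁] [Module K V₁]
    [FiniteDimensional K V₁] [AddCommGroup V₂] [Module K V₂] [FiniteDimensional K V₂]
    (u₁ : V₁ ≃ₗ[K] V₁) (u₂ : V₂ ≃ₗ[K] V₂) (α m n : ℕ) (hn : 1 ≤ n)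
    (hd₁ : finrank K V₁ = 2 ^ (α + 1) * (2 * m + 1))
    (h0₁ : ((u₁ : V₁ →ₗ[K] V₁) - 1) ^ (2 ^ (α + 1) * (2 * m + 1)) = 0)
    (h1₁ : ((u₁ : V₁ →ₗ[K] V₁) - 1) ^ (2 ^ (α + 1) * (2 * m + 1) - 1) ≠ 0)
    (hd₂ : finrank K V₂ = 2 ^ (α + 2) * n)
    (h0₂ : ((u₂ : V₂ →ₗ[K] V₂) - 1) ^ (2 ^ (α + 2) * n) = 0)
    (h1₂ : ((u₂ : V₂ →ₗ[K] V₂) - 1) ^ (2 ^ (α + 2) * n - 1) ≠ 0)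
    (b₁ : V₁ →ₗ[K] V₁ →ₗ[K] K) (b₂ : V₂ →ₗ[K] V₂ →ₗ[K] K)
    (halt₁ : ∀ v, b₁ v v = 0) (halt₂ : ∀ v, b₂ v v = 0)
    (hinv₁ : ∀ v w, b₁ (u₁ v) (u₁ w) = b₁ v w) (hinv₂ : ∀ v w, b₂ (u₂ v) (u₂ w) = b₂ v w)
    (bT : V₁ ⊗[K] V₂ →ₗ[K] V₁ ⊗[K] V₂ →ₗ[K] K)
    (hbT : ∀ (v : V₁) (w : V₂) (v' : V₁) (w' : V₂),
      bT (v ⊗ₜ[K] w) (v' ⊗ₜ[K] w') = b₁ v v' * b₂ w w')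
    (X : V₁ ⊗[K] V₂ →ₗ[K] V₁ ⊗[K] V₂)
    (hX : X = TensorProduct.map (u₁ : V₁ →ₗ[K] V₁) (u₂ : V₂ →ₗ[K] V₂) - 1) (d : ℕ) (hd : 1 ≤ d)
    (v : V₁ ⊗[K] V₂) (hv : (X ^ d) v = 0) : bT ((X ^ (d - 1)) v) v = 0 := by
  have hs₁ := symm_of_alt b₁ halt₁
  have hs₂ := symm_of_alt b₂ halt₂
  have hflip : bT = bT.flip := by
    apply q_apply_tensor
    intro v w v' w'
    rw [LinearMap.flip_apply, hbT, hbT, hs₁, hs₂]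
  have hsymm : ∀ v w, bT v w = bT w v := by
    intro v w
    conv_lhs => rw [hflip]
    rfl
  have halt : ∀ v, bT v v = 0 := by
    intro v
    induction v using TensorProduct.induction_on with
    | zero => simp
    | tmul v w => rw [hbT, halt₁, zero_mul]
    | add a b ha hb =>
      simp only [map_add, LinearMap.add_apply, ha, hb, zero_add, add_zero]
      rw [hsymm b a]; exact CharTwo.add_self_eq_zero _
  have hUX : ∀ v, v + X v = TensorProduct.map (u₁ : V₁ →ₗ[K] V₁) (u₂ : V₂ →ₗ[K] V₂) v := by
    intro v; rw [hX]; simp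
  have hinv : bT.compl₁₂ (TensorProduct.map (u₁ : V₁ →ₗ[K] V₁) (u₂ : V₂ →ₗ[K] V₂))
      (TensorProduct.map (u₁ : V₁ →ₗ[K] V₁) (u₂ : V₂ →ₗ[K] V₂)) = bT := by
    apply q_apply_tensor
    intro v w v' w'
    simp [hbT, hinv₁, hinv₂]
  have hadj : Adj bT X := by
    apply adj_of_inv
    intro v w
    rw [hUX, hUX]
    exact LinearMap.congr_fun₂ hinv v w
  by_cases hdiv : 2 ^ (α + 2) ∣ d
  · obtain ⟨e', rfl⟩ := hdiv
    obtain ⟨e, rfl⟩ : ∃ e, e' = e + 1 := by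
      rcases e' with _ | e
      · simp at hd
      · exact ⟨e, rfl⟩
    rw [q_reduce hadj halt (α + 1) e v hv]
    have hadj₁ : Adj b₁ ((u₁ : V₁ →ₗ[K] V₁) - 1) := by
      apply adj_of_inv
      intro v w
      simpa using hinv₁ v w
    have hadj₂ : Adj b₂ (((u₂ : V₂ →ₗ[K] V₂) - 1) ^ (2 ^ (α + 1))) := by
      apply adj_pow_two
      apply adj_of_inv
      intro v w
      simpa using hinv₂ v w
    obtain ⟨β, hβ1, hβ2⟩ := block_split _ (α + 1) m hd₁ h0₁ h1₁ b₁ halt₁ hadj₁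
    let γ : V₁ ⊗[K] V₂ →ₗ[K] V₁ ⊗[K] V₂ →ₗ[K] K := LinearMap.BilinForm.tmul β b₂
    have hγ : ∀ v w v' w', γ (v ⊗ₜ[K] w) (v' ⊗ₜ[K] w') = β v v' * b₂ w w' := by
      intro v w v' w'
      simp [γ, mul_comm]
    have hγb : ∀ v w, bT v w = γ v w + γ w v := by
      have : bT = γ + γ.flip := by
        apply q_apply_tensor
        intro v w v' w'
        rw [LinearMap.add_apply, LinearMap.add_apply, LinearMap.flip_apply, hγ, hγ, hbT, hβ2,
          hs₂ w' w, add_mul]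
      intro v w
      conv_lhs => rw [this]
      rfl
    have hγadj : Adj γ (X ^ (2 ^ (α + 1))) := by
      rw [sub_one_pow_two] at hβ1 hadj₂
      have hinvγ : γ.compl₁₂ (TensorProduct.map ((u₁ : V₁ →ₗ[K] V₁) ^ (2 ^ (α + 1)))
          ((u₂ : V₂ →ₗ[K] V₂) ^ (2 ^ (α + 1))))
          (TensorProduct.map ((u₁ : V₁ →ₗ[K] V₁) ^ (2 ^ (α + 1)))
          ((u₂ : V₂ →ₗ[K] V₂) ^ (2 ^ (α + 1)))) = γ := by
        apply q_apply_tensor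
        intro v w v' w'
        rw [LinearMap.compl₁₂_apply, TensorProduct.map_tmul, TensorProduct.map_tmul, hγ, hγ,
          inv_of_adj hβ1, inv_of_adj hadj₂]
      rw [hX, sub_one_pow_two, TensorProduct.map_pow]
      apply adj_of_inv
      intro v w
      have := LinearMap.congr_fun₂ hinvγ v w
      simpa only [LinearMap.compl₁₂_apply, LinearMap.sub_apply, Module.End.one_apply,
        add_sub_cancel] using this
    have h2 : 2 ^ (α + 1 + 1) * (e + 1) = 2 ^ (α + 1) * (2 * e + 1 + 1) := by ring
    have h3 : 2 ^ (α + 1 + 1) * (e + 1) - 2 ^ (α + 1) = 2 ^ (α + 1) * (2 * e + 1) := by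
      rw [h2, mul_add (2 ^ (α + 1)) _ 1, mul_one, Nat.add_sub_cancel]
    rw [h3, pow_mul]
    apply q_split hγadj hγb
    rw [← pow_mul, ← h2]; exact hv
  · obtain ⟨ι, N, hσ, hgen⟩ := tensor_ind u₁ u₂ (α + 2) n hn hd₂ h0₂ h1₂
    rw [← hX] at hσ hgen
    have hlt := Nat.mod_lt d (show 0 < 2 ^ (α + 2) by positivity)
    have hdm := Nat.div_add_mod d (2 ^ (α + 2))
    have hne : d % 2 ^ (α + 2) ≠ 0 := fun h => hdiv (Nat.dvd_of_mod_eq_zero h)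
    have h1 : d = 2 ^ (α + 2) * (d / 2 ^ (α + 2)) + (d % 2 ^ (α + 2) - 1) + 1 := by omega
    have h2 : d - 1 = 2 ^ (α + 2) * (d / 2 ^ (α + 2)) + (d % 2 ^ (α + 2) - 1) := by omega
    rw [h2]
    refine q_nondiv X _ _ (2 ^ (α + 2)) Nat.one_le_two_pow hσ ?_ hgen bT hadj hsymm _ _ ?_ v ?_
    · simp only [finrank_tensorProduct, hd₁, hd₂, finrank_fin_fun]; ring
    · omega
    · rw [← h1]; exact hv
end

lemma val_split (a b : ℕ) (ha : 1 ≤ a) (hb : 1 ≤ b) (h : padicValNat 2 a < padicValNat 2 b) :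
    ∃ m n : ℕ, 1 ≤ n ∧ 2 * a = 2 ^ (padicValNat 2 a + 1) * (2 * m + 1) ∧
      2 * b = 2 ^ (padicValNat 2 a + 2) * n := by
  obtain ⟨q, hq⟩ := pow_padicValNat_dvd (p := 2) (n := a)
  have hodd : ¬ 2 ∣ q := by
    rintro ⟨r, rfl⟩
    have : 2 ^ (padicValNat 2 a + 1) ∣ a := ⟨r, by rw [pow_succ, mul_assoc]; exact hq⟩
    exact pow_succ_padicValNat_not_dvd (p := 2) (by omega) this
  obtain ⟨n, hn⟩ := (pow_dvd_pow 2 h).trans (pow_padicValNat_dvd (p := 2) (n := b))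
  refine ⟨q / 2, n, ?_, ?_, ?_⟩
  · rcases n with _ | n
    · simp at hn; omega
    · omega
  · have : 2 * (q / 2) + 1 = q := by omega
    rw [this]
    conv_lhs => rw [hq]
    ring
  · conv_lhs => rw [hn]
    simp only [Nat.succ_eq_add_one]
    ring

open TensorProduct in
/-- for the tensor product of two orthogonally indecomposable non-degenerate
alternating bilinear `K[u]`-modules `V(2ℓ)` and `V(2k)`: (i) all Jordan block sizes of `u ⊗ u`
are even and occur with even multiplicity; (ii) if `ν₂(ℓ) ≠ ν₂(k)` then the ε-invariant of the
tensor product form vanishes everywhere. -/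
theorem tensor_of_single_blocks_even_and_eps_zero
    (K : Type*) [Field K] [IsAlgClosed K] [CharP K 2]
    (V₁ : Type*) [AddCommGroup V₁] [Module K V₁] [FiniteDimensional K V₁]
    (V₂ : Type*) [AddCommGroup V₂] [Module K V₂] [FiniteDimensional K V₂]
    (ℓ k : ℕ) (hℓ : 1 ≤ ℓ) (hk : 1 ≤ k)
    (u₁ : V₁ ≃ₗ[K] V₁) (u₂ : V₂ ≃ₗ[K] V₂)
    (hord₁ : ∃ m : ℕ, u₁ ^ (2 ^ m) = 1) (hord₂ : ∃ m : ℕ, u₂ ^ (2 ^ m) = 1)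
    (hdim₁ : Module.finrank K V₁ = 2 * ℓ) (hdim₂ : Module.finrank K V₂ = 2 * k)
    (hblock₁ : jordanMult K ((u₁ : V₁ →ₗ[K] V₁) - 1) (2 * ℓ) = 1)
    (hblock₂ : jordanMult K ((u₂ : V₂ →ₗ[K] V₂) - 1) (2 * k) = 1)
    (b₁ : V₁ →ₗ[K] V₁ →ₗ[K] K) (b₂ : V₂ →ₗ[K] V₂ →ₗ[K] K)
    (halt₁ : ∀ v, b₁ v v = 0) (halt₂ : ∀ v, b₂ v v = 0)
    (hnd₁ : ∀ v, (∀ w, b₁ v w = 0) → v = 0) (hnd₂ : ∀ v, (∀ w, b₂ v w = 0) → v = 0)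
    (hinv₁ : ∀ v w, b₁ (u₁ v) (u₁ w) = b₁ v w) (hinv₂ : ∀ v w, b₂ (u₂ v) (u₂ w) = b₂ v w)
    -- the tensor product form
    (bT : V₁ ⊗[K] V₂ →ₗ[K] V₁ ⊗[K] V₂ →ₗ[K] K)
    (hbT : ∀ (v : V₁) (w : V₂) (v' : V₁) (w' : V₂),
      bT (v ⊗ₜ[K] w) (v' ⊗ₜ[K] w') = b₁ v v' * b₂ w w') :
    (∀ d : ℕ, 1 ≤ d →
      (jordanMult K ((TensorProduct.congr u₁ u₂).toLinearMap - 1) d ≠ 0 → Even d) ∧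
      Even (jordanMult K ((TensorProduct.congr u₁ u₂).toLinearMap - 1) d)) ∧
    (padicValNat 2 ℓ ≠ padicValNat 2 k →
      ∀ d : ℕ, 1 ≤ d → eps K ((TensorProduct.congr u₁ u₂).toLinearMap - 1) bT d = 0) := by
  obtain ⟨h0₁, h1₁⟩ := block_facts u₁ (2 * ℓ) (by omega) hord₁ hdim₁ hblock₁
  obtain ⟨h0₂, h1₂⟩ := block_facts u₂ (2 * k) (by omega) hord₂ hdim₂ hblock₂
  have hX : (TensorProduct.congr u₁ u₂).toLinearMap - 1 =
    TensorProduct.map (u₁ : V₁ →ₗ[K] V₁) (u₂ : V₂ →ₗ[K] V₂) - 1 := rfl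
  refine ⟨fun d hd => part_one u₁ u₂ ℓ k hℓ hk hdim₁ h0₁ h1₁ hdim₂ h0₂ h1₂ _ hX d hd, ?_⟩
  intro hne d hd
  unfold eps
  rw [if_neg]
  push Not
  intro v hv
  rcases lt_or_gt_of_ne hne with hlt | hlt
  · obtain ⟨m, n, hn, e1, e2⟩ := val_split ℓ k hℓ hk hlt
    rw [e1] at hdim₁ h0₁ h1₁
    rw [e2] at hdim₂ h0₂ h1₂
    exact core u₁ u₂ _ m n hn hdim₁ h0₁ h1₁ hdim₂ h0₂ h1₂ b₁ b₂ halt₁ halt₂ hinv₁ hinv₂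
      bT hbT _ hX d hd v hv
  · obtain ⟨m, n, hn, e1, e2⟩ := val_split k ℓ hk hℓ hlt
    rw [e1] at hdim₂ h0₂ h1₂
    rw [e2] at hdim₁ h0₁ h1₁
    let c := TensorProduct.comm K V₁ V₂
    let X₂ : V₂ ⊗[K] V₁ →ₗ[K] V₂ ⊗[K] V₁ :=
      TensorProduct.map (u₂ : V₂ →ₗ[K] V₂) (u₁ : V₁ →ₗ[K] V₁) - 1
    have hc : X₂ ∘ₗ c.toLinearMap =
        c.toLinearMap ∘ₗ ((TensorProduct.congr u₁ u₂).toLinearMap - 1) := by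
      apply TensorProduct.ext'
      intro v w
      simp [X₂, c]
    have hcp : ∀ j w, (X₂ ^ j) (c w) =
        c ((((TensorProduct.congr u₁ u₂).toLinearMap - 1 :
          V₁ ⊗[K] V₂ →ₗ[K] V₁ ⊗[K] V₂) ^ j) w) := by
      intro j
      induction j with
      | zero => intro w; simp
      | succ j ih =>
        intro w
        rw [pow_succ, pow_succ, Module.End.mul_apply, Module.End.mul_apply, ← ih]
        exact congrArg _ (LinearMap.congr_fun hc w)
    have := core u₂ u₁ _ m n hn hdim₂ h0₂ h1₂ hdim₁ h0₁ h1₁ b₂ b₁ halt₂ halt₁ hinv₂ hinv₁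
      (bT.compl₁₂ c.symm.toLinearMap c.symm.toLinearMap)
      (by intro v w v' w'; simp [c, hbT, mul_comm]) X₂ rfl d hd (c v) (by rw [hcp, hv, map_zero])
    rw [hcp] at this
    simpa using this
end

section
/- Let (V₁,b₁) and (V₂,b₂) be non-degenerate alternating bilinear K[u]-modules on which u acts as a single Jordan block of size 2ℓ and 2k respectively (ℓ, k ≥ 1), and suppose ν₂(ℓ) = ν₂(k) = α. Write the Jordan block sizes of u⊗u on V₁⊗V₂ as 2d_1 < ⋯ < 2d_t with multiplicities 2k_1, …, 2k_t. Then there is a unique index j with ν₂(d_j) = α; furthermore k_j = 2^α, d_j/2^α is the unique odd Jordan block size of the tensor product of single unipotent Jordan blocks of sizes ℓ/2^α and k/2^α, and ε_{V₁⊗V₂, b₁⊗b₂}(2d_j) = 1 while ε_{V₁⊗V₂, b₁⊗b₂}(d) = 0 for all d ≠ 2d_j. -/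
set_option maxSynthPendingDepth 3

open Module LinearMap

section RankPart

variable {K : Type*} [Field K] {V : Type*} [AddCommGroup V] [Module K V]

/-- Abbreviation for the rank of the `i`-th power. -/
noncomputable def rk (f : V →ₗ[K] V) (i : ℕ) : ℕ := Module.finrank K (LinearMap.range (f ^ i))

/-- `ker f ∩ range (f^i)`. -/
def kr (f : V →ₗ[K] V) (i : ℕ) : Submodule K V := LinearMap.ker f ⊓ LinearMap.range (f ^ i)

lemma rank_step [FiniteDimensional K V] (f : V →ₗ[K] V) (i : ℕ) :
    rk f i = rk f (i + 1) + Module.finrank K (kr f i) := by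
  have h := LinearMap.finrank_range_add_finrank_ker (f.domRestrict (LinearMap.range (f ^ i)))
  have h1 : LinearMap.range (f.domRestrict (LinearMap.range (f ^ i)))
      = LinearMap.range (f ^ (i + 1)) := by
    rw [LinearMap.range_domRestrict, pow_succ', Module.End.mul_eq_comp, LinearMap.range_comp]
  have h2 : Module.finrank K (LinearMap.ker (f.domRestrict (LinearMap.range (f ^ i))))
      = Module.finrank K (kr f i) := by
    rw [LinearMap.ker_domRestrict]
    have := Submodule.finrank_map_subtype_eq (LinearMap.range (f ^ i))
      (Submodule.comap (LinearMap.range (f ^ i)).subtype (LinearMap.ker f))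
    rw [← this, Submodule.map_comap_subtype, inf_comm]
    rfl
  rw [h1, h2] at h
  exact h.symm

lemma kr_anti (f : V →ₗ[K] V) (i : ℕ) : kr f (i + 1) ≤ kr f i := by
  rintro x ⟨hx, y, rfl⟩
  refine ⟨hx, f y, ?_⟩
  rw [pow_succ]; rfl

lemma rk_convex [FiniteDimensional K V] (f : V →ₗ[K] V) (i : ℕ) :
    2 * rk f (i + 1) ≤ rk f i + rk f (i + 2) := by
  have h1 := rank_step f i
  have h2 : rk f (i + 1) = rk f (i + 2) + _ := rank_step f (i + 1)
  have h3 := Submodule.finrank_mono (kr_anti f i)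
  omega

lemma jm_eq (f : V →ₗ[K] V) (d : ℕ) :
    jordanMult K f (d + 1) = rk f d + rk f (d + 2) - 2 * rk f (d + 1) := rfl

lemma jm_add [FiniteDimensional K V] (f : V →ₗ[K] V) (d : ℕ) :
    jordanMult K f (d + 1) + 2 * rk f (d + 1) = rk f d + rk f (d + 2) := by
  have := rk_convex f d
  rw [jm_eq]; omega

lemma jm_kr [FiniteDimensional K V] (f : V →ₗ[K] V) (d : ℕ) :
    Module.finrank K (kr f d) = jordanMult K f (d + 1) + Module.finrank K (kr f (d + 1)) := by
  have h1 := rank_step f d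
  have h2 : rk f (d + 1) = rk f (d + 2) + _ := rank_step f (d + 1)
  have h3 := jm_add f d
  omega

lemma kr_eq_of_jm [FiniteDimensional K V] (f : V →ₗ[K] V) (d : ℕ)
    (h : jordanMult K f (d + 1) = 0) : kr f (d + 1) = kr f d := by
  apply Submodule.eq_of_le_of_finrank_eq (kr_anti f d)
  have := jm_kr f d
  omega

/-- If `[D, f] = 1` in characteristic two then there are no odd blocks. -/
lemma jm_odd_of_weyl [CharP K 2] [FiniteDimensional K V] (f D : V →ₗ[K] V)
    (h : D * f = f * D + 1) (j : ℕ) : jordanMult K f (2 * j + 1) = 0 := by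
  have two : ∀ x : V, x + x = 0 := fun x => by
    rw [← two_smul K x, CharTwo.two_eq_zero, zero_smul]
  have two' : ∀ x : V →ₗ[K] V, x + x = 0 := fun x => by
    rw [← two_smul K x, CharTwo.two_eq_zero, zero_smul]
  have hc : Commute D (f ^ 2) := by
    show D * f ^ 2 = f ^ 2 * D
    calc D * f ^ 2 = (D * f) * f := by rw [pow_two, mul_assoc]
      _ = f * (D * f) + f := by rw [h, add_mul, one_mul, mul_assoc, h]
      _ = f ^ 2 * D + (f + f) := by rw [h, mul_add, mul_one, pow_two, mul_assoc, add_assoc]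
      _ = f ^ 2 * D := by rw [two', add_zero]
  have hc2 : Commute D (f ^ (2 * j)) := by rw [pow_mul]; exact hc.pow_right j
  have key : kr f (2 * j) ≤ kr f (2 * j + 1) := by
    rintro x ⟨hx, y, rfl⟩
    refine ⟨hx, D y, ?_⟩
    have hx' : f ((f ^ (2 * j)) y) = 0 := hx
    have h1 := LinearMap.congr_fun h ((f ^ (2 * j)) y)
    have h2 := LinearMap.congr_fun hc2.eq y
    simp only [Module.End.mul_apply, LinearMap.add_apply, Module.End.one_apply, hx', map_zero]
      at h1 h2
    rw [pow_succ', Module.End.mul_apply, ← h2]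
    have h3 := two ((f ^ (2 * j)) y)
    have h4 : f (D ((f ^ (2 * j)) y)) + (f ^ (2 * j)) y
      = (f ^ (2 * j)) y + (f ^ (2 * j)) y := by rw [← h1, h3]
    exact add_right_cancel h4
  have h1 := jm_kr f (2 * j)
  have h2 := Submodule.finrank_mono key
  omega

lemma rk_conj {W : Type*} [AddCommGroup W] [Module K W] (e : V ≃ₗ[K] W)
    (f : V →ₗ[K] V) (g : W →ₗ[K] W) (h : ∀ v, e (f v) = g (e v)) (i : ℕ) :
    rk f i = rk g i := by
  have h2 : ∀ i v, e ((f ^ i) v) = (g ^ i) (e v) := by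
    intro i
    induction i with
    | zero => intro v; simp
    | succ n ih => intro v; rw [pow_succ, pow_succ, Module.End.mul_apply, Module.End.mul_apply, ih, h]
  have : LinearMap.range (g ^ i) = (LinearMap.range (f ^ i)).map e.toLinearMap := by
    ext x
    constructor
    · rintro ⟨y, rfl⟩
      refine ⟨(f ^ i) (e.symm y), ⟨_, rfl⟩, ?_⟩
      simp [h2]
    · rintro ⟨_, ⟨y, rfl⟩, rfl⟩
      exact ⟨e y, by simp [h2]⟩
  unfold rk
  rw [this]
  exact (LinearEquiv.finrank_map_eq e _).symm

lemma jm_conj {W : Type*} [AddCommGroup W] [Module K W] (e : V ≃ₗ[K] W)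
    (f : V →ₗ[K] V) (g : W →ₗ[K] W) (h : ∀ v, e (f v) = g (e v)) (i : ℕ) :
    jordanMult K f i = jordanMult K g i := by
  have := rk_conj e f g h
  simp only [rk] at this
  simp only [jordanMult, this]

lemma rk_prod {W : Type*} [AddCommGroup W] [Module K W] [FiniteDimensional K V]
    [FiniteDimensional K W] (f : V →ₗ[K] V) (g : W →ₗ[K] W) (i : ℕ) :
    rk (f.prodMap g) i = rk f i + rk g i := by
  have : (f.prodMap g) ^ i = (f ^ i).prodMap (g ^ i) := by
    induction i with
    | zero => rw [pow_zero, pow_zero, pow_zero]; rfl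
    | succ n ih => rw [pow_succ, ih, pow_succ, pow_succ]; rfl
  unfold rk
  rw [this, LinearMap.range_prodMap]
  let e : ((LinearMap.range (f ^ i)).prod (LinearMap.range (g ^ i))) ≃ₗ[K]
      (LinearMap.range (f ^ i)) × (LinearMap.range (g ^ i)) :=
    { toFun := fun x => (⟨x.1.1, x.2.1⟩, ⟨x.1.2, x.2.2⟩)
      map_add' := fun x y => rfl
      map_smul' := fun c x => rfl
      invFun := fun x => ⟨(x.1.1, x.2.1), ⟨x.1.2, x.2.2⟩⟩
      left_inv := fun x => rfl
      right_inv := fun x => rfl }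
  rw [LinearEquiv.finrank_eq e, Module.finrank_prod]

end RankPart

section Model

variable (K : Type*) [Field K]

/-- the shift on `Fin n → K` -/
def shiftMap (n : ℕ) : (Fin n → K) →ₗ[K] (Fin n → K) where
  toFun w i := if h : (i : ℕ) + 1 < n then w ⟨i + 1, h⟩ else 0
  map_add' x y := by
    ext i; by_cases h : (i : ℕ) + 1 < n <;> simp [h]
  map_smul' c x := by
    ext i; by_cases h : (i : ℕ) + 1 < n <;> simp [h]

lemma shiftMap_apply (n : ℕ) (w : Fin n → K) (i : Fin n) :
    shiftMap K n w i = if h : (i : ℕ) + 1 < n then w ⟨i + 1, h⟩ else 0 := rfl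

lemma shiftMap_pow_apply (n r : ℕ) (w : Fin n → K) (i : Fin n) :
    (shiftMap K n ^ r) w i = if h : (i : ℕ) + r < n then w ⟨i + r, h⟩ else 0 := by
  induction r generalizing i with
  | zero => simp
  | succ r ih =>
    rw [pow_succ', Module.End.mul_apply, shiftMap_apply]
    by_cases h : (i : ℕ) + (r + 1) < n
    · have h1 : (i : ℕ) + 1 < n := by omega
      rw [dif_pos h1, ih, dif_pos h, dif_pos (by simp only; omega)]
      congr 1; ext; simp only; omega
    · rw [dif_neg h]
      by_cases h1 : (i : ℕ) + 1 < n
      · rw [dif_pos h1, ih, dif_neg (by simp only; omega)]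
      · rw [dif_neg h1]

lemma jordanBlockMap_eq (n : ℕ) : jordanBlockMap K n = 1 + shiftMap K n := by
  apply LinearMap.ext
  intro w
  ext i
  rw [jordanBlockMap, map_add, Matrix.toLin'_one]
  simp only [LinearMap.add_apply, LinearMap.id_apply, Module.End.one_apply, Pi.add_apply]
  congr 1
  rw [Matrix.toLin'_apply, shiftMap_apply, Matrix.mulVec, dotProduct]
  simp only [Matrix.of_apply, ite_mul, one_mul, zero_mul]
  by_cases h : (i : ℕ) + 1 < n
  · rw [dif_pos h, Finset.sum_eq_single ⟨i + 1, h⟩]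
    · simp
    · intro j _ hj
      rw [if_neg]
      intro h'
      exact hj (Fin.ext h'.symm)
    · simp
  · rw [dif_neg h]
    apply Finset.sum_eq_zero
    intro j _
    rw [if_neg]
    have := j.2
    omega

lemma shiftMap_eq (n : ℕ) : shiftMap K n = jordanBlockMap K n - 1 := by
  rw [jordanBlockMap_eq]; abel

/-- coordinates `0,2,4,…` and `1,3,5,…` -/
def halfEquiv (n m r : ℕ) (hm : m = (n + 1) / 2) (hr : r = n / 2) :
    (Fin n → K) ≃ₗ[K] (Fin m → K) × (Fin r → K) where
  toFun w := (fun i => w ⟨2 * i, by have := i.2; omega⟩, fun i => w ⟨2 * i + 1, by have := i.2; omega⟩)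
  map_add' x y := rfl
  map_smul' c x := rfl
  invFun w := fun i => if h : (i : ℕ) % 2 = 0 then w.1 ⟨i / 2, by have := i.2; omega⟩
    else w.2 ⟨i / 2, by have := i.2; omega⟩
  left_inv w := by
    ext i
    by_cases h : (i : ℕ) % 2 = 0
    · simp only [h, dif_pos]; congr 1; ext; simp only; omega
    · simp only [h, dif_neg, not_false_eq_true]; congr 1; ext; simp only; omega
  right_inv w := by
    apply Prod.ext
    · ext i
      simp
    · ext i
      have h : ¬ (2 * (i : ℕ) + 1) % 2 = 0 := by omega
      simp only [h, dif_neg, not_false_eq_true]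
      exact congrArg w.2 (Fin.ext (by simp only; omega))

lemma halfEquiv_shift (n m r : ℕ) (hm : m = (n + 1) / 2) (hr : r = n / 2) (w : Fin n → K) :
    halfEquiv K n m r hm hr ((shiftMap K n ^ 2) w) =
      ((shiftMap K m).prodMap (shiftMap K r)) (halfEquiv K n m r hm hr w) := by
  apply Prod.ext
  · ext i
    have := i.2
    simp only [halfEquiv, LinearEquiv.coe_mk, LinearMap.coe_mk, AddHom.coe_mk, shiftMap_pow_apply,
      LinearMap.prodMap_apply, shiftMap_apply]
    by_cases h : (i : ℕ) + 1 < m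
    · rw [dif_pos h, dif_pos (by omega)]; rfl
    · rw [dif_neg h, dif_neg (by omega)]
  · ext i
    have := i.2
    simp only [halfEquiv, LinearEquiv.coe_mk, LinearMap.coe_mk, AddHom.coe_mk, shiftMap_pow_apply,
      LinearMap.prodMap_apply, shiftMap_apply]
    by_cases h : (i : ℕ) + 1 < r
    · rw [dif_pos h, dif_pos (by omega)]; congr 1
    · rw [dif_neg h, dif_neg (by omega)]

instance charP_end (V : Type*) [AddCommGroup V] [Module K V] [Nontrivial V] [CharP K 2] :
    CharP (V →ₗ[K] V) 2 := by
  have : CharP (Module.End K V) 2 := charP_of_injective_algebraMap (algebraMap K _).injective 2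
  exact this

lemma end_add_self {V : Type*} [AddCommGroup V] [Module K V] [CharP K 2] (x : V) : x + x = 0 := by
  rw [← two_smul K x, CharTwo.two_eq_zero, zero_smul]

lemma end_sub_pow {V : Type*} [AddCommGroup V] [Module K V] [CharP K 2] (x : V →ₗ[K] V) (r : ℕ) :
    (x - 1) ^ (2 ^ r) = x ^ (2 ^ r) - 1 := by
  cases subsingleton_or_nontrivial V with
  | inl h => exact LinearMap.ext fun v => Subsingleton.elim _ _
  | inr h =>
    have := sub_pow_char_pow_of_commute (R := V →ₗ[K] V) (p := 2) (n := r) (x := x) (y := 1)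
      (Commute.one_right x)
    simpa using this

lemma half_jordan [CharP K 2] (n m r : ℕ) (hm : m = (n + 1) / 2) (hr : r = n / 2) (w : Fin n → K) :
    halfEquiv K n m r hm hr ((jordanBlockMap K n ^ 2) w) =
      ((jordanBlockMap K m).prodMap (jordanBlockMap K r)) (halfEquiv K n m r hm hr w) := by
  have h1 : jordanBlockMap K n ^ 2 = 1 + shiftMap K n ^ 2 := by
    have := end_sub_pow K (jordanBlockMap K n) 1
    rw [pow_one, ← shiftMap_eq] at this
    rw [this]; abel
  rw [h1, LinearMap.add_apply, map_add, halfEquiv_shift, jordanBlockMap_eq, jordanBlockMap_eq]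
  rfl

/-- derivation on an even block -/
def derMap (n : ℕ) : (Fin n → K) →ₗ[K] (Fin n → K) where
  toFun w i := if h : 0 < (i : ℕ) then (i : K) * w ⟨i - 1, by have := i.2; omega⟩ else 0
  map_add' x y := by
    ext i; by_cases h : 0 < (i : ℕ) <;> simp [h, mul_add]
  map_smul' c x := by
    ext i; by_cases h : 0 < (i : ℕ) <;> simp [h, mul_left_comm]

lemma derMap_shift [CharP K 2] (n : ℕ) (hn : Even n) :
    derMap K n * shiftMap K n = shiftMap K n * derMap K n + 1 := by
  apply LinearMap.ext
  intro w
  ext i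
  have hi := i.2
  have hn0 : (n : K) = 0 := (CharP.cast_eq_zero_iff K 2 n).2 hn.two_dvd
  simp only [Module.End.mul_apply, LinearMap.add_apply, Module.End.one_apply, Pi.add_apply,
    shiftMap_apply, derMap, LinearMap.coe_mk, AddHom.coe_mk]
  have e1 : ∀ h, w ⟨(i : ℕ) + 1 - 1, h⟩ = w i := fun h => by congr 1
  have key : (if h : 0 < (i : ℕ) then (i : K) * (if h : (i : ℕ) - 1 + 1 < n then
      w ⟨(i : ℕ) - 1 + 1, h⟩ else 0) else 0) = (i : K) * w i := by
    by_cases h : 0 < (i : ℕ)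
    · rw [dif_pos h, dif_pos (by omega)]; congr 2; ext; simp only; omega
    · rw [dif_neg h]
      have : (i : ℕ) = 0 := by omega
      rw [this]; simp
  have key2 : (if h : (i : ℕ) + 1 < n then
      if h' : 0 < (i : ℕ) + 1 then (((i : ℕ) + 1 : ℕ) : K) * w ⟨(i : ℕ) + 1 - 1, by omega⟩ else 0 else 0)
      = ((i : K) + 1) * w i := by
    by_cases h : (i : ℕ) + 1 < n
    · rw [dif_pos h, dif_pos (by omega), e1]; push_cast; rfl
    · rw [dif_neg h]
      have : (i : ℕ) + 1 = n := by omega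
      have h2 : ((i : K) + 1) = 0 := by
        have h3 : (((i : ℕ) + 1 : ℕ) : K) = 0 := by rw [this, hn0]
        exact_mod_cast h3
      rw [h2, zero_mul]
  have k3 : ((i : K) + 1) * w i + w i = (i : K) * w i := by
    have := CharTwo.add_self_eq_zero (w i)
    linear_combination this
  refine key.trans ?_
  rw [← k3, ← key2]

end Model

section TensorRank

open TensorProduct

variable {K : Type*} [Field K]

lemma rk_tensor_left {A B C : Type*} [AddCommGroup A] [Module K A] [FiniteDimensional K A]
    [AddCommGroup B] [Module K B] [FiniteDimensional K B]
    [AddCommGroup C] [Module K C] [FiniteDimensional K C]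
    (f : A →ₗ[K] A) (g : B →ₗ[K] B) (h : C →ₗ[K] C) (i : ℕ) :
    rk (TensorProduct.map (f.prodMap g) h - 1) i
      = rk (TensorProduct.map f h - 1) i + rk (TensorProduct.map g h - 1) i := by
  rw [← rk_prod]
  apply rk_conj (TensorProduct.prodLeft K K A B C)
  intro v
  induction v using TensorProduct.induction_on with
  | zero => rw [map_zero, map_zero, map_zero]
  | tmul x y => obtain ⟨a, b⟩ := x; simp
  | add x y hx hy => rw [map_add, map_add, hx, hy, ← map_add, ← map_add]

lemma rk_tensor_right {A B C : Type*} [AddCommGroup A] [Module K A] [FiniteDimensional K A]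
    [AddCommGroup B] [Module K B] [FiniteDimensional K B]
    [AddCommGroup C] [Module K C] [FiniteDimensional K C]
    (f : A →ₗ[K] A) (g : B →ₗ[K] B) (h : C →ₗ[K] C) (i : ℕ) :
    rk (TensorProduct.map h (f.prodMap g) - 1) i
      = rk (TensorProduct.map h f - 1) i + rk (TensorProduct.map h g - 1) i := by
  rw [← rk_prod]
  apply rk_conj (TensorProduct.prodRight K K C A B)
  intro v
  induction v using TensorProduct.induction_on with
  | zero => rw [map_zero, map_zero, map_zero]
  | tmul x y => obtain ⟨a, b⟩ := y; simp
  | add x y hx hy => rw [map_add, map_add, hx, hy, ← map_add, ← map_add]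

lemma conj_tensor {A B C D : Type*} [AddCommGroup A] [Module K A]
    [AddCommGroup B] [Module K B] [AddCommGroup C] [Module K C] [AddCommGroup D] [Module K D]
    (e : A ≃ₗ[K] B) (e' : C ≃ₗ[K] D) (f : A →ₗ[K] A) (g : B →ₗ[K] B) (f' : C →ₗ[K] C)
    (g' : D →ₗ[K] D) (h : ∀ v, e (f v) = g (e v)) (h' : ∀ v, e' (f' v) = g' (e' v))
    (v : A ⊗[K] C) :
    TensorProduct.congr e e' ((TensorProduct.map f f' - 1) v)
      = (TensorProduct.map g g' - 1) (TensorProduct.congr e e' v) := by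
  induction v using TensorProduct.induction_on with
  | zero => simp
  | tmul x y => simp [h, h']
  | add x y hx hy => rw [map_add, map_add, hx, hy, ← map_add, ← map_add]

variable (K)

/-- the model tensor product of two blocks, minus one -/
noncomputable def tt (n m : ℕ) : ((Fin n → K) ⊗[K] (Fin m → K)) →ₗ[K] ((Fin n → K) ⊗[K] (Fin m → K)) :=
  TensorProduct.map (jordanBlockMap K n) (jordanBlockMap K m) - 1

/-- multiplicities -/
noncomputable def mlt (n m d : ℕ) : ℕ := jordanMult K (tt K n m) d

lemma rk_pow {V : Type*} [AddCommGroup V] [Module K V] (f : V →ₗ[K] V) (i j : ℕ) :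
    rk f (i * j) = rk (f ^ i) j := by
  unfold rk; rw [pow_mul]

lemma rk_half [CharP K 2] (n m j : ℕ) :
    rk (tt K n m) (2 * j) =
      (rk (tt K ((n + 1) / 2) ((m + 1) / 2)) j + rk (tt K ((n + 1) / 2) (m / 2)) j) +
      (rk (tt K (n / 2) ((m + 1) / 2)) j + rk (tt K (n / 2) (m / 2)) j) := by
  have h1 : tt K n m ^ 2
      = TensorProduct.map (jordanBlockMap K n ^ 2) (jordanBlockMap K m ^ 2) - 1 := by
    have := end_sub_pow K (TensorProduct.map (jordanBlockMap K n) (jordanBlockMap K m)) 1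
    rw [pow_one] at this
    rw [tt, this, TensorProduct.map_pow]
  rw [rk_pow, h1]
  rw [rk_conj (TensorProduct.congr (halfEquiv K n _ _ rfl rfl) (halfEquiv K m _ _ rfl rfl)) _
    (TensorProduct.map ((jordanBlockMap K ((n + 1) / 2)).prodMap (jordanBlockMap K (n / 2)))
      ((jordanBlockMap K ((m + 1) / 2)).prodMap (jordanBlockMap K (m / 2))) - 1)
    (conj_tensor _ _ _ _ _ _ (half_jordan K n _ _ rfl rfl) (half_jordan K m _ _ rfl rfl))]
  rw [rk_tensor_left, rk_tensor_right, rk_tensor_right]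
  rfl

lemma jordan_inv (n : ℕ) : ∃ g : (Fin n → K) →ₗ[K] (Fin n → K),
    g * jordanBlockMap K n = 1 ∧ jordanBlockMap K n * g = 1 := by
  have hn : IsNilpotent (shiftMap K n) := by
    refine ⟨n, ?_⟩
    apply LinearMap.ext
    intro w
    ext i
    rw [shiftMap_pow_apply, dif_neg (by omega)]
    rfl
  obtain ⟨u, hu⟩ := hn.isUnit_one_add
  rw [← jordanBlockMap_eq] at hu
  exact ⟨(u⁻¹ : (Module.End K (Fin n → K))ˣ), by rw [← hu]; exact u.inv_mul, by rw [← hu]; exact u.mul_inv⟩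

lemma der_jordan [CharP K 2] (n : ℕ) (hn : Even n) :
    derMap K n * jordanBlockMap K n = jordanBlockMap K n * derMap K n + 1 := by
  rw [jordanBlockMap_eq, mul_add, derMap_shift K n hn, mul_one, add_mul, one_mul, add_assoc]

lemma mlt_even_left [CharP K 2] (n m j : ℕ) (hn : Even n) : mlt K n m (2 * j + 1) = 0 := by
  obtain ⟨g, hg, hg'⟩ := jordan_inv K m
  apply jm_odd_of_weyl (tt K n m) (TensorProduct.map (derMap K n) g)
  rw [tt, mul_sub, sub_mul, mul_one, one_mul, ← TensorProduct.map_mul, ← TensorProduct.map_mul,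
    hg, hg', der_jordan K n hn, TensorProduct.map_add_left]
  rw [TensorProduct.map_one]
  abel

lemma mlt_even_right [CharP K 2] (n m j : ℕ) (hm : Even m) : mlt K n m (2 * j + 1) = 0 := by
  obtain ⟨g, hg, hg'⟩ := jordan_inv K n
  apply jm_odd_of_weyl (tt K n m) (TensorProduct.map g (derMap K m))
  rw [tt, mul_sub, sub_mul, mul_one, one_mul, ← TensorProduct.map_mul, ← TensorProduct.map_mul,
    hg, hg', der_jordan K m hm, TensorProduct.map_add_right]
  rw [TensorProduct.map_one]
  abel

lemma mlt_add (n m d : ℕ) :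
    mlt K n m (d + 1) + 2 * rk (tt K n m) (d + 1) = rk (tt K n m) d + rk (tt K n m) (d + 2) :=
  jm_add _ _

lemma mlt_half [CharP K 2] (n m j : ℕ) :
    mlt K n m (2 * j + 1) + 2 * mlt K n m (2 * j + 2) + mlt K n m (2 * j + 3) =
      (mlt K ((n + 1) / 2) ((m + 1) / 2) (j + 1) + mlt K ((n + 1) / 2) (m / 2) (j + 1)) +
      (mlt K (n / 2) ((m + 1) / 2) (j + 1) + mlt K (n / 2) (m / 2) (j + 1)) := by
  have a1 := mlt_add K n m (2 * j)
  have a2 := mlt_add K n m (2 * j + 1)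
  have a3 := mlt_add K n m (2 * j + 2)
  have b1 := mlt_add K ((n + 1) / 2) ((m + 1) / 2) j
  have b2 := mlt_add K ((n + 1) / 2) (m / 2) j
  have b3 := mlt_add K (n / 2) ((m + 1) / 2) j
  have b4 := mlt_add K (n / 2) (m / 2) j
  have c1 := rk_half K n m j
  have c2 := rk_half K n m (j + 1)
  have c3 := rk_half K n m (j + 2)
  simp only [mul_add, mul_one, add_assoc, Nat.reduceAdd, Nat.reduceMul] at *
  omega

lemma mlt_double [CharP K 2] (n m d : ℕ) (hd : 1 ≤ d) :
    mlt K (2 * n) (2 * m) (2 * d) = 2 * mlt K n m d := by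
  obtain ⟨j, rfl⟩ : ∃ j, d = j + 1 := ⟨d - 1, by omega⟩
  have h := mlt_half K (2 * n) (2 * m) j
  have h1 := mlt_even_left K (2 * n) (2 * m) j (even_two_mul n)
  have h2 := mlt_even_left K (2 * n) (2 * m) (j + 1) (even_two_mul n)
  have e1 : (2 * n + 1) / 2 = n := by omega
  have e2 : (2 * m + 1) / 2 = m := by omega
  have e3 : (2 * n) / 2 = n := by omega
  have e4 : (2 * m) / 2 = m := by omega
  rw [e1, e2, e3, e4] at h
  simp only [mul_add, mul_one, add_assoc, Nat.reduceAdd, Nat.reduceMul] at *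
  omega

lemma mlt_pow [CharP K 2] (r n m d : ℕ) (hd : 1 ≤ d) :
    mlt K (2 ^ r * n) (2 ^ r * m) (2 ^ r * d) = 2 ^ r * mlt K n m d := by
  induction r with
  | zero => simp
  | succ r ih =>
    have h : 1 ≤ 2 ^ r * d := Nat.mul_pos (by positivity) hd
    have e : ∀ x, 2 ^ (r + 1) * x = 2 * (2 ^ r * x) := fun x => by ring
    rw [e, e, e, e, mlt_double K _ _ _ h, ih]

lemma mlt_not_dvd [CharP K 2] (r n m D : ℕ) (hD : 1 ≤ D) (h : ¬ 2 ^ r ∣ D) :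
    mlt K (2 ^ r * n) (2 ^ r * m) D = 0 := by
  induction r generalizing D with
  | zero => simp at h
  | succ r ih =>
    have e : ∀ x, 2 ^ (r + 1) * x = 2 * (2 ^ r * x) := fun x => by ring
    rw [e, e]
    rcases Nat.even_or_odd' D with ⟨c, rfl | rfl⟩
    · rw [mlt_double K _ _ _ (by omega), ih c (by omega), mul_zero]
      rintro ⟨y, rfl⟩
      exact h ⟨y, by ring⟩
    · exact mlt_even_left K _ _ _ (even_two_mul _)

lemma rk_one_one [CharP K 2] (j : ℕ) : rk (tt K 1 1) (j + 1) = 0 := by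
  have : tt K 1 1 = 0 := by
    have h : jordanBlockMap K 1 = 1 := by
      rw [jordanBlockMap_eq]
      have : shiftMap K 1 = 0 := by
        apply LinearMap.ext; intro w; ext i
        rw [shiftMap_apply, dif_neg (by omega)]; rfl
      rw [this, add_zero]
    rw [tt, h, TensorProduct.map_one, sub_self]
  rw [rk, this, zero_pow (by omega), LinearMap.range_zero, finrank_bot]

lemma mlt_odd_half [CharP K 2] (n m : ℕ) (hn : Odd n) (hm : Odd m) :
    ∃ n' m', Odd n' ∧ Odd m' ∧ n' ≤ (n + 1) / 2 ∧ m' ≤ (m + 1) / 2 ∧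
      ∀ j, mlt K n' m' (2 * j + 1) = mlt K n m (4 * j + 1) + 2 * mlt K n m (4 * j + 2) +
        mlt K n m (4 * j + 3) := by
  have key : ∀ j, mlt K n m (4 * j + 1) + 2 * mlt K n m (4 * j + 2) + mlt K n m (4 * j + 3) = _ :=
    fun j => (show 2 * (2 * j) = 4 * j by ring) ▸ mlt_half K n m (2 * j)
  have L := fun n m j h => mlt_even_left K n m j h
  have R := fun n m j h => mlt_even_right K n m j h
  obtain ⟨x, rfl⟩ := hn
  obtain ⟨y, rfl⟩ := hm
  have e1 : (2 * x + 1 + 1) / 2 = x + 1 := by omega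
  have e2 : (2 * y + 1 + 1) / 2 = y + 1 := by omega
  have e3 : (2 * x + 1) / 2 = x := by omega
  have e4 : (2 * y + 1) / 2 = y := by omega
  rw [e1, e2]
  rw [e1, e2, e3, e4] at key
  rcases Nat.even_or_odd x with hx | hx <;> rcases Nat.even_or_odd y with hy | hy
  · refine ⟨x + 1, y + 1, hx.add_one, hy.add_one, le_rfl, le_rfl, fun j => ?_⟩
    rw [key, L x _ j hx, L x _ j hx, R _ y j hy]; ring
  · refine ⟨x + 1, y, hx.add_one, hy, le_rfl, by omega, fun j => ?_⟩
    rw [key, L x _ j hx, L x _ j hx, R _ (y + 1) j hy.add_one]; ring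
  · refine ⟨x, y + 1, hx, hy.add_one, by omega, le_rfl, fun j => ?_⟩
    rw [key, L (x + 1) _ j hx.add_one, L (x + 1) _ j hx.add_one, R _ y j hy]; ring
  · refine ⟨x, y, hx, hy, by omega, by omega, fun j => ?_⟩
    rw [key, L (x + 1) _ j hx.add_one, L (x + 1) _ j hx.add_one, R _ (y + 1) j hy.add_one]; ring

lemma unique_odd_block [CharP K 2] : ∀ (s n m : ℕ), n + m ≤ s → Odd n → Odd m →
    ∃ j, mlt K n m (2 * j + 1) = 1 ∧ ∀ i, i ≠ j → mlt K n m (2 * i + 1) = 0 := by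
  intro s
  induction s with
  | zero =>
    intro n m h hn
    have := hn.pos
    omega
  | succ s ih =>
    intro n m h hn hm
    have hn0 := hn.pos
    have hm0 := hm.pos
    by_cases h1 : n = 1 ∧ m = 1
    · obtain ⟨rfl, rfl⟩ := h1
      refine ⟨0, ?_, fun i hi => ?_⟩
      · have h0 := mlt_add K 1 1 0
        have h1 := rk_one_one K 0
        have h2 := rk_one_one K 1
        have h3 : rk (tt K 1 1) 0 = 1 := by
          rw [rk, pow_zero, Module.End.one_eq_id, LinearMap.range_id, finrank_top]
          simp
        simp only [zero_add, Nat.reduceAdd, mul_zero] at *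
        omega
      · obtain ⟨c, rfl⟩ : ∃ c, i = c + 1 := ⟨i - 1, by omega⟩
        have h0 := mlt_add K 1 1 (2 * (c + 1))
        have h1 := rk_one_one K (2 * c + 1)
        have h2 := rk_one_one K (2 * c + 3)
        have h3 := rk_one_one K (2 * c + 2)
        simp only [mul_add, mul_one, add_assoc, Nat.reduceAdd] at *
        omega
    · obtain ⟨n', m', hn', hm', hle, hle', key⟩ := mlt_odd_half K n m hn hm
      obtain ⟨j, hj, hu⟩ := ih n' m' (by omega) hn' hm'
      have kj := key j
      rw [hj] at kj
      by_cases hc : mlt K n m (4 * j + 1) = 1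
      · refine ⟨2 * j, by rw [show 2 * (2 * j) + 1 = 4 * j + 1 by ring]; exact hc, fun i hi => ?_⟩
        rcases Nat.even_or_odd' i with ⟨c, rfl | rfl⟩
        · have kc := key c
          rw [hu c (by omega)] at kc
          rw [show 2 * (2 * c) + 1 = 4 * c + 1 by ring]; omega
        · by_cases hcj : c = j
          · subst hcj
            rw [show 2 * (2 * c + 1) + 1 = 4 * c + 3 by ring]; omega
          · have kc := key c
            rw [hu c hcj] at kc
            rw [show 2 * (2 * c + 1) + 1 = 4 * c + 3 by ring]; omega
      · refine ⟨2 * j + 1, by rw [show 2 * (2 * j + 1) + 1 = 4 * j + 3 by ring]; omega,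
          fun i hi => ?_⟩
        rcases Nat.even_or_odd' i with ⟨c, rfl | rfl⟩
        · by_cases hcj : c = j
          · subst hcj
            rw [show 2 * (2 * c) + 1 = 4 * c + 1 by ring]; omega
          · have kc := key c
            rw [hu c hcj] at kc
            rw [show 2 * (2 * c) + 1 = 4 * c + 1 by ring]; omega
        · have kc := key c
          rw [hu c (by omega)] at kc
          rw [show 2 * (2 * c + 1) + 1 = 4 * c + 3 by ring]; omega

end TensorRank

section Forms

variable {K : Type*} [Field K] {V : Type*} [AddCommGroup V] [Module K V]

lemma inv_pow_form (b : V →ₗ[K] V →ₗ[K] K) (u : V →ₗ[K] V)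
    (hinv : ∀ v w, b (u v) (u w) = b v w) (n : ℕ) (v w : V) :
    b ((u ^ n) v) ((u ^ n) w) = b v w := by
  induction n with
  | zero => simp
  | succ n ih => rw [pow_succ', Module.End.mul_apply, Module.End.mul_apply, hinv, ih]

lemma adj_form [CharP K 2] (b : V →ₗ[K] V →ₗ[K] K) (u : V →ₗ[K] V)
    (hinv : ∀ v w, b (u v) (u w) = b v w) (v w : V) :
    b v ((u - 1) w) = b ((u - 1) v) (u w) := by
  simp only [LinearMap.sub_apply, Module.End.one_apply, map_sub, hinv]
  have := CharTwo.add_self_eq_zero (b v (u w) - b v w)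
  linear_combination this

lemma adj_pow_form [CharP K 2] (b : V →ₗ[K] V →ₗ[K] K) (u : V →ₗ[K] V)
    (hinv : ∀ v w, b (u v) (u w) = b v w) (n : ℕ) (v w : V) :
    b v (((u - 1) ^ n) w) = b (((u - 1) ^ n) v) ((u ^ n) w) := by
  induction n generalizing v w with
  | zero => simp
  | succ n ih =>
    have hc : Commute u ((u - 1) ^ n) := by
      apply Commute.pow_right
      exact (Commute.refl u).sub_right (Commute.one_right u)
    rw [pow_succ', Module.End.mul_apply, adj_form b u hinv]
    have h := LinearMap.congr_fun hc.eq w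
    simp only [Module.End.mul_apply] at h
    rw [h, ih, ← Module.End.mul_apply, ← pow_succ, ← pow_succ', ← Module.End.mul_apply, ← pow_succ]

lemma fix_form (b : V →ₗ[K] V →ₗ[K] K) (u : V →ₗ[K] V)
    (hinv : ∀ v w, b (u v) (u w) = b v w) (x : V) (hx : (u - 1) x = 0) (n : ℕ) (w : V) :
    b x ((u ^ n) w) = b x w := by
  have hx' : u x = x := by
    rw [LinearMap.sub_apply, Module.End.one_apply, sub_eq_zero] at hx; exact hx
  induction n with
  | zero => simp
  | succ n ih =>
    rw [pow_succ', Module.End.mul_apply]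
    conv_lhs => rw [← hx']
    rw [hinv, ih]

/-- moving `(u-1)^d` over, on `ker (u-1)^(d+1)` -/
lemma cross_form [CharP K 2] (b : V →ₗ[K] V →ₗ[K] K) (u : V →ₗ[K] V)
    (hinv : ∀ v w, b (u v) (u w) = b v w) (d : ℕ) (v w : V) (hv : ((u - 1) ^ (d + 1)) v = 0) :
    b v (((u - 1) ^ d) w) = b (((u - 1) ^ d) v) w := by
  rw [adj_pow_form b u hinv, fix_form b u hinv]
  rw [← Module.End.mul_apply, ← pow_succ', hv]

lemma eps_zero_of_jm [CharP K 2] [FiniteDimensional K V] (b : V →ₗ[K] V →ₗ[K] K) (u : V →ₗ[K] V)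
    (hinv : ∀ v w, b (u v) (u w) = b v w) (hsym : ∀ v w, b v w = b w v) (d : ℕ)
    (h : jordanMult K (u - 1) (d + 1) = 0) : eps K (u - 1) b (d + 1) = 0 := by
  rw [eps, if_neg]
  rintro ⟨v, hv, hne⟩
  apply hne
  rw [Nat.add_sub_cancel]
  have hmem : ((u - 1) ^ d) v ∈ kr (u - 1) d := by
    refine ⟨?_, v, rfl⟩
    rw [SetLike.mem_coe, LinearMap.mem_ker, ← Module.End.mul_apply, ← pow_succ', hv]
  rw [← kr_eq_of_jm _ _ h] at hmem
  obtain ⟨-, w, hw⟩ := hmem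
  rw [← hw, hsym, adj_pow_form b u hinv, hv, map_zero, LinearMap.zero_apply]

/-- The subspace on which the quadratic form vanishes. -/
def nullSub [CharP K 2] (b : V →ₗ[K] V →ₗ[K] K) (u : V →ₗ[K] V)
    (hinv : ∀ v w, b (u v) (u w) = b v w) (hsym : ∀ v w, b v w = b w v) (d : ℕ) :
    Submodule K V where
  carrier := {v | ((u - 1) ^ (d + 1)) v = 0 ∧ b (((u - 1) ^ d) v) v = 0}
  zero_mem' := by simp
  add_mem' := by
    rintro v w ⟨hv, hv'⟩ ⟨hw, hw'⟩
    refine ⟨by rw [map_add, hv, hw, add_zero], ?_⟩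
    simp only [map_add, LinearMap.add_apply, hv', hw']
    rw [hsym (((u - 1) ^ d) w) v, cross_form b u hinv d v w hv, zero_add, add_zero,
      CharTwo.add_self_eq_zero]
  smul_mem' := by
    rintro c v ⟨hv, hv'⟩
    refine ⟨by rw [map_smul, hv, smul_zero], ?_⟩
    simp [hv']

lemma sub_one_pow_eq_sum [CharP K 2] (u : V →ₗ[K] V) (r : ℕ) :
    (u - 1) ^ (2 ^ r - 1) = ∑ j ∈ Finset.range (2 ^ r), u ^ j := by
  have key : ((Polynomial.X : Polynomial K) - 1) ^ (2 ^ r - 1)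
      = ∑ j ∈ Finset.range (2 ^ r), Polynomial.X ^ j := by
    have hne : (Polynomial.X : Polynomial K) - 1 ≠ 0 := by
      simpa using Polynomial.X_sub_C_ne_zero (1 : K)
    apply mul_right_cancel₀ hne
    rw [geom_sum_mul, ← pow_succ, Nat.sub_add_cancel Nat.one_le_two_pow]
    have := sub_pow_char_pow (R := Polynomial K) (p := 2) (n := r) (x := Polynomial.X) (y := 1)
    simpa using this
  have h := congrArg (Polynomial.aeval u) key
  simpa using h

lemma three_form [CharP K 2] (b : V →ₗ[K] V →ₗ[K] K) (u : V →ₗ[K] V)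
    (hinv : ∀ v w, b (u v) (u w) = b v w) (hsym : ∀ v w, b v w = b w v) (r d p q : ℕ)
    (hp : p = 2 ^ (r + 1)) (hq : q = 2 ^ r) (v : V)
    (hv : ((u ^ p - 1) ^ (d + 1)) v = 0) :
    b (((u - 1) ^ (p * (d + 1) - 1)) v) v =
      b (((u ^ p - 1) ^ d) v) v + b ((u ^ q) (((u ^ p - 1) ^ d) v)) v := by
  have hpq : p = 2 * q := by rw [hp, hq]; ring
  have hq1 : 1 ≤ q := by rw [hq]; exact Nat.one_le_two_pow
  set x := ((u ^ p - 1) ^ d) v with hx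
  have hinvp : ∀ v w, b ((u ^ p) v) ((u ^ p) w) = b v w := inv_pow_form b u hinv p
  have hfix : (u ^ p - 1) x = 0 := by
    rw [hx, ← Module.End.mul_apply, ← pow_succ', hv]
  have hux : (u ^ p) x = x := by
    rw [LinearMap.sub_apply, Module.End.one_apply, sub_eq_zero] at hfix; exact hfix
  have e1 : ((u - 1) ^ (p * (d + 1) - 1)) v = ∑ j ∈ Finset.range p, (u ^ j) x := by
    have h1 : p * (d + 1) - 1 = (p - 1) + p * d := by
      have : p * (d + 1) = p * d + p := by ring
      omega
    rw [h1, pow_add, pow_mul, hp, end_sub_pow, ← hp, Module.End.mul_apply, ← hx,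
      hp, sub_one_pow_eq_sum, LinearMap.sum_apply]
  have hF : ∀ j, j ≤ p → b ((u ^ (p - j)) x) v = b ((u ^ j) x) v := by
    intro j hj
    have hfixj : (u ^ p - 1) ((u ^ j) x) = 0 := by
      have hc : Commute (u ^ p - 1) (u ^ j) :=
        ((Commute.refl u).pow_pow p j).sub_left (Commute.one_left _)
      rw [← Module.End.mul_apply, hc.eq, Module.End.mul_apply, hfix, map_zero]
    have hc2 : Commute ((u ^ p - 1) ^ d) (u ^ j) :=
        (((Commute.refl u).pow_pow p j).sub_left (Commute.one_left _)).pow_left d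
    calc b ((u ^ (p - j)) x) v = b ((u ^ j) ((u ^ (p - j)) x)) ((u ^ j) v) :=
          (inv_pow_form b u hinv j _ _).symm
      _ = b x ((u ^ j) v) := by
          rw [← Module.End.mul_apply, ← pow_add, Nat.add_sub_cancel' hj, hux]
      _ = b ((u ^ j) v) x := hsym _ _
      _ = b (((u ^ p - 1) ^ d) ((u ^ j) v)) (((u ^ p) ^ d) v) := by
          rw [hx, adj_pow_form b (u ^ p) hinvp]
      _ = b ((u ^ j) x) (((u ^ p) ^ d) v) := by
          rw [hx, ← Module.End.mul_apply, hc2.eq, Module.End.mul_apply]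
      _ = b ((u ^ j) x) v := fix_form b (u ^ p) hinvp _ hfixj d v
  rw [e1, map_sum, LinearMap.sum_apply]
  have hsub : ({0, q} : Finset ℕ) ⊆ Finset.range p := by
    intro j hj
    simp only [Finset.mem_insert, Finset.mem_singleton] at hj
    rw [Finset.mem_range]; omega
  rw [← Finset.sum_sdiff hsub, Finset.sum_pair (by omega), pow_zero, Module.End.one_apply]
  have hz : ∑ j ∈ Finset.range p \ {0, q}, b ((u ^ j) x) v = 0 := by
    apply Finset.sum_involution (fun j _ => p - j)
    · intro j hj
      simp only [Finset.mem_sdiff, Finset.mem_range, Finset.mem_insert, Finset.mem_singleton,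
        not_or] at hj
      rw [hF j (by omega), CharTwo.add_self_eq_zero]
    · intro j hj _
      simp only [Finset.mem_sdiff, Finset.mem_range, Finset.mem_insert, Finset.mem_singleton,
        not_or] at hj
      omega
    · intro j hj
      simp only [Finset.mem_sdiff, Finset.mem_range, Finset.mem_insert, Finset.mem_singleton,
        not_or] at hj ⊢
      omega
    · intro j hj
      simp only [Finset.mem_sdiff, Finset.mem_range, Finset.mem_insert, Finset.mem_singleton,
        not_or] at hj
      omega
  rw [hz, zero_add]

lemma even_zero_form [CharP K 2] (B : V →ₗ[K] V →ₗ[K] K) (U : V →ₗ[K] V)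
    (hinv : ∀ v w, B (U v) (U w) = B v w) (hB : ∀ g, B g (U g) = B g g) (n : ℕ) (a : V)
    (ha : ((U - 1) ^ (2 * n + 2)) a = 0) : B (((U - 1) ^ (2 * n + 1)) a) a = 0 := by
  have h0 : B (((U - 1) ^ n) a) ((U - 1) (((U - 1) ^ n) a)) = 0 := by
    rw [LinearMap.sub_apply, map_sub, hB, Module.End.one_apply, sub_self]
  rw [← Module.End.mul_apply, ← pow_succ', adj_pow_form B U hinv, ← Module.End.mul_apply,
    ← pow_add, fix_form B U hinv, show n + 1 + n = 2 * n + 1 by ring] at h0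
  · exact h0
  · rw [← Module.End.mul_apply, ← pow_succ', show n + 1 + n + 1 = 2 * n + 2 by ring, ha]

lemma alt_zero_form [CharP K 2] (B : V →ₗ[K] V →ₗ[K] K) (U : V →ₗ[K] V)
    (hinv : ∀ v w, B (U v) (U w) = B v w) (hB : ∀ g, B g g = 0) (n : ℕ) (a : V)
    (ha : ((U - 1) ^ (2 * n + 1)) a = 0) : B (((U - 1) ^ (2 * n)) a) a = 0 := by
  have h0 := hB (((U - 1) ^ n) a)
  rw [adj_pow_form B U hinv, ← Module.End.mul_apply,
    ← pow_add, fix_form B U hinv, ← two_mul] at h0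
  · exact h0
  · rw [← Module.End.mul_apply, ← pow_succ', ← two_mul, ha]

lemma trace_zero_form [CharP K 2] (G M : V →ₗ[K] V →ₗ[K] K) (U : V →ₗ[K] V)
    (hinv : ∀ v w, M (U v) (U w) = M v w) (hG : ∀ v w, G v w = M v w + M w v) (d : ℕ) (a : V)
    (ha : ((U - 1) ^ (d + 1)) a = 0) : G (((U - 1) ^ d) a) a = 0 := by
  rw [hG, cross_form M U hinv d a a ha, CharTwo.add_self_eq_zero]

lemma surj_of_nondeg [FiniteDimensional K V] (B : V →ₗ[K] V →ₗ[K] K) (U : V →ₗ[K] V)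
    (hinv : ∀ v w, B (U v) (U w) = B v w) (hnd : ∀ x, (∀ w, B x w = 0) → x = 0) :
    Function.Surjective U := by
  apply LinearMap.surjective_of_injective
  rw [injective_iff_map_eq_zero]
  intro v hv
  apply hnd
  intro w
  rw [← hinv, hv, map_zero, LinearMap.zero_apply]

lemma exists_repr [FiniteDimensional K V] (B : V →ₗ[K] V →ₗ[K] K)
    (hnd : ∀ x, (∀ w, B x w = 0) → x = 0) (φ : V →ₗ[K] K) : ∃ x, B x = φ := by
  have hinj : Function.Injective B := by
    rw [injective_iff_map_eq_zero]
    intro v hv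
    exact hnd v fun w => by rw [hv, LinearMap.zero_apply]
  have := (LinearMap.injective_iff_surjective_of_finrank_eq_finrank
    (f := B) (Subspace.dual_finrank_eq (K := K) (V := V)).symm).1 hinj
  exact this φ

lemma nonzero_form [CharP K 2] [FiniteDimensional K V] (B : V →ₗ[K] V →ₗ[K] K) (U : V →ₗ[K] V)
    (hinv : ∀ v w, B (U v) (U w) = B v w) (hnd : ∀ x, (∀ w, B x w = 0) → x = 0) (d : ℕ)
    (h : jordanMult K (U - 1) (d + 1) = 1) :
    ∃ a, ((U - 1) ^ (d + 1)) a = 0 ∧ B (((U - 1) ^ d) a) a ≠ 0 := by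
  by_contra hcon
  push Not at hcon
  set S := U - 1 with hS
  have hfr := jm_kr S d
  rw [h] at hfr
  have hlt : kr S (d + 1) < kr S d := by
    apply lt_of_le_of_ne (kr_anti S d)
    intro heq
    rw [heq] at hfr
    omega
  obtain ⟨y, hy, hy'⟩ := SetLike.exists_of_lt hlt
  have hsup : kr S (d + 1) ⊔ Submodule.span K {y} = kr S d := by
    apply Submodule.eq_of_le_of_finrank_le
    · apply sup_le (kr_anti S d)
      rw [Submodule.span_singleton_le_iff_mem]; exact hy
    · have : kr S (d + 1) < kr S (d + 1) ⊔ Submodule.span K {y} := by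
        apply lt_of_le_of_ne le_sup_left
        intro heq
        apply hy'
        rw [heq]
        exact Submodule.mem_sup_right (Submodule.mem_span_singleton_self y)
      have := Submodule.finrank_lt_finrank_of_lt this
      omega
  obtain ⟨hySk, a0, ha0⟩ := id hy
  have hSy : S y = 0 := hySk
  have ha0k : (S ^ (d + 1)) a0 = 0 := by
    rw [pow_succ', Module.End.mul_apply, ha0, hSy]
  have h00 : B y a0 = 0 := by rw [← ha0]; exact hcon a0 ha0k
  have hperp : ∀ w, (S ^ (d + 1)) w = 0 → B y w = 0 := by
    intro w hw
    have hmem : (S ^ d) w ∈ kr S d := by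
      refine ⟨?_, w, rfl⟩
      rw [SetLike.mem_coe, LinearMap.mem_ker, ← Module.End.mul_apply, ← pow_succ', hw]
    rw [← hsup, Submodule.mem_sup] at hmem
    obtain ⟨z, hz, y', hy'', hzy⟩ := hmem
    obtain ⟨c, rfl⟩ := Submodule.mem_span_singleton.1 hy''
    obtain ⟨-, t, ht⟩ := hz
    have e : (S ^ d) (w - c • a0) = (S ^ (d + 1)) t := by
      rw [map_sub, map_smul, ← hzy, ha0, ht]; abel
    have h1 : B y (w - c • a0) = 0 := by
      rw [← ha0, ← cross_form B U hinv d a0 _ ha0k, ← hS, e, adj_pow_form B U hinv, ← hS, ha0k,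
        map_zero, LinearMap.zero_apply]
    rw [map_sub, map_smul, h00, smul_zero, sub_zero] at h1
    exact h1
  have hran : B y ∈ LinearMap.range (S ^ (d + 1)).dualMap := by
    rw [LinearMap.range_dualMap_eq_dualAnnihilator_ker, Submodule.mem_dualAnnihilator]
    intro w hw
    exact hperp w hw
  obtain ⟨φ, hφ⟩ := hran
  obtain ⟨x, hx⟩ := exists_repr B hnd φ
  have hyx : y = (S ^ (d + 1)) x := by
    rw [← sub_eq_zero]
    apply hnd
    intro w
    have hs : Function.Surjective (U ^ (d + 1)) := by
      rw [Module.End.coe_pow]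
      exact (surj_of_nondeg B U hinv hnd).iterate _
    obtain ⟨w', rfl⟩ := hs w
    rw [map_sub, LinearMap.sub_apply, fix_form B U hinv y hSy, hS, ← adj_pow_form B U hinv, ← hφ,
      ← hS, LinearMap.dualMap_apply, hx, sub_self]
  exact hy' ⟨hySk, x, hyx.symm⟩

end Forms

section SingleBlock

variable {K : Type*} [Field K] {V : Type*} [AddCommGroup V] [Module K V]

lemma shift_top (m : ℕ) (w : Fin (m + 1) → K) (hw : w ≠ 0) :
    ∃ (r : ℕ) (c : K), c ≠ 0 ∧ (shiftMap K (m + 1) ^ r) w = c • Pi.single 0 1 := by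
  classical
  have hne : (Finset.univ.filter fun i => w i ≠ 0).Nonempty := by
    by_contra h
    rw [Finset.not_nonempty_iff_eq_empty] at h
    apply hw
    funext i
    by_contra hi
    have : i ∈ (Finset.univ.filter fun i => w i ≠ 0) := by simpa using hi
    rw [h] at this
    simp at this
  set r := (Finset.univ.filter fun i => w i ≠ 0).max' hne with hr
  have hr1 : w r ≠ 0 := by
    have := Finset.max'_mem _ hne
    rw [← hr] at this
    simpa using this
  have hr2 : ∀ i, r < i → w i = 0 := by
    intro i hi
    by_contra h
    have : i ≤ r := Finset.le_max' _ i (by simpa using h)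
    exact absurd hi (not_lt.2 this)
  refine ⟨r, w r, hr1, ?_⟩
  funext i
  rw [shiftMap_pow_apply]
  by_cases hi : i = 0
  · subst hi
    simp
    intro h
    have := r.isLt
    omega
  · have h0 : (0 : ℕ) < i := Nat.pos_of_ne_zero fun h => hi (Fin.ext h)
    rw [Pi.smul_apply, Pi.single_eq_of_ne hi, smul_zero]
    split_ifs with h
    · apply hr2
      rw [Fin.lt_def]
      simp only
      omega
    · rfl

lemma intertwine_pow {W : Type*} [AddCommGroup W] [Module K W] (Φ : W →ₗ[K] V)
    (N : W →ₗ[K] W) (X : V →ₗ[K] V) (h : ∀ w, Φ (N w) = X (Φ w)) (r : ℕ) (w : W) :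
    Φ ((N ^ r) w) = (X ^ r) (Φ w) := by
  induction r with
  | zero => simp
  | succ r ih => rw [pow_succ', Module.End.mul_apply, h, ih, pow_succ', Module.End.mul_apply]

lemma block_equiv [FiniteDimensional K V] (X : V →ₗ[K] V) (m : ℕ) (hdim : finrank K V = m + 1)
    (hX : IsNilpotent X) (hj : jordanMult K X (m + 1) = 1) :
    ∃ Φ : (Fin (m + 1) → K) ≃ₗ[K] V, ∀ w, Φ (shiftMap K (m + 1) w) = X (Φ w) := by
  have hXn : X ^ (m + 1) = 0 := by
    have h1 := LinearMap.aeval_self_charpoly X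
    rw [(LinearMap.charpoly_eq_X_pow_iff X).2 (fun v => by
      obtain ⟨n, hn⟩ := hX
      exact ⟨n, by rw [hn, LinearMap.zero_apply]⟩)] at h1
    simpa [hdim] using h1
  have hne : X ^ m ≠ 0 := by
    intro h
    rw [jordanMult, Nat.add_sub_cancel, h, pow_succ' X (m + 1), hXn] at hj
    rw [mul_zero, LinearMap.range_zero, finrank_bot] at hj
    omega
  obtain ⟨v1, hv1⟩ : ∃ v, (X ^ m) v ≠ 0 := by
    by_contra hcon
    push Not at hcon
    exact hne (LinearMap.ext hcon)
  set Φ : (Fin (m + 1) → K) →ₗ[K] V :=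
    Fintype.linearCombination K (fun i : Fin (m + 1) => (X ^ (m - (i : ℕ))) v1) with hΦ
  have hΦa : ∀ w, Φ w = ∑ i, w i • (X ^ (m - (i : ℕ))) v1 := fun w => by
    rw [hΦ, Fintype.linearCombination_apply]
  have hIntw : ∀ w, Φ (shiftMap K (m + 1) w) = X (Φ w) := by
    intro w
    rw [hΦa, hΦa, map_sum, Fin.sum_univ_succ (f := fun i => X _), Fin.sum_univ_castSucc]
    have e1 : (shiftMap K (m + 1) w) (Fin.last m) = 0 := by
      have := shiftMap_pow_apply (K := K) (m + 1) 1 w (Fin.last m)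
      rw [pow_one] at this
      rw [this, dif_neg]
      simp
    have e2 : X (w 0 • (X ^ (m - ((0 : Fin (m + 1)) : ℕ))) v1) = 0 := by
      rw [map_smul, ← Module.End.mul_apply, ← pow_succ']
      simp [hXn]
    rw [e1, e2, zero_smul, add_zero, zero_add]
    apply Finset.sum_congr rfl
    intro i _
    have e3 : (shiftMap K (m + 1) w) i.castSucc = w i.succ := by
      have := shiftMap_pow_apply (K := K) (m + 1) 1 w i.castSucc
      rw [pow_one] at this
      rw [this, dif_pos (by simp)]
      rfl
    rw [e3, map_smul, ← Module.End.mul_apply, ← pow_succ']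
    congr 3
    simp only [Fin.val_castSucc, Fin.val_succ]
    omega
  have he0 : Φ (Pi.single 0 1) = (X ^ m) v1 := by
    rw [hΦa, Finset.sum_eq_single 0]
    · simp
    · intro i _ hi
      rw [Pi.single_eq_of_ne hi, zero_smul]
    · simp
  have hinj : Function.Injective Φ := by
    rw [injective_iff_map_eq_zero]
    intro w hw
    by_contra hw0
    obtain ⟨r, c, hc, hr⟩ := shift_top m w hw0
    have h1 := intertwine_pow Φ (shiftMap K (m + 1)) X hIntw r w
    rw [hr, hw, map_zero, map_smul, he0] at h1
    exact (smul_ne_zero hc hv1) h1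
  refine ⟨LinearEquiv.ofInjectiveOfFinrankEq Φ hinj (by simp [hdim]), ?_⟩
  intro w
  exact hIntw w

end SingleBlock

section MuForm

variable {K : Type*} [Field K] {V : Type*} [AddCommGroup V] [Module K V]

lemma exists_repr_right [FiniteDimensional K V] (B : V →ₗ[K] V →ₗ[K] K)
    (hnd : ∀ x, (∀ w, B x w = 0) → x = 0) (φ : V →ₗ[K] K) : ∃ y, ∀ v, B v y = φ v := by
  have hnd' : ∀ y, (∀ w, B.flip y w = 0) → y = 0 := by
    intro y hy
    rw [← Module.forall_dual_apply_eq_zero_iff K]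
    intro ψ
    obtain ⟨x, hx⟩ := exists_repr B hnd ψ
    rw [← hx]
    exact hy x
  obtain ⟨y, hy⟩ := exists_repr B.flip hnd' φ
  exact ⟨y, fun v => by rw [← hy]; rfl⟩

lemma mu_form [CharP K 2] [FiniteDimensional K V] (U : V →ₗ[K] V) (m : ℕ)
    (hdim : finrank K V = 2 * m + 1) (w0 : V)
    (hspan : ⊤ ≤ Submodule.span K (Set.range fun i : Fin (2 * m + 1) => (U ^ (i : ℕ)) w0))
    (b B : V →ₗ[K] V →ₗ[K] K)
    (hb : ∀ v w, b (U v) (U w) = b v w) (halt : ∀ v, b v v = 0) (hsym : ∀ v w, b v w = b w v)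
    (hB : ∀ v w, B (U v) (U w) = B v w) (hnd : ∀ x, (∀ w, B x w = 0) → x = 0) :
    ∃ M : V →ₗ[K] V →ₗ[K] K, (∀ v w, M (U v) (U w) = M v w) ∧
      ∀ v w, b v w = M v w + M w v := by
  have hsurj : ∀ n : ℕ, Function.Surjective ((U ^ n : V →ₗ[K] V) : V → V) := by
    intro n
    rw [Module.End.coe_pow]
    exact (surj_of_nondeg B U hB hnd).iterate _
  let bas := basisOfTopLeSpanOfCardEqFinrank
    (fun i : Fin (2 * m + 1) => (U ^ (i : ℕ)) w0) hspan (by simp [hdim])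
  have hbas : ∀ i : Fin (2 * m + 1), bas i = (U ^ (i : ℕ)) w0 := fun i => by
    simp [bas]
  set x0 := (U ^ m) w0 with hx0
  let φ : V →ₗ[K] K := bas.constr K fun i : Fin (2 * m + 1) =>
    if m < (i : ℕ) then b ((U ^ (i : ℕ)) w0) x0 else 0
  have hφ : ∀ i, i < 2 * m + 1 → φ ((U ^ i) w0) = if m < i then b ((U ^ i) w0) x0 else 0 := by
    intro i hi
    have := bas.constr_basis K (fun i : Fin (2 * m + 1) =>
      if m < (i : ℕ) then b ((U ^ (i : ℕ)) w0) x0 else 0) ⟨i, hi⟩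
    rw [hbas] at this
    exact this
  obtain ⟨y, hy⟩ := exists_repr_right B hnd φ
  obtain ⟨y', rfl⟩ := hsurj m y
  set C : V →ₗ[K] V := ∑ i, (bas.repr y' i) • U ^ (i : ℕ) with hC
  have hCU : Commute C U := by
    rw [hC]
    apply Commute.sum_left
    intro i _
    exact (Commute.pow_self U i).smul_left _
  have hCw : C w0 = y' := by
    conv_rhs => rw [← bas.sum_repr y']
    rw [hC, LinearMap.sum_apply]
    apply Finset.sum_congr rfl
    intro i _
    rw [hbas, LinearMap.smul_apply]
  have hCx : C x0 = (U ^ m) y' := by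
    rw [← hCw, hx0, ← Module.End.mul_apply, (hCU.pow_right m).eq, Module.End.mul_apply]
  set M : V →ₗ[K] V →ₗ[K] K := B.compl₂ C with hM
  have hMa : ∀ v w, M v w = B v (C w) := fun v w => by rw [hM, LinearMap.compl₂_apply]
  have hMinv : ∀ v w, M (U v) (U w) = M v w := by
    intro v w
    have : C (U w) = U (C w) := by
      rw [← Module.End.mul_apply, hCU.eq, Module.End.mul_apply]
    rw [hMa, hMa, this, hB]
  have hMx : ∀ v, M v x0 = φ v := fun v => by rw [hMa, hCx, hy]
  refine ⟨M, hMinv, ?_⟩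
  set F : V →ₗ[K] V →ₗ[K] K := M + M.flip - b with hF
  have hFa : ∀ v w, F v w = M v w + M w v - b v w := fun v w => by simp [hF]
  have hFinv : ∀ v w, F (U v) (U w) = F v w := fun v w => by
    rw [hFa, hFa, hMinv, hMinv, hb]
  have hFk : ∀ k, k < 2 * m + 1 → F ((U ^ k) w0) x0 = 0 := by
    intro k hk
    rw [hFa, hMx, hφ k hk]
    rcases lt_trichotomy k m with h | h | h
    · obtain ⟨i, rfl⟩ := Nat.exists_eq_add_of_lt h
      have e1 : M x0 ((U ^ k) w0) = M ((U ^ (k + i + 1 + (i + 1))) w0) x0 := by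
        rw [← inv_pow_form M U hMinv (i + 1), hx0, ← Module.End.mul_apply, ← Module.End.mul_apply,
          ← pow_add, ← pow_add]
        congr 3 <;> ring_nf
      have e2 : b x0 ((U ^ k) w0) = b ((U ^ (k + i + 1 + (i + 1))) w0) x0 := by
        rw [← inv_pow_form b U hb (i + 1), hx0, ← Module.End.mul_apply, ← Module.End.mul_apply,
          ← pow_add, ← pow_add]
        congr 3 <;> ring_nf
      rw [if_neg (by omega), zero_add, e1, hMx, hφ _ (by omega), if_pos (by omega), hsym ((U ^ k) w0) x0, e2,
        sub_self]
    · subst h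
      rw [if_neg (by omega), ← hx0, hMx, hx0, hφ _ (by omega), if_neg (by omega), halt]
      simp
    · obtain ⟨i, rfl⟩ := Nat.exists_eq_add_of_lt h
      have e1 : M x0 ((U ^ (m + i + 1)) w0) = M ((U ^ (m - (i + 1))) w0) x0 := by
        rw [← inv_pow_form M U hMinv (i + 1) ((U ^ (m - (i + 1))) w0), hx0,
          ← Module.End.mul_apply, ← Module.End.mul_apply, ← pow_add, ← pow_add,
          Nat.add_sub_cancel' (by omega), show i + 1 + m = m + i + 1 by ring]
      rw [if_pos (by omega), e1, hMx, hφ _ (by omega), if_neg (by omega), add_zero, sub_self]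
  have hFx : ∀ v, F v x0 = 0 := by
    intro v
    have hv : v ∈ Submodule.span K (Set.range fun i : Fin (2 * m + 1) => (U ^ (i : ℕ)) w0) :=
      hspan Submodule.mem_top
    induction hv using Submodule.span_induction with
    | mem x hx =>
      obtain ⟨i, rfl⟩ := hx
      exact hFk i i.isLt
    | zero => simp
    | add x y _ _ hx hy => rw [map_add, LinearMap.add_apply, hx, hy, add_zero]
    | smul c x _ hx => rw [map_smul, LinearMap.smul_apply, hx, smul_zero]
  have hF0 : ∀ v w, F v w = 0 := by
    intro v w
    have hw : w ∈ Submodule.span K (Set.range fun i : Fin (2 * m + 1) => (U ^ (i : ℕ)) w0) :=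
      hspan Submodule.mem_top
    induction hw using Submodule.span_induction with
    | mem x hx =>
      obtain ⟨i, rfl⟩ := hx
      obtain ⟨z, hz⟩ := hsurj i ((U ^ m) v)
      have : F v ((U ^ (i : ℕ)) w0) = F z x0 := by
        rw [← inv_pow_form F U hFinv m, ← hz, ← inv_pow_form F U hFinv i z, hx0,
          ← Module.End.mul_apply, ← Module.End.mul_apply, ← pow_add, ← pow_add, add_comm (i : ℕ) m]
      exact this.trans (hFx z)
    | zero => simp
    | add x y _ _ hx hy => rw [map_add, hx, hy, add_zero]
    | smul c x _ hx => rw [map_smul, hx, smul_zero]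
  intro v w
  have := hF0 v w
  rw [hFa, sub_eq_zero] at this
  exact this.symm

/-- powers of the Jordan block applied to the cyclic vector span -/
lemma jordan_span (m : ℕ) :
    ⊤ ≤ Submodule.span K (Set.range fun i : Fin (m + 1) =>
      (jordanBlockMap K (m + 1) ^ (i : ℕ)) (Pi.single (Fin.last m) 1)) := by
  set U := jordanBlockMap K (m + 1) with hU
  set w0 : Fin (m + 1) → K := Pi.single (Fin.last m) 1 with hw0
  set T := Submodule.span K (Set.range fun i : Fin (m + 1) => (U ^ (i : ℕ)) w0) with hT
  have h1 : ∀ r s, r + s ≤ m → (shiftMap K (m + 1) ^ r) ((U ^ s) w0) ∈ T := by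
    intro r
    induction r with
    | zero =>
      intro s hs
      exact Submodule.subset_span ⟨⟨s, by omega⟩, by simp⟩
    | succ r ih =>
      intro s hs
      have : (shiftMap K (m + 1) ^ (r + 1)) ((U ^ s) w0)
          = (shiftMap K (m + 1) ^ r) ((U ^ (s + 1)) w0)
            - (shiftMap K (m + 1) ^ r) ((U ^ s) w0) := by
        rw [pow_succ, Module.End.mul_apply, ← map_sub, pow_succ', Module.End.mul_apply]
        congr 1
        rw [shiftMap_eq, LinearMap.sub_apply, Module.End.one_apply]
      rw [this]
      exact T.sub_mem (ih _ (by omega)) (ih _ (by omega))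
  have h2 : ∀ i : Fin (m + 1), (Pi.single i 1 : Fin (m + 1) → K) ∈ T := by
    intro i
    have hr := h1 (m - i) 0 (by omega)
    have : (shiftMap K (m + 1) ^ (m - (i : ℕ))) ((U ^ 0) w0) = Pi.single i 1 := by
      funext x
      rw [shiftMap_pow_apply, pow_zero, Module.End.one_apply, hw0]
      have hx := x.isLt
      have hi := i.isLt
      by_cases hxi : x = i
      · subst hxi
        rw [dif_pos (by omega), Pi.single_eq_same]
        have : (⟨(x : ℕ) + (m - x), by omega⟩ : Fin (m + 1)) = Fin.last m := by
          apply Fin.ext; simp only [Fin.val_last]; omega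
        rw [this, Pi.single_eq_same]
      · have hxi' : (x : ℕ) ≠ i := fun h => hxi (Fin.ext h)
        rw [Pi.single_eq_of_ne hxi]
        split_ifs with h
        · apply Pi.single_eq_of_ne
          intro h'
          have := congrArg Fin.val h'
          simp only [Fin.val_last] at this
          omega
        · rfl
    rwa [this] at hr
  intro w _
  have : w = ∑ i, w i • (Pi.single i 1 : Fin (m + 1) → K) := by
    conv_lhs => rw [pi_eq_sum_univ' w]
  rw [this]
  exact T.sum_mem fun i _ => T.smul_mem _ (h2 i)

end MuForm

section Factor

variable {K : Type*} [Field K]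

/-- model inclusion of the block of size `a` into the block of size `n = p a` -/
def jIns (K : Type*) [Field K] (p a n : ℕ) (hn : n = p * a) :
    (Fin a → K) →ₗ[K] (Fin n → K) where
  toFun w i := if (i : ℕ) % p = p - 1 then
    w ⟨i / p, Nat.div_lt_of_lt_mul (by rw [← hn]; exact i.isLt)⟩ else 0
  map_add' v w := by
    funext i
    simp only [Pi.add_apply]
    split_ifs <;> simp
  map_smul' c w := by
    funext i
    simp

lemma jIns_apply (p a n : ℕ) (hn : n = p * a) (w : Fin a → K) (i : Fin n) :
    jIns K p a n hn w i = if (i : ℕ) % p = p - 1 then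
      w ⟨i / p, Nat.div_lt_of_lt_mul (by rw [← hn]; exact i.isLt)⟩ else 0 := rfl

/-- model projections -/
def pProj (K : Type*) [Field K] (p a n i : ℕ) : (Fin n → K) →ₗ[K] (Fin a → K) where
  toFun w m := if h : p * (m : ℕ) + (p - 1 - i) < n then w ⟨_, h⟩ else 0
  map_add' v w := by
    funext i
    simp only [Pi.add_apply]
    split_ifs <;> simp
  map_smul' c w := by
    funext i
    simp only [Pi.smul_apply]
    split_ifs <;> simp

lemma pProj_apply (p a n i : ℕ) (w : Fin n → K) (m : Fin a) :
    pProj K p a n i w m = if h : p * (m : ℕ) + (p - 1 - i) < n then w ⟨_, h⟩ else 0 := rfl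

lemma fin_fun_congr {K : Type*} {n : ℕ} (w : Fin n → K) (x y : ℕ) (hx : x < n) (hy : y < n) (h : x = y) :
    w ⟨x, hx⟩ = w ⟨y, hy⟩ := by subst h; rfl

lemma jIns_shift (p a n : ℕ) (hp : 1 ≤ p) (hn : n = p * a) (w : Fin a → K) :
    jIns K p a n hn (shiftMap K a w) = (shiftMap K n ^ p) (jIns K p a n hn w) := by
  funext i
  have hs : ∀ x : Fin a, shiftMap K a w x = if h : (x : ℕ) + 1 < a then w ⟨x + 1, h⟩ else 0 := by
    intro x
    have := shiftMap_pow_apply (K := K) a 1 w x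
    rwa [pow_one] at this
  rw [shiftMap_pow_apply, jIns_apply, hs]
  have hdiv : ((i : ℕ) + p) / p = i / p + 1 := Nat.add_div_right _ hp
  have hiff : (i : ℕ) + p < n ↔ (i : ℕ) / p + 1 < a := by
    rw [← hdiv, Nat.div_lt_iff_lt_mul hp, mul_comm a p, ← hn]
  by_cases h1 : (i : ℕ) % p = p - 1
  · rw [if_pos h1]
    by_cases h2 : (i : ℕ) / p + 1 < a
    · rw [dif_pos h2, dif_pos (hiff.2 h2), jIns_apply, if_pos (by simpa using h1)]
      exact fin_fun_congr w _ _ _ _ hdiv.symm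
    · rw [dif_neg h2, dif_neg (fun h => h2 (hiff.1 h))]
  · rw [if_neg h1]
    split_ifs with h
    · rw [jIns_apply, if_neg (by simpa using h1)]
    · rfl

lemma pProj_shift (p a n i : ℕ) (hp : 1 ≤ p) (hn : n = p * a) (w : Fin n → K) :
    pProj K p a n i ((shiftMap K n ^ p) w) = shiftMap K a (pProj K p a n i w) := by
  funext m
  have hs : ∀ (v : Fin a → K) (x : Fin a),
      shiftMap K a v x = if h : (x : ℕ) + 1 < a then v ⟨x + 1, h⟩ else 0 := by
    intro v x
    have := shiftMap_pow_apply (K := K) a 1 v x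
    rwa [pow_one] at this
  have hb : ∀ x, p * x + (p - 1 - i) < n ↔ x < a := by
    intro x
    constructor
    · intro h
      by_contra hc
      have : p * a ≤ p * x := Nat.mul_le_mul_left p (by omega)
      omega
    · intro h
      have : p * (x + 1) ≤ p * a := Nat.mul_le_mul_left p (by omega)
      rw [mul_add] at this
      omega
  rw [pProj_apply, hs, dif_pos ((hb _).2 m.isLt), shiftMap_pow_apply]
  have e : p * ((m : ℕ) + 1) + (p - 1 - i) = p * m + (p - 1 - i) + p := by ring
  by_cases h : (m : ℕ) + 1 < a
  · rw [dif_pos h, pProj_apply, dif_pos ((hb _).2 h), dif_pos (by rw [← e]; exact (hb _).2 h)]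
    exact fin_fun_congr w _ _ _ _ e.symm
  · rw [dif_neg h, dif_neg]
    intro h'
    apply h
    rw [← hb, e]
    exact h'

lemma proj_sum (p a n : ℕ) (hp : 1 ≤ p) (hn : n = p * a) (w : Fin n → K) :
    ∑ i ∈ Finset.range p, (shiftMap K n ^ i) (jIns K p a n hn (pProj K p a n i w)) = w := by
  funext x
  rw [Finset.sum_apply]
  have hm : (x : ℕ) % p < p := Nat.mod_lt _ hp
  have hx : p * ((x : ℕ) / p) + (x : ℕ) % p = x := Nat.div_add_mod _ _
  have hxa : (x : ℕ) / p < a := Nat.div_lt_of_lt_mul (by rw [← hn]; exact x.isLt)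
  have hxn := x.isLt
  have hle : p * ((x : ℕ) / p + 1) ≤ n := by
    calc p * ((x : ℕ) / p + 1) ≤ p * a := Nat.mul_le_mul_left p (by omega)
      _ = n := hn.symm
  rw [mul_add, mul_one] at hle
  rw [Finset.sum_eq_single (p - 1 - (x : ℕ) % p)]
  · have e1 : (x : ℕ) + (p - 1 - (x : ℕ) % p) = p * ((x : ℕ) / p) + (p - 1) := by omega
    have e2 : ((x : ℕ) + (p - 1 - (x : ℕ) % p)) / p = (x : ℕ) / p := by
      rw [e1, Nat.mul_add_div hp, Nat.div_eq_of_lt (by omega : p - 1 < p), add_zero]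
    have e3 : ((x : ℕ) + (p - 1 - (x : ℕ) % p)) % p = p - 1 := by
      rw [e1, Nat.mul_add_mod, Nat.mod_eq_of_lt (by omega)]
    rw [shiftMap_pow_apply, dif_pos (by omega), jIns_apply, if_pos e3, pProj_apply]
    have e4 : p * (((x : ℕ) + (p - 1 - (x : ℕ) % p)) / p) + (p - 1 - (p - 1 - (x : ℕ) % p)) = x := by
      rw [e2]; omega
    rw [dif_pos (by simp only; omega)]
    exact fin_fun_congr w _ _ _ _ e4
  · intro i hi hne
    rw [Finset.mem_range] at hi
    rw [shiftMap_pow_apply]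
    split_ifs with h
    · rw [jIns_apply, if_neg]
      simp only
      intro h'
      apply hne
      have h1 : ((x : ℕ) % p + i) % p = p - 1 := by rw [← h', Nat.mod_add_mod]
      by_cases hlt : (x : ℕ) % p + i < p
      · rw [Nat.mod_eq_of_lt hlt] at h1
        omega
      · rw [Nat.mod_eq_sub_mod (by omega), Nat.mod_eq_of_lt (by omega)] at h1
        omega
    · rfl
  · intro h
    exact absurd (Finset.mem_range.2 (by omega)) h

end Factor

section Factor2

variable {K : Type*} [Field K] {V : Type*} [AddCommGroup V] [Module K V]

lemma shift_last (m : ℕ) :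
    (shiftMap K (m + 1) ^ m) (Pi.single (Fin.last m) 1) = Pi.single 0 1 := by
  funext x
  rw [shiftMap_pow_apply]
  by_cases hx : x = 0
  · subst hx
    rw [dif_pos (by simp), Pi.single_eq_same]
    have : (⟨((0 : Fin (m + 1)) : ℕ) + m, by simp⟩ : Fin (m + 1)) = Fin.last m := by
      apply Fin.ext; simp
    rw [this, Pi.single_eq_same]
  · have hx' : (x : ℕ) ≠ 0 := fun h => hx (Fin.ext h)
    rw [dif_neg (by omega), Pi.single_eq_of_ne hx]

lemma shift_pow_zero (n : ℕ) (w : Fin n → K) : (shiftMap K n ^ n) w = 0 := by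
  funext x
  rw [shiftMap_pow_apply, dif_neg (by omega)]
  rfl

lemma jIns_last (p m n' : ℕ) (hp : 1 ≤ p) (hn : n' + 1 = p * (m + 1)) :
    jIns K p (m + 1) (n' + 1) hn (Pi.single (Fin.last m) 1) = Pi.single (Fin.last n') 1 := by
  funext x
  rw [jIns_apply]
  have hx : p * ((x : ℕ) / p) + (x : ℕ) % p = x := Nat.div_add_mod _ _
  have hm : (x : ℕ) % p < p := Nat.mod_lt _ hp
  have hn2 : n' + 1 = p * m + p := by rw [hn]; ring
  by_cases h : x = Fin.last n'
  · have e1 : (x : ℕ) = p * m + (p - 1) := by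
      rw [h, Fin.val_last]; omega
    have e2 : (x : ℕ) % p = p - 1 := by
      rw [e1, Nat.mul_add_mod, Nat.mod_eq_of_lt (by omega)]
    have e3 : (x : ℕ) / p = m := by
      rw [e1, Nat.mul_add_div hp, Nat.div_eq_of_lt (by omega : p - 1 < p), add_zero]
    rw [if_pos e2, h, Pi.single_eq_same]
    have : (⟨((Fin.last n' : Fin (n' + 1)) : ℕ) / p, by rw [← h, e3]; omega⟩ : Fin (m + 1))
        = Fin.last m := by
      apply Fin.ext
      rw [h] at e3
      exact e3
    rw [this, Pi.single_eq_same]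
  · rw [Pi.single_eq_of_ne h]
    split_ifs with h1
    · apply Pi.single_eq_of_ne
      intro h2
      apply h
      have h3 := congrArg Fin.val h2
      simp only [Fin.val_last] at h3
      apply Fin.ext
      rw [Fin.val_last]
      rw [h3, h1] at hx
      omega
    · rfl

lemma top_form_ne [CharP K 2] (u : V →ₗ[K] V) (n' : ℕ) (Φ : (Fin (n' + 1) → K) ≃ₗ[K] V)
    (hΦ : ∀ w, Φ (shiftMap K (n' + 1) w) = (u - 1) (Φ w))
    (b : V →ₗ[K] V →ₗ[K] K) (hinv : ∀ v w, b (u v) (u w) = b v w)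
    (hnd : ∀ x, (∀ w, b x w = 0) → x = 0) :
    b (((u - 1) ^ n') (Φ (Pi.single (Fin.last n') 1))) (Φ (Pi.single (Fin.last n') 1)) ≠ 0 := by
  intro h0
  set e : Fin (n' + 1) → K := Pi.single (Fin.last n') 1 with he
  have hpw := intertwine_pow Φ.toLinearMap (shiftMap K (n' + 1)) (u - 1) hΦ
  have hJ : ∀ w, Φ.toLinearMap (jordanBlockMap K (n' + 1) w) = u (Φ.toLinearMap w) := by
    intro w
    have := hΦ w
    rw [shiftMap_eq, LinearMap.sub_apply, LinearMap.sub_apply, map_sub] at this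
    simpa using this
  have hJp := intertwine_pow Φ.toLinearMap (jordanBlockMap K (n' + 1)) u hJ
  have hx : ((u - 1) ^ n') (Φ e) = 0 := by
    apply hnd
    intro w
    obtain ⟨z, rfl⟩ := Φ.surjective w
    have hz := jordan_span (K := K) n' (Submodule.mem_top (x := z))
    induction hz using Submodule.span_induction with
    | mem x hx =>
      obtain ⟨i, rfl⟩ := hx
      have := hJp i e
      simp only [LinearEquiv.coe_coe] at this
      rw [← he, this, fix_form b u hinv, h0]
      have h1 := hpw (n' + 1) e
      rw [shift_pow_zero, map_zero] at h1
      rw [← Module.End.mul_apply, ← pow_succ']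
      exact h1.symm
    | zero => simp
    | add x y _ _ hx hy => rw [map_add, map_add, hx, hy, add_zero]
    | smul c x _ hx => rw [map_smul, map_smul, hx, smul_zero]
  have h2 := hpw n' e
  rw [he, shift_last] at h2
  simp only [LinearEquiv.coe_coe] at h2
  rw [← he, hx] at h2
  have h3 := Φ.map_eq_zero_iff.1 h2
  have := congrFun h3 0
  simp at this

lemma factor [CharP K 2] [FiniteDimensional K V] (u : V →ₗ[K] V) (r p q m n : ℕ)
    (hp : p = 2 ^ (r + 1)) (hq : q = 2 ^ r) (hn : n = p * (2 * m + 1))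
    (Φ : (Fin n → K) ≃ₗ[K] V) (hΦ : ∀ w, Φ (shiftMap K n w) = (u - 1) (Φ w))
    (b : V →ₗ[K] V →ₗ[K] K) (hinv : ∀ v w, b (u v) (u w) = b v w)
    (hsym : ∀ v w, b v w = b w v) (halt : ∀ v, b v v = 0)
    (hnd : ∀ x, (∀ w, b x w = 0) → x = 0) :
    ∃ (j : (Fin (2 * m + 1) → K) →ₗ[K] V) (pr : ℕ → (V →ₗ[K] (Fin (2 * m + 1) → K)))
      (M : (Fin (2 * m + 1) → K) →ₗ[K] (Fin (2 * m + 1) → K) →ₗ[K] K),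
      (∀ w, (u ^ p) (j w) = j (jordanBlockMap K (2 * m + 1) w)) ∧
      (∀ i v, pr i ((u ^ p) v) = jordanBlockMap K (2 * m + 1) (pr i v)) ∧
      (∀ v, ∑ i ∈ Finset.range p, ((u - 1) ^ i) (j (pr i v)) = v) ∧
      (∀ x, (∀ w, b ((u ^ q) (j x)) (j w) = 0) → x = 0) ∧
      (∀ v w, M (jordanBlockMap K (2 * m + 1) v) (jordanBlockMap K (2 * m + 1) w) = M v w) ∧
      (∀ v w, b (j v) (j w) = M v w + M w v) := by
  have hp1 : 1 ≤ p := by rw [hp]; exact Nat.one_le_two_pow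
  set a := 2 * m + 1 with ha
  set J := jordanBlockMap K a with hJ
  set j : (Fin a → K) →ₗ[K] V := Φ.toLinearMap ∘ₗ jIns K p a n hn with hj
  have hja : ∀ w, j w = Φ (jIns K p a n hn w) := fun w => rfl
  set pr : ℕ → (V →ₗ[K] (Fin a → K)) := fun i => pProj K p a n i ∘ₗ Φ.symm.toLinearMap with hpr
  have hpra : ∀ i v, pr i v = pProj K p a n i (Φ.symm v) := fun i v => rfl
  have hpw := intertwine_pow Φ.toLinearMap (shiftMap K n) (u - 1) hΦ
  simp only [LinearEquiv.coe_coe] at hpw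
  have hup : u ^ p - 1 = (u - 1) ^ p := by rw [hp, end_sub_pow]
  have hjN : ∀ w, j (shiftMap K a w) = (u ^ p - 1) (j w) := by
    intro w
    rw [hja, hja, jIns_shift p a n hp1 hn, hpw, hup]
  have h1 : ∀ w, (u ^ p) (j w) = j (J w) := by
    intro w
    have := hjN w
    rw [hJ, jordanBlockMap_eq, LinearMap.add_apply, map_add, this, LinearMap.sub_apply]
    simp
  have h2 : ∀ i v, pr i ((u ^ p) v) = J (pr i v) := by
    intro i v
    obtain ⟨z, rfl⟩ := Φ.surjective v
    have e : (u ^ p) (Φ z) = Φ (z + (shiftMap K n ^ p) z) := by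
      rw [map_add, hpw, ← hup, LinearMap.sub_apply]
      simp
    rw [hpra, hpra, e, Φ.symm_apply_apply, Φ.symm_apply_apply, map_add, pProj_shift p a n i hp1 hn,
      hJ, jordanBlockMap_eq, LinearMap.add_apply, Module.End.one_apply]
  have h3 : ∀ v, ∑ i ∈ Finset.range p, ((u - 1) ^ i) (j (pr i v)) = v := by
    intro v
    obtain ⟨z, rfl⟩ := Φ.surjective v
    conv_rhs => rw [← proj_sum p a n hp1 hn z, map_sum]
    apply Finset.sum_congr rfl
    intro i _
    rw [hpw, hja, hpra, Φ.symm_apply_apply]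
  set B : (Fin a → K) →ₗ[K] (Fin a → K) →ₗ[K] K := b.compl₁₂ ((u ^ q) ∘ₗ j) j with hB
  have hBa : ∀ v w, B v w = b ((u ^ q) (j v)) (j w) := fun v w => rfl
  set b' : (Fin a → K) →ₗ[K] (Fin a → K) →ₗ[K] K := b.compl₁₂ j j with hb'
  have hb'a : ∀ v w, b' v w = b (j v) (j w) := fun v w => rfl
  have hcpq : ∀ v, (u ^ q) ((u ^ p) v) = (u ^ p) ((u ^ q) v) := by
    intro v
    rw [← Module.End.mul_apply, ← Module.End.mul_apply, ← pow_add, ← pow_add, add_comm]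
  have hBinv : ∀ v w, B (J v) (J w) = B v w := by
    intro v w
    rw [hBa, hBa, ← h1, ← h1, hcpq, inv_pow_form b u hinv]
  have hb'inv : ∀ v w, b' (J v) (J w) = b' v w := by
    intro v w
    rw [hb'a, hb'a, ← h1, ← h1, inv_pow_form b u hinv]
  have hjp := intertwine_pow j (shiftMap K a) (u ^ p - 1) hjN
  set w0 : Fin a → K := Pi.single (Fin.last (2 * m)) 1 with hw0
  have hJ1 : J - 1 = shiftMap K a := by rw [hJ, shiftMap_eq]
  have hne : B (Pi.single 0 1) w0 ≠ 0 := by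
    have ht := three_form b u hinv hsym r (2 * m) p q hp hq (j w0) (by
      rw [← hjp, ← ha, shift_pow_zero, map_zero])
    rw [← hjp, shift_last] at ht
    have hz := alt_zero_form b' J hb'inv (fun g => halt _) m w0 (by
      rw [hJ1, ← ha, shift_pow_zero])
    rw [hJ1, shift_last, hb'a] at hz
    rw [hz, zero_add] at ht
    rw [hBa, ← ht]
    obtain ⟨n', hn'⟩ : ∃ n', n = n' + 1 := ⟨n - 1, by
      have : 1 ≤ p * (2 * m + 1) := Nat.mul_pos hp1 (by omega)
      rw [← ha, ← hn] at this
      omega⟩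
    subst hn'
    rw [← hn, Nat.add_sub_cancel, hja, hw0, jIns_last p (2 * m) n' hp1 hn]
    exact top_form_ne u n' Φ hΦ b hinv hnd
  have hJs : Function.Surjective J := by
    obtain ⟨g, -, hg⟩ := jordan_inv K a
    intro w
    exact ⟨g w, by rw [hJ, ← Module.End.mul_apply, hg, Module.End.one_apply]⟩
  have hBnd : ∀ x, (∀ w, B x w = 0) → x = 0 := by
    intro x hx
    by_contra hx0
    obtain ⟨s, c, hc, hs⟩ := shift_top (2 * m) x hx0
    have hst : ∀ t w, B ((shiftMap K a ^ t) x) w = 0 := by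
      intro t
      induction t with
      | zero => simpa using hx
      | succ t ih =>
        intro w
        obtain ⟨w', rfl⟩ := hJs w
        rw [pow_succ', Module.End.mul_apply]
        conv_lhs => rw [← hJ1]
        rw [LinearMap.sub_apply, map_sub, LinearMap.sub_apply, hBinv, hJ1, ih, Module.End.one_apply, ih,
          sub_zero]
    have := hst s w0
    rw [hs, map_smul, LinearMap.smul_apply] at this
    exact (smul_ne_zero hc hne) this
  obtain ⟨M, hM1, hM2⟩ := mu_form J m (by simp [ha]) w0 (jordan_span (2 * m)) b' B hb'inv
    (fun v => halt _) (fun v w => hsym _ _) hBinv hBnd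
  exact ⟨j, pr, M, h1, h2, h3, hBnd, hM1, hM2⟩

end Factor2

section TensorForms

open TensorProduct

variable {K : Type*} [Field K]
  {V₁ : Type*} [AddCommGroup V₁] [Module K V₁] {V₂ : Type*} [AddCommGroup V₂] [Module K V₂]

lemma tensor_form_ext (F G : V₁ ⊗[K] V₂ →ₗ[K] V₁ ⊗[K] V₂ →ₗ[K] K)
    (h : ∀ v w v' w', F (v ⊗ₜ[K] w) (v' ⊗ₜ[K] w') = G (v ⊗ₜ[K] w) (v' ⊗ₜ[K] w')) : F = G :=
  TensorProduct.ext' fun v w => TensorProduct.ext' fun v' w' => h v w v' w'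

lemma tensor_form_sym (b₁ : V₁ →ₗ[K] V₁ →ₗ[K] K) (b₂ : V₂ →ₗ[K] V₂ →ₗ[K] K)
    (bT : V₁ ⊗[K] V₂ →ₗ[K] V₁ ⊗[K] V₂ →ₗ[K] K)
    (hbT : ∀ v w v' w', bT (v ⊗ₜ[K] w) (v' ⊗ₜ[K] w') = b₁ v v' * b₂ w w')
    (h₁ : ∀ v w, b₁ v w = b₁ w v) (h₂ : ∀ v w, b₂ v w = b₂ w v) (x y : V₁ ⊗[K] V₂) :
    bT x y = bT y x := by
  have : bT = bT.flip := by
    apply tensor_form_ext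
    intro v w v' w'
    rw [LinearMap.flip_apply, hbT, hbT, h₁, h₂]
  conv_lhs => rw [this]
  rfl

lemma tensor_form_inv (b₁ : V₁ →ₗ[K] V₁ →ₗ[K] K) (b₂ : V₂ →ₗ[K] V₂ →ₗ[K] K)
    (bT : V₁ ⊗[K] V₂ →ₗ[K] V₁ ⊗[K] V₂ →ₗ[K] K)
    (hbT : ∀ v w v' w', bT (v ⊗ₜ[K] w) (v' ⊗ₜ[K] w') = b₁ v v' * b₂ w w')
    (f₁ : V₁ →ₗ[K] V₁) (f₂ : V₂ →ₗ[K] V₂)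
    (h₁ : ∀ v w, b₁ (f₁ v) (f₁ w) = b₁ v w) (h₂ : ∀ v w, b₂ (f₂ v) (f₂ w) = b₂ v w)
    (x y : V₁ ⊗[K] V₂) :
    bT (TensorProduct.map f₁ f₂ x) (TensorProduct.map f₁ f₂ y) = bT x y := by
  have : bT.compl₁₂ (TensorProduct.map f₁ f₂) (TensorProduct.map f₁ f₂) = bT := by
    apply tensor_form_ext
    intro v w v' w'
    rw [LinearMap.compl₁₂_apply, TensorProduct.map_tmul, TensorProduct.map_tmul, hbT, hbT, h₁, h₂]
  exact LinearMap.congr_fun (LinearMap.congr_fun this x) y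

/-- tensor product of bilinear forms -/
noncomputable def formTensor (b₁ : V₁ →ₗ[K] V₁ →ₗ[K] K) (b₂ : V₂ →ₗ[K] V₂ →ₗ[K] K) :
    V₁ ⊗[K] V₂ →ₗ[K] V₁ ⊗[K] V₂ →ₗ[K] K :=
  TensorProduct.dualDistrib K V₁ V₂ ∘ₗ TensorProduct.map b₁ b₂

lemma formTensor_tmul (b₁ : V₁ →ₗ[K] V₁ →ₗ[K] K) (b₂ : V₂ →ₗ[K] V₂ →ₗ[K] K) (v w v' w') :
    formTensor b₁ b₂ (v ⊗ₜ[K] w) (v' ⊗ₜ[K] w') = b₁ v v' * b₂ w w' := by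
  rw [formTensor, LinearMap.comp_apply, TensorProduct.map_tmul, TensorProduct.dualDistrib_apply]

lemma tensor_nondeg [FiniteDimensional K V₁] [FiniteDimensional K V₂]
    (b₁ : V₁ →ₗ[K] V₁ →ₗ[K] K) (b₂ : V₂ →ₗ[K] V₂ →ₗ[K] K)
    (bT : V₁ ⊗[K] V₂ →ₗ[K] V₁ ⊗[K] V₂ →ₗ[K] K)
    (hbT : ∀ v w v' w', bT (v ⊗ₜ[K] w) (v' ⊗ₜ[K] w') = b₁ v v' * b₂ w w')
    (h₁ : ∀ x, (∀ w, b₁ x w = 0) → x = 0) (h₂ : ∀ x, (∀ w, b₂ x w = 0) → x = 0)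
    (x : V₁ ⊗[K] V₂) (hx : ∀ y, bT x y = 0) : x = 0 := by
  have hT : bT = formTensor b₁ b₂ := tensor_form_ext _ _ fun v w v' w' => by rw [hbT, formTensor_tmul]
  have i₁ : Function.Injective b₁ := by
    rw [injective_iff_map_eq_zero]
    intro v hv
    exact h₁ v fun w => by rw [hv, LinearMap.zero_apply]
  have i₂ : Function.Injective b₂ := by
    rw [injective_iff_map_eq_zero]
    intro v hv
    exact h₂ v fun w => by rw [hv, LinearMap.zero_apply]
  have i₃ : Function.Injective (TensorProduct.map b₁ b₂) :=
    TensorProduct.map_injective_of_flat_flat _ _ i₁ i₂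
  have i₄ : Function.Injective (TensorProduct.dualDistrib K V₁ V₂) :=
    (TensorProduct.dualDistribEquiv K V₁ V₂).injective
  apply i₃
  apply i₄
  rw [map_zero, map_zero]
  apply LinearMap.ext
  intro y
  have := hx y
  rw [hT] at this
  exact this

lemma nullSub_stable [CharP K 2] {V : Type*} [AddCommGroup V] [Module K V]
    (b : V →ₗ[K] V →ₗ[K] K) (u : V →ₗ[K] V)
    (hinv : ∀ v w, b (u v) (u w) = b v w) (hsym : ∀ v w, b v w = b w v) (d : ℕ)
    (g : V →ₗ[K] V) (hg : Commute g u) (hgb : ∀ v w, b (g v) (g w) = b v w) (v : V)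
    (hv : v ∈ nullSub b u hinv hsym d) : g v ∈ nullSub b u hinv hsym d := by
  obtain ⟨h1, h2⟩ := hv
  have hc : ∀ n : ℕ, ((u - 1) ^ n) (g v) = g (((u - 1) ^ n) v) := by
    intro n
    have : Commute g ((u - 1) ^ n) := (hg.sub_right (Commute.one_right g)).pow_right n
    rw [← Module.End.mul_apply, ← this.eq, Module.End.mul_apply]
  refine ⟨?_, ?_⟩
  · rw [hc, h1, map_zero]
  · rw [hc, hgb, h2]

lemma stable_pow {V : Type*} [AddCommGroup V] [Module K V] (T : Submodule K V) (f : V →ₗ[K] V)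
    (h : ∀ v ∈ T, f v ∈ T) (n : ℕ) : ∀ v ∈ T, (f ^ n) v ∈ T := by
  induction n with
  | zero => intro v hv; simpa using hv
  | succ n ih =>
    intro v hv
    rw [pow_succ', Module.End.mul_apply]
    exact h _ (ih _ hv)

/-- Data describing a single block as an induced object. -/
structure Fac {V : Type*} [AddCommGroup V] [Module K V] {W : Type*} [AddCommGroup W] [Module K W]
    (u : V →ₗ[K] V) (b : V →ₗ[K] V →ₗ[K] K) (p q : ℕ) (U : W →ₗ[K] W) where
  j : W →ₗ[K] V
  pr : ℕ → (V →ₗ[K] W)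
  M : W →ₗ[K] W →ₗ[K] K
  hj : ∀ w, (u ^ p) (j w) = j (U w)
  hpr : ∀ i v, pr i ((u ^ p) v) = U (pr i v)
  hsum : ∀ v, ∑ i ∈ Finset.range p, ((u - 1) ^ i) (j (pr i v)) = v
  hnd : ∀ x, (∀ w, b ((u ^ q) (j x)) (j w) = 0) → x = 0
  hMinv : ∀ v w, M (U v) (U w) = M v w
  hM : ∀ v w, b (j v) (j w) = M v w + M w v

variable {W₁ : Type*} [AddCommGroup W₁] [Module K W₁] {W₂ : Type*} [AddCommGroup W₂] [Module K W₂]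
  {u₁ : V₁ →ₗ[K] V₁} {u₂ : V₂ →ₗ[K] V₂} {b₁ : V₁ →ₗ[K] V₁ →ₗ[K] K} {b₂ : V₂ →ₗ[K] V₂ →ₗ[K] K}
  {p q : ℕ} {U₁ : W₁ →ₗ[K] W₁} {U₂ : W₂ →ₗ[K] W₂}

lemma iota_shift (D₁ : Fac u₁ b₁ p q U₁) (D₂ : Fac u₂ b₂ p q U₂) (x : W₁ ⊗[K] W₂) :
    TensorProduct.map D₁.j D₂.j ((TensorProduct.map U₁ U₂ - 1 : _ →ₗ[K] _) x)
      = ((TensorProduct.map u₁ u₂ ^ p - 1 : V₁ ⊗[K] V₂ →ₗ[K] V₁ ⊗[K] V₂))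
        (TensorProduct.map D₁.j D₂.j x) := by
  have : TensorProduct.map D₁.j D₂.j ∘ₗ TensorProduct.map U₁ U₂
      = TensorProduct.map (u₁ ^ p) (u₂ ^ p) ∘ₗ TensorProduct.map D₁.j D₂.j := by
    apply TensorProduct.ext'
    intro v w
    simp [D₁.hj, D₂.hj]
  have h := LinearMap.congr_fun this x
  rw [LinearMap.comp_apply, LinearMap.comp_apply] at h
  rw [LinearMap.sub_apply, LinearMap.sub_apply, map_sub, h, TensorProduct.map_pow]
  rfl

lemma proj_shift (D₁ : Fac u₁ b₁ p q U₁) (D₂ : Fac u₂ b₂ p q U₂) (i i' : ℕ) (x : V₁ ⊗[K] V₂) :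
    TensorProduct.map (D₁.pr i) (D₂.pr i') ((TensorProduct.map u₁ u₂ ^ p - 1 : _ →ₗ[K] _) x)
      = ((TensorProduct.map U₁ U₂ - 1 : W₁ ⊗[K] W₂ →ₗ[K] W₁ ⊗[K] W₂))
        (TensorProduct.map (D₁.pr i) (D₂.pr i') x) := by
  have : TensorProduct.map (D₁.pr i) (D₂.pr i') ∘ₗ TensorProduct.map (u₁ ^ p) (u₂ ^ p)
      = TensorProduct.map U₁ U₂ ∘ₗ TensorProduct.map (D₁.pr i) (D₂.pr i') := by
    apply TensorProduct.ext'
    intro v w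
    simp [D₁.hpr, D₂.hpr]
  have h := LinearMap.congr_fun this x
  rw [LinearMap.comp_apply, LinearMap.comp_apply] at h
  rw [LinearMap.sub_apply, LinearMap.sub_apply, map_sub, TensorProduct.map_pow, h]
  rfl

lemma decomp (D₁ : Fac u₁ b₁ p q U₁) (D₂ : Fac u₂ b₂ p q U₂) (x : V₁ ⊗[K] V₂) :
    ∑ i ∈ Finset.range p, ∑ i' ∈ Finset.range p,
      TensorProduct.map ((u₁ - 1) ^ i) ((u₂ - 1) ^ i') (TensorProduct.map D₁.j D₂.j
        (TensorProduct.map (D₁.pr i) (D₂.pr i') x)) = x := by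
  induction x using TensorProduct.induction_on with
  | zero => simp
  | tmul v w =>
    conv_rhs => rw [← D₁.hsum v, ← D₂.hsum w, TensorProduct.sum_tmul]
    apply Finset.sum_congr rfl
    intro i _
    rw [TensorProduct.tmul_sum]
    apply Finset.sum_congr rfl
    intro i' _
    simp only [TensorProduct.map_tmul]
  | add x y hx hy =>
    conv_rhs => rw [← hx, ← hy]
    simp only [map_add, Finset.sum_add_distrib]

end TensorForms

section Assembly

open TensorProduct

variable {K : Type*} [Field K]
  {V₁ : Type*} [AddCommGroup V₁] [Module K V₁] {V₂ : Type*} [AddCommGroup V₂] [Module K V₂]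
  {W₁ : Type*} [AddCommGroup W₁] [Module K W₁] {W₂ : Type*} [AddCommGroup W₂] [Module K W₂]
  {u₁ : V₁ →ₗ[K] V₁} {u₂ : V₂ →ₗ[K] V₂} {b₁ : V₁ →ₗ[K] V₁ →ₗ[K] K} {b₂ : V₂ →ₗ[K] V₂ →ₗ[K] K}
  {p q r : ℕ} {U₁ : W₁ →ₗ[K] W₁} {U₂ : W₂ →ₗ[K] W₂}

/-- the form on the multiplicity space -/
noncomputable def mform (D₁ : Fac u₁ b₁ p q U₁) (D₂ : Fac u₂ b₂ p q U₂)
    (bT : V₁ ⊗[K] V₂ →ₗ[K] V₁ ⊗[K] V₂ →ₗ[K] K) : W₁ ⊗[K] W₂ →ₗ[K] W₁ ⊗[K] W₂ →ₗ[K] K :=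
  bT.compl₁₂ ((TensorProduct.map u₁ u₂ ^ q) ∘ₗ TensorProduct.map D₁.j D₂.j)
    (TensorProduct.map D₁.j D₂.j)

lemma mform_apply (D₁ : Fac u₁ b₁ p q U₁) (D₂ : Fac u₂ b₂ p q U₂)
    (bT : V₁ ⊗[K] V₂ →ₗ[K] V₁ ⊗[K] V₂ →ₗ[K] K) (x y : W₁ ⊗[K] W₂) :
    mform D₁ D₂ bT x y = bT ((TensorProduct.map u₁ u₂ ^ q) (TensorProduct.map D₁.j D₂.j x))
      (TensorProduct.map D₁.j D₂.j y) := rfl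

lemma iota_U (D₁ : Fac u₁ b₁ p q U₁) (D₂ : Fac u₂ b₂ p q U₂) (x : W₁ ⊗[K] W₂) :
    TensorProduct.map D₁.j D₂.j (TensorProduct.map U₁ U₂ x)
      = (TensorProduct.map u₁ u₂ ^ p) (TensorProduct.map D₁.j D₂.j x) := by
  have := iota_shift D₁ D₂ x
  rw [LinearMap.sub_apply, LinearMap.sub_apply, map_sub, Module.End.one_apply,
    Module.End.one_apply, sub_left_inj] at this
  exact this

lemma mform_inv [CharP K 2] (D₁ : Fac u₁ b₁ p q U₁) (D₂ : Fac u₂ b₂ p q U₂)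
    (bT : V₁ ⊗[K] V₂ →ₗ[K] V₁ ⊗[K] V₂ →ₗ[K] K)
    (hinv : ∀ x y, bT (TensorProduct.map u₁ u₂ x) (TensorProduct.map u₁ u₂ y) = bT x y)
    (x y : W₁ ⊗[K] W₂) :
    mform D₁ D₂ bT (TensorProduct.map U₁ U₂ x) (TensorProduct.map U₁ U₂ y) = mform D₁ D₂ bT x y := by
  rw [mform_apply, mform_apply, iota_U, iota_U]
  rw [← Module.End.mul_apply, ← pow_add, add_comm q p, pow_add, Module.End.mul_apply,
    inv_pow_form bT _ hinv]

lemma mform_diag [CharP K 2] (hpq : p = q + q) (D₁ : Fac u₁ b₁ p q U₁) (D₂ : Fac u₂ b₂ p q U₂)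
    (bT : V₁ ⊗[K] V₂ →ₗ[K] V₁ ⊗[K] V₂ →ₗ[K] K)
    (hinv : ∀ x y, bT (TensorProduct.map u₁ u₂ x) (TensorProduct.map u₁ u₂ y) = bT x y)
    (hsym : ∀ x y, bT x y = bT y x) (g : W₁ ⊗[K] W₂) :
    mform D₁ D₂ bT g (TensorProduct.map U₁ U₂ g) = mform D₁ D₂ bT g g := by
  rw [mform_apply, mform_apply, iota_U]
  have hup : (TensorProduct.map u₁ u₂ : V₁ ⊗[K] V₂ →ₗ[K] V₁ ⊗[K] V₂) ^ p
      = TensorProduct.map u₁ u₂ ^ q * TensorProduct.map u₁ u₂ ^ q := by rw [hpq, pow_add]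
  rw [hup, Module.End.mul_apply, inv_pow_form bT _ hinv, hsym]

lemma key_form [CharP K 2] (hp : p = 2 ^ (r + 1)) (hq : q = 2 ^ r)
    (D₁ : Fac u₁ b₁ p q U₁) (D₂ : Fac u₂ b₂ p q U₂)
    (bT : V₁ ⊗[K] V₂ →ₗ[K] V₁ ⊗[K] V₂ →ₗ[K] K)
    (hbT : ∀ v w v' w', bT (v ⊗ₜ[K] w) (v' ⊗ₜ[K] w') = b₁ v v' * b₂ w w')
    (hinv₂ : ∀ v w, b₂ (u₂ v) (u₂ w) = b₂ v w) (hsym₂ : ∀ v w, b₂ v w = b₂ w v)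
    (hinv : ∀ x y, bT (TensorProduct.map u₁ u₂ x) (TensorProduct.map u₁ u₂ y) = bT x y)
    (hsym : ∀ x y, bT x y = bT y x) (d : ℕ) (a : W₁ ⊗[K] W₂)
    (ha : ((TensorProduct.map U₁ U₂ - 1 : W₁ ⊗[K] W₂ →ₗ[K] W₁ ⊗[K] W₂) ^ (d + 1)) a = 0) :
    ((TensorProduct.map u₁ u₂ - 1 : V₁ ⊗[K] V₂ →ₗ[K] V₁ ⊗[K] V₂) ^ (p * (d + 1)))
        (TensorProduct.map D₁.j D₂.j a) = 0 ∧
    bT (((TensorProduct.map u₁ u₂ - 1 : V₁ ⊗[K] V₂ →ₗ[K] V₁ ⊗[K] V₂) ^ (p * (d + 1) - 1))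
        (TensorProduct.map D₁.j D₂.j a)) (TensorProduct.map D₁.j D₂.j a) =
      mform D₁ D₂ bT
        (((TensorProduct.map U₁ U₂ - 1 : W₁ ⊗[K] W₂ →ₗ[K] W₁ ⊗[K] W₂) ^ d) a) a := by
  have hpw := intertwine_pow (TensorProduct.map D₁.j D₂.j) _ _ (iota_shift D₁ D₂)
  have h0 : ((TensorProduct.map u₁ u₂ ^ p - 1 : V₁ ⊗[K] V₂ →ₗ[K] V₁ ⊗[K] V₂) ^ (d + 1))
      (TensorProduct.map D₁.j D₂.j a) = 0 := by
    rw [← hpw, ha, map_zero]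
  constructor
  · have hup : (TensorProduct.map u₁ u₂ - 1 : V₁ ⊗[K] V₂ →ₗ[K] V₁ ⊗[K] V₂) ^ p
        = TensorProduct.map u₁ u₂ ^ p - 1 := by rw [hp, end_sub_pow]
    rw [pow_mul, hup]
    exact h0
  · rw [three_form bT _ hinv hsym r d p q hp hq _ h0, ← hpw, mform_apply]
    have hz := trace_zero_form
      (bT.compl₁₂ (TensorProduct.map D₁.j D₂.j) (TensorProduct.map D₁.j D₂.j))
      (formTensor D₁.M (b₂.compl₁₂ D₂.j D₂.j)) (TensorProduct.map U₁ U₂)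
      (tensor_form_inv D₁.M (b₂.compl₁₂ D₂.j D₂.j) _ (formTensor_tmul _ _) U₁ U₂ D₁.hMinv
        (fun v w => by
          rw [LinearMap.compl₁₂_apply, LinearMap.compl₁₂_apply, ← D₂.hj, ← D₂.hj,
            inv_pow_form b₂ u₂ hinv₂]))
      (by
        have : bT.compl₁₂ (TensorProduct.map D₁.j D₂.j) (TensorProduct.map D₁.j D₂.j)
            = formTensor D₁.M (b₂.compl₁₂ D₂.j D₂.j)
              + (formTensor D₁.M (b₂.compl₁₂ D₂.j D₂.j)).flip := by
          apply tensor_form_ext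
          intro v w v' w'
          rw [LinearMap.compl₁₂_apply, TensorProduct.map_tmul, TensorProduct.map_tmul, hbT, D₁.hM,
            LinearMap.add_apply, LinearMap.add_apply, LinearMap.flip_apply, formTensor_tmul,
            formTensor_tmul, LinearMap.compl₁₂_apply, LinearMap.compl₁₂_apply,
            hsym₂ (D₂.j w') (D₂.j w), add_mul]
        intro x y
        rw [this]
        rfl) d a ha
    rw [LinearMap.compl₁₂_apply] at hz
    rw [hz, zero_add]

lemma eps_odd [CharP K 2] [FiniteDimensional K W₁] [FiniteDimensional K W₂]
    (hp : p = 2 ^ (r + 1)) (hq : q = 2 ^ r)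
    (D₁ : Fac u₁ b₁ p q U₁) (D₂ : Fac u₂ b₂ p q U₂)
    (bT : V₁ ⊗[K] V₂ →ₗ[K] V₁ ⊗[K] V₂ →ₗ[K] K)
    (hbT : ∀ v w v' w', bT (v ⊗ₜ[K] w) (v' ⊗ₜ[K] w') = b₁ v v' * b₂ w w')
    (hinv₂ : ∀ v w, b₂ (u₂ v) (u₂ w) = b₂ v w) (hsym₂ : ∀ v w, b₂ v w = b₂ w v)
    (hinv : ∀ x y, bT (TensorProduct.map u₁ u₂ x) (TensorProduct.map u₁ u₂ y) = bT x y)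
    (hsym : ∀ x y, bT x y = bT y x) (d : ℕ)
    (hd : jordanMult K (TensorProduct.map U₁ U₂ - 1) (d + 1) = 1) :
    eps K (TensorProduct.map u₁ u₂ - 1) bT (p * (d + 1)) = 1 := by
  have hmt : ∀ v w v' w', mform D₁ D₂ bT (v ⊗ₜ[K] w) (v' ⊗ₜ[K] w')
      = b₁.compl₁₂ ((u₁ ^ q) ∘ₗ D₁.j) D₁.j v v' * b₂.compl₁₂ ((u₂ ^ q) ∘ₗ D₂.j) D₂.j w w' := by
    intro v w v' w'
    rw [mform_apply, TensorProduct.map_pow, TensorProduct.map_tmul, TensorProduct.map_tmul,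
      TensorProduct.map_tmul, hbT]
    rfl
  obtain ⟨a, ha, hne⟩ := nonzero_form (mform D₁ D₂ bT) (TensorProduct.map U₁ U₂)
    (mform_inv D₁ D₂ bT hinv)
    (tensor_nondeg _ _ (mform D₁ D₂ bT) hmt D₁.hnd D₂.hnd) d hd
  obtain ⟨k1, k2⟩ := key_form hp hq D₁ D₂ bT hbT hinv₂ hsym₂ hinv hsym d a ha
  rw [eps, if_pos]
  exact ⟨_, k1, by rw [k2]; exact hne⟩

lemma eps_even [CharP K 2] (hp : p = 2 ^ (r + 1)) (hq : q = 2 ^ r)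
    (D₁ : Fac u₁ b₁ p q U₁) (D₂ : Fac u₂ b₂ p q U₂)
    (bT : V₁ ⊗[K] V₂ →ₗ[K] V₁ ⊗[K] V₂ →ₗ[K] K)
    (hbT : ∀ v w v' w', bT (v ⊗ₜ[K] w) (v' ⊗ₜ[K] w') = b₁ v v' * b₂ w w')
    (hinv₁ : ∀ v w, b₁ (u₁ v) (u₁ w) = b₁ v w)
    (hinv₂ : ∀ v w, b₂ (u₂ v) (u₂ w) = b₂ v w) (hsym₂ : ∀ v w, b₂ v w = b₂ w v)
    (hinv : ∀ x y, bT (TensorProduct.map u₁ u₂ x) (TensorProduct.map u₁ u₂ y) = bT x y)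
    (hsym : ∀ x y, bT x y = bT y x) (n : ℕ) :
    eps K (TensorProduct.map u₁ u₂ - 1) bT (p * (2 * n + 2)) = 0 := by
  have hp1 : 1 ≤ p := by rw [hp]; exact Nat.one_le_two_pow
  rw [eps, if_neg]
  rintro ⟨x, hx, hne⟩
  apply hne
  have hpos : p * (2 * n + 2) - 1 + 1 = p * (2 * n + 2) :=
    Nat.sub_add_cancel (Nat.mul_pos hp1 (by omega))
  set T := nullSub bT (TensorProduct.map u₁ u₂) hinv hsym (p * (2 * n + 2) - 1) with hT
  suffices h : x ∈ T from h.2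
  have hx' : ((TensorProduct.map u₁ u₂ ^ p - 1 : V₁ ⊗[K] V₂ →ₗ[K] V₁ ⊗[K] V₂) ^ (2 * n + 2)) x
      = 0 := by
    have hup : (TensorProduct.map u₁ u₂ - 1 : V₁ ⊗[K] V₂ →ₗ[K] V₁ ⊗[K] V₂) ^ p
      = TensorProduct.map u₁ u₂ ^ p - 1 := by rw [hp, end_sub_pow]
    rw [pow_mul, hup] at hx
    exact hx
  have st1 : ∀ v ∈ T, TensorProduct.map (u₁ - 1) (1 : V₂ →ₗ[K] V₂) v ∈ T := by
    intro v hv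
    have e : TensorProduct.map (u₁ - 1) (1 : V₂ →ₗ[K] V₂)
        = TensorProduct.map u₁ (1 : V₂ →ₗ[K] V₂) - 1 := by
      apply TensorProduct.ext'
      intro a b
      simp [TensorProduct.sub_tmul]
    rw [e, LinearMap.sub_apply, Module.End.one_apply]
    refine T.sub_mem (nullSub_stable bT _ hinv hsym _ _ ?_ ?_ v hv) hv
    · rw [Commute, SemiconjBy, ← TensorProduct.map_mul, ← TensorProduct.map_mul, one_mul, mul_one]
    · exact tensor_form_inv b₁ b₂ bT hbT u₁ 1 hinv₁ (fun v w => rfl)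
  have st2 : ∀ v ∈ T, TensorProduct.map (1 : V₁ →ₗ[K] V₁) (u₂ - 1) v ∈ T := by
    intro v hv
    have e : TensorProduct.map (1 : V₁ →ₗ[K] V₁) (u₂ - 1)
        = TensorProduct.map (1 : V₁ →ₗ[K] V₁) u₂ - 1 := by
      apply TensorProduct.ext'
      intro a b
      simp [TensorProduct.tmul_sub]
    rw [e, LinearMap.sub_apply, Module.End.one_apply]
    refine T.sub_mem (nullSub_stable bT _ hinv hsym _ _ ?_ ?_ v hv) hv
    · rw [Commute, SemiconjBy, ← TensorProduct.map_mul, ← TensorProduct.map_mul, one_mul, mul_one]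
    · exact tensor_form_inv b₁ b₂ bT hbT 1 u₂ (fun v w => rfl) hinv₂
  have st : ∀ i i' : ℕ, ∀ v ∈ T,
      TensorProduct.map ((u₁ - 1) ^ i) ((u₂ - 1) ^ i') v ∈ T := by
    intro i i' v hv
    have e : TensorProduct.map ((u₁ - 1) ^ i) ((u₂ - 1) ^ i')
        = TensorProduct.map (u₁ - 1) (1 : V₂ →ₗ[K] V₂) ^ i
          * TensorProduct.map (1 : V₁ →ₗ[K] V₁) (u₂ - 1) ^ i' := by
      rw [TensorProduct.map_pow, TensorProduct.map_pow, ← TensorProduct.map_mul, one_pow, one_pow,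
        one_mul, mul_one]
    rw [e, Module.End.mul_apply]
    exact stable_pow T _ st1 i _ (stable_pow T _ st2 i' _ hv)
  rw [← decomp D₁ D₂ x]
  refine T.sum_mem fun i _ => T.sum_mem fun i' _ => st i i' _ ?_
  have ha : ((TensorProduct.map U₁ U₂ - 1 : W₁ ⊗[K] W₂ →ₗ[K] W₁ ⊗[K] W₂) ^ (2 * n + 1 + 1))
      (TensorProduct.map (D₁.pr i) (D₂.pr i') x) = 0 := by
    have := intertwine_pow (TensorProduct.map (D₁.pr i) (D₂.pr i')) _ _ (proj_shift D₁ D₂ i i')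
      (2 * n + 2) x
    rw [hx', map_zero] at this
    exact this.symm
  obtain ⟨k1, k2⟩ := key_form hp hq D₁ D₂ bT hbT hinv₂ hsym₂ hinv hsym (2 * n + 1) _ ha
  refine ⟨?_, ?_⟩
  · rw [hpos]
    exact k1
  · refine k2.trans ?_
    exact even_zero_form (mform D₁ D₂ bT) (TensorProduct.map U₁ U₂) (mform_inv D₁ D₂ bT hinv)
      (mform_diag (by rw [hp, hq]; ring) D₁ D₂ bT hinv hsym) n _ ha

end Assembly

section Final

lemma alt_symm {K : Type*} [Field K] [CharP K 2] {V : Type*} [AddCommGroup V] [Module K V]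
    (b : V →ₗ[K] V →ₗ[K] K) (halt : ∀ v, b v v = 0) (v w : V) : b v w = b w v := by
  have h := halt (v + w)
  simp only [map_add, LinearMap.add_apply, halt, zero_add, add_zero] at h
  first
    | exact CharTwo.add_eq_zero.1 h
    | exact (CharTwo.add_eq_zero.1 h).symm

lemma single_block {K : Type*} [Field K] [CharP K 2] {V : Type*} [AddCommGroup V] [Module K V]
    [FiniteDimensional K V] (u : V ≃ₗ[K] V) (hord : ∃ m : ℕ, u ^ (2 ^ m) = 1)
    (n r p q m : ℕ) (hp : p = 2 ^ (r + 1)) (hq : q = 2 ^ r) (hn : n = p * (2 * m + 1))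
    (hdim : finrank K V = n) (hblock : jordanMult K ((u : V →ₗ[K] V) - 1) n = 1)
    (b : V →ₗ[K] V →ₗ[K] K) (halt : ∀ v, b v v = 0) (hnd : ∀ v, (∀ w, b v w = 0) → v = 0)
    (hinv : ∀ v w, b (u v) (u w) = b v w) :
    (∃ Φ : (Fin n → K) ≃ₗ[K] V, ∀ w, Φ (jordanBlockMap K n w) = (u : V →ₗ[K] V) (Φ w)) ∧
    Nonempty (Fac (u : V →ₗ[K] V) b p q (jordanBlockMap K (2 * m + 1))) := by
  have hp1 : 1 ≤ p := by rw [hp]; exact Nat.one_le_two_pow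
  have hn1 : 1 ≤ n := by rw [hn]; exact Nat.mul_pos hp1 (by omega)
  obtain ⟨n', rfl⟩ : ∃ n', n = n' + 1 := ⟨n - 1, by omega⟩
  have hnil : IsNilpotent ((u : V →ₗ[K] V) - 1) := by
    obtain ⟨s, hs⟩ := hord
    refine ⟨2 ^ s, ?_⟩
    rw [end_sub_pow]
    have h2 : ∀ t : ℕ, (u : V →ₗ[K] V) ^ t = ((u ^ t : V ≃ₗ[K] V) : V →ₗ[K] V) := by
      intro t
      induction t with
      | zero => rfl
      | succ t ih => rw [pow_succ, pow_succ, ih]; rfl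
    rw [h2, hs]
    exact sub_self _
  obtain ⟨Φ, hΦ⟩ := block_equiv _ n' hdim hnil hblock
  refine ⟨⟨Φ, ?_⟩, ?_⟩
  · intro w
    rw [jordanBlockMap_eq, LinearMap.add_apply, map_add, hΦ, LinearMap.sub_apply,
      Module.End.one_apply, Module.End.one_apply]
    abel
  · obtain ⟨j, pr, M, h1, h2, h3, h4, h5, h6⟩ := factor (u : V →ₗ[K] V) r p q m (n' + 1) hp hq hn
      Φ hΦ b hinv (alt_symm b halt) halt hnd
    exact ⟨⟨j, pr, M, h1, h2, h3, h4, h5, h6⟩⟩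

lemma odd_part (n α : ℕ) (hn : 1 ≤ n) (h : padicValNat 2 n = α) :
    ∃ m, n = 2 ^ α * (2 * m + 1) := by
  obtain ⟨c, hc⟩ : 2 ^ α ∣ n := h ▸ pow_padicValNat_dvd
  have h2 : ¬ 2 ^ (α + 1) ∣ n := h ▸ pow_succ_padicValNat_not_dvd (by omega)
  rcases Nat.even_or_odd' c with ⟨m, rfl | rfl⟩
  · exact absurd ⟨m, by rw [hc]; ring⟩ h2
  · exact ⟨m, hc⟩

end Final

open TensorProduct in
/-- the Hesselink normal form of `V(2ℓ) ⊗ V(2k)` when `ν₂(ℓ) = ν₂(k) = α`: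
there is a unique Jordan block size `2e` of `u ⊗ u` with `ν₂(e) = α`; it has multiplicity
`2·2^α`, `e/2^α` is the unique odd Jordan block size of `V_{ℓ/2^α} ⊗ V_{k/2^α}`, and the
ε-invariant of the product form is `1` exactly at `2e`. -/
theorem tensor_of_single_blocks_same_valuation
    (K : Type*) [Field K] [IsAlgClosed K] [CharP K 2]
    (V₁ : Type*) [AddCommGroup V₁] [Module K V₁] [FiniteDimensional K V₁]
    (V₂ : Type*) [AddCommGroup V₂] [Module K V₂] [FiniteDimensional K V₂]
    (ℓ k : ℕ) (hℓ : 1 ≤ ℓ) (hk : 1 ≤ k)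
    (α : ℕ) (hα : padicValNat 2 ℓ = α ∧ padicValNat 2 k = α)
    (u₁ : V₁ ≃ₗ[K] V₁) (u₂ : V₂ ≃ₗ[K] V₂)
    (hord₁ : ∃ m : ℕ, u₁ ^ (2 ^ m) = 1) (hord₂ : ∃ m : ℕ, u₂ ^ (2 ^ m) = 1)
    (hdim₁ : Module.finrank K V₁ = 2 * ℓ) (hdim₂ : Module.finrank K V₂ = 2 * k)
    (hblock₁ : jordanMult K ((u₁ : V₁ →ₗ[K] V₁) - 1) (2 * ℓ) = 1)
    (hblock₂ : jordanMult K ((u₂ : V₂ →ₗ[K] V₂) - 1) (2 * k) = 1)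
    (b₁ : V₁ →ₗ[K] V₁ →ₗ[K] K) (b₂ : V₂ →ₗ[K] V₂ →ₗ[K] K)
    (halt₁ : ∀ v, b₁ v v = 0) (halt₂ : ∀ v, b₂ v v = 0)
    (hnd₁ : ∀ v, (∀ w, b₁ v w = 0) → v = 0) (hnd₂ : ∀ v, (∀ w, b₂ v w = 0) → v = 0)
    (hinv₁ : ∀ v w, b₁ (u₁ v) (u₁ w) = b₁ v w) (hinv₂ : ∀ v w, b₂ (u₂ v) (u₂ w) = b₂ v w)
    (bT : V₁ ⊗[K] V₂ →ₗ[K] V₁ ⊗[K] V₂ →ₗ[K] K)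
    (hbT : ∀ (v : V₁) (w : V₂) (v' : V₁) (w' : V₂),
      bT (v ⊗ₜ[K] w) (v' ⊗ₜ[K] w') = b₁ v v' * b₂ w w') :
    ∃ e : ℕ, 1 ≤ e ∧
      jordanMult K ((TensorProduct.congr u₁ u₂).toLinearMap - 1) (2 * e) ≠ 0 ∧
      padicValNat 2 e = α ∧
      (∀ e' : ℕ, 1 ≤ e' →
        jordanMult K ((TensorProduct.congr u₁ u₂).toLinearMap - 1) (2 * e') ≠ 0 →
        padicValNat 2 e' = α → e' = e) ∧
      jordanMult K ((TensorProduct.congr u₁ u₂).toLinearMap - 1) (2 * e) = 2 * 2 ^ α ∧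
      Odd (e / 2 ^ α) ∧
      jordanMult K
        (TensorProduct.map (jordanBlockMap K (ℓ / 2 ^ α)) (jordanBlockMap K (k / 2 ^ α)) - 1)
        (e / 2 ^ α) ≠ 0 ∧
      eps K ((TensorProduct.congr u₁ u₂).toLinearMap - 1) bT (2 * e) = 1 ∧
      (∀ d : ℕ, 1 ≤ d → d ≠ 2 * e →
        eps K ((TensorProduct.congr u₁ u₂).toLinearMap - 1) bT d = 0) := by
  obtain ⟨hα₁, hα₂⟩ := hα
  obtain ⟨m₁, hm₁⟩ := odd_part ℓ α hℓ hα₁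
  obtain ⟨m₂, hm₂⟩ := odd_part k α hk hα₂
  have hn₁ : 2 * ℓ = 2 ^ (α + 1) * (2 * m₁ + 1) := by rw [hm₁]; ring
  have hn₂ : 2 * k = 2 ^ (α + 1) * (2 * m₂ + 1) := by rw [hm₂]; ring
  obtain ⟨⟨Φ₁, hΦ₁⟩, ⟨D₁⟩⟩ := single_block u₁ hord₁ (2 * ℓ) α _ _ m₁ rfl rfl hn₁ hdim₁ hblock₁
    b₁ halt₁ hnd₁ hinv₁
  obtain ⟨⟨Φ₂, hΦ₂⟩, ⟨D₂⟩⟩ := single_block u₂ hord₂ (2 * k) α _ _ m₂ rfl rfl hn₂ hdim₂ hblock₂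
    b₂ halt₂ hnd₂ hinv₂
  have hu : (TensorProduct.congr u₁ u₂).toLinearMap
      = TensorProduct.map (u₁ : V₁ →ₗ[K] V₁) (u₂ : V₂ →ₗ[K] V₂) := rfl
  rw [hu]
  have hsym₁ := alt_symm b₁ halt₁
  have hsym₂ := alt_symm b₂ halt₂
  have hsym := tensor_form_sym b₁ b₂ bT hbT hsym₁ hsym₂
  have hinv := tensor_form_inv b₁ b₂ bT hbT (u₁ : V₁ →ₗ[K] V₁) (u₂ : V₂ →ₗ[K] V₂) hinv₁ hinv₂
  have hjm : ∀ d, jordanMult K (TensorProduct.map (u₁ : V₁ →ₗ[K] V₁) (u₂ : V₂ →ₗ[K] V₂) - 1) d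
      = mlt K (2 ^ (α + 1) * (2 * m₁ + 1)) (2 ^ (α + 1) * (2 * m₂ + 1)) d := by
    intro d
    rw [← hn₁, ← hn₂]
    exact (jm_conj (TensorProduct.congr Φ₁ Φ₂) _ _
      (conj_tensor Φ₁ Φ₂ _ _ _ _ hΦ₁ hΦ₂) d).symm
  obtain ⟨j, hj1, hj0⟩ := unique_odd_block K ((2 * m₁ + 1) + (2 * m₂ + 1)) (2 * m₁ + 1)
    (2 * m₂ + 1) le_rfl ⟨m₁, rfl⟩ ⟨m₂, rfl⟩
  have hpos : 0 < 2 ^ α := by positivity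
  have h2e : 2 * (2 ^ α * (2 * j + 1)) = 2 ^ (α + 1) * (2 * j + 1) := by ring
  have hmult : jordanMult K
      (TensorProduct.map (u₁ : V₁ →ₗ[K] V₁) (u₂ : V₂ →ₗ[K] V₂) - 1)
      (2 * (2 ^ α * (2 * j + 1))) = 2 * 2 ^ α := by
    rw [hjm, h2e, mlt_pow K (α + 1) _ _ _ (by omega), hj1]
    ring
  have hval : padicValNat 2 (2 ^ α * (2 * j + 1)) = α := by
    rw [padicValNat.mul (by positivity) (by omega), padicValNat.prime_pow,
      padicValNat.eq_zero_of_not_dvd (by omega), add_zero]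
  refine ⟨2 ^ α * (2 * j + 1), Nat.mul_pos hpos (by omega), ?_, hval, ?_, hmult, ?_, ?_, ?_, ?_⟩
  · rw [hmult]; positivity
  · intro e' he' hne hv
    obtain ⟨i, hi⟩ := odd_part e' α he' hv
    by_contra hcon
    apply hne
    have hij : i ≠ j := by
      rintro rfl
      exact hcon hi
    rw [hjm, hi, show 2 * (2 ^ α * (2 * i + 1)) = 2 ^ (α + 1) * (2 * i + 1) by ring,
      mlt_pow K (α + 1) _ _ _ (by omega), hj0 i hij, mul_zero]
  · rw [Nat.mul_div_cancel_left _ hpos]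
    exact ⟨j, rfl⟩
  · rw [Nat.mul_div_cancel_left _ hpos, hm₁, hm₂, Nat.mul_div_cancel_left _ hpos,
      Nat.mul_div_cancel_left _ hpos]
    have : mlt K (2 * m₁ + 1) (2 * m₂ + 1) (2 * j + 1) ≠ 0 := by rw [hj1]; exact one_ne_zero
    exact this
  · rw [h2e]
    exact eps_odd rfl rfl D₁ D₂ bT hbT hinv₂ hsym₂ hinv hsym (2 * j) hj1
  · intro d hd hne
    have hz : mlt K (2 ^ (α + 1) * (2 * m₁ + 1)) (2 ^ (α + 1) * (2 * m₂ + 1)) d = 0 →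
        eps K (TensorProduct.map (u₁ : V₁ →ₗ[K] V₁) (u₂ : V₂ →ₗ[K] V₂) - 1) bT d = 0 := by
      intro h
      obtain ⟨d', rfl⟩ : ∃ d', d = d' + 1 := ⟨d - 1, by omega⟩
      exact eps_zero_of_jm bT _ hinv hsym d' (by rw [hjm, h])
    by_cases hdv : 2 ^ (α + 1) ∣ d
    · obtain ⟨c, rfl⟩ := hdv
      rcases Nat.even_or_odd' c with ⟨i, rfl | rfl⟩
      · obtain ⟨n, rfl⟩ : ∃ n, i = n + 1 := by
          refine ⟨i - 1, ?_⟩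
          rcases Nat.eq_zero_or_pos i with rfl | h
          · simp at hd
          · omega
        exact eps_even rfl rfl D₁ D₂ bT hbT hinv₁ hinv₂ hsym₂ hinv hsym n
      · apply hz
        have hij : i ≠ j := by
          rintro rfl
          exact hne h2e.symm
        rw [mlt_pow K (α + 1) _ _ _ (by omega), hj0 i hij, mul_zero]
    · exact hz (mlt_not_dvd K (α + 1) _ _ d hd hdv)
end
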